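/- (Eichler's class number formula for B_{p,∞}) Let p be a prime and Λ(p) a maximal ℤ-order in the quaternion ℚ-algebra B_{p,∞} ramified exactly at p and ∞. Then the class number h(Λ(p)) — the number of isomorphism classes of locally free right Λ(p)-ideals — equals (p−1)/12 + (1/3)(1 − (−3/p)) + (1/4)(1 − (−4/p)), where (·/p) is the Legendre symbol (taken to be 0 when p divides the numerator's discriminant entry as usual for p = 2, 3). In particular h(Λ(p)) = 1 if and only if p ∈ {2, 3, 5, 7, 13}. -/

import Mathlib

open scoped TensorProduct
open IsDedekindDomain

noncomputable section

/-- A field `K` is a *global field* if it is a number field (finite extension of `ℚ`) or a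
global function field (finite separable extension of `𝔽_p(t)` for some prime `p` and some
element `t` transcendental over the prime field `𝔽_p`; `𝔽_p(t)` is realised as the subfield
`Subfield.closure {t}` generated by `t`, and transcendence of `t` as infiniteness of this
subfield). -/
def IsGlobalField (K : Type*) [Field K] : Prop :=
  NumberField K ∨
    ∃ (p : ℕ) (t : K), p.Prime ∧ CharP K p ∧
      Infinite ↥(Subfield.closure ({t} : Set K)) ∧
      Module.Finite ↥(Subfield.closure ({t} : Set K)) K ∧
      Algebra.IsSeparable ↥(Subfield.closure ({t} : Set K)) K


/-- A `K`-algebra is *separable* if it remains semisimple after base change to an algebraic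
closure of `K` (equivalently, it is semisimple with centre a product of finite separable
field extensions of `K`). -/
def IsSeparableAlgebra (K : Type*) [Field K] (A : Type*) [Ring A] [Algebra K A] : Prop :=
  IsSemisimpleRing ((AlgebraicClosure K) ⊗[K] A)

variable (R : Type*) [CommRing R] [IsDedekindDomain R]
variable (K : Type*) [Field K] [Algebra R K] [IsFractionRing R K]
variable (A : Type*) [Ring A] [Algebra K A] [FiniteDimensional K A]
variable [Algebra R A] [IsScalarTower R K A]

/-- An `R`-order in the `K`-algebra `A`: an `R`-subring of `A` which is finitely generated
as an `R`-module and spans `A` over `K`. -/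
def IsROrder (Λ : Subalgebra R A) : Prop :=
  Module.Finite R ↥Λ ∧ Submodule.span K (Λ : Set A) = ⊤

/-- The completion `A_v = K_v ⊗[K] A` of `A` at a finite place (height-one prime) `v` of `R`. -/
def PlaceAlgebra (v : HeightOneSpectrum R) : Type _ := v.adicCompletion K ⊗[K] A

instance (v : HeightOneSpectrum R) : Ring (PlaceAlgebra R K A v) :=
  inferInstanceAs (Ring (v.adicCompletion K ⊗[K] A))

/-- The canonical identification of `K_v ⊗[K] A` with the completed algebra `A_v`. -/
def PlaceAlgebra.of (v : HeightOneSpectrum R) (z : v.adicCompletion K ⊗[K] A) :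
    PlaceAlgebra R K A v := z

/-- The completed order `Λ_v = R_v ⊗[R] Λ`, realised as the subring of `A_v` generated by
the valuation integers `O_v` of `K_v` and by (the image of) `Λ`; this is exactly the
`O_v`-span of the image of `Λ`. -/
def orderAt (Λ : Subalgebra R A) (v : HeightOneSpectrum R) : Subring (PlaceAlgebra R K A v) :=
  Subring.closure
    ((fun c : v.adicCompletion K => PlaceAlgebra.of R K A v (c ⊗ₜ[K] (1 : A))) ''
        (v.adicCompletionIntegers K : Set (v.adicCompletion K)) ∪
      (fun a : A => PlaceAlgebra.of R K A v ((1 : v.adicCompletion K) ⊗ₜ[K] a)) '' (Λ : Set A))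

/-- The completed lattice `J_v = R_v ⊗[R] J ⊆ A_v`, the `O_v`-span of the image of `J`. -/
def latticeAt (J : Submodule R A) (v : HeightOneSpectrum R) :
    AddSubgroup (PlaceAlgebra R K A v) :=
  AddSubgroup.closure
    {z | ∃ c ∈ (v.adicCompletionIntegers K : Set (v.adicCompletion K)),
      ∃ x ∈ J, z = PlaceAlgebra.of R K A v (c ⊗ₜ[K] x)}

/-- A *locally free (right) `Λ`-ideal* in `A`: a full `R`-lattice `J` in `A` (a finitely
generated `R`-submodule spanning `A` over `K`) which is a right `Λ`-module and whose
completion at every finite place `v` is a free `Λ_v`-module of rank one, i.e.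
`J_v = u ⬝ Λ_v` for some unit `u` of `A_v`. -/
structure LocallyFreeIdeal (Λ : Subalgebra R A) where
  carrier : Submodule R A
  fg : carrier.FG
  spans : Submodule.span K (carrier : Set A) = ⊤
  right_mul : ∀ x ∈ carrier, ∀ a ∈ Λ, x * a ∈ carrier
  locallyFree : ∀ v : HeightOneSpectrum R, ∃ u : (PlaceAlgebra R K A v)ˣ,
      (latticeAt R K A carrier v : Set (PlaceAlgebra R K A v)) =
        (fun y : PlaceAlgebra R K A v => u.val * y) ''
          (orderAt R K A Λ v : Set (PlaceAlgebra R K A v))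

variable {R K A}

/-- A right `Λ`-module isomorphism between additive subgroups of `Fin m → A` which are stable
under the diagonal right multiplication by elements of `Λ`: an additive equivalence commuting
with right multiplication by every element of `Λ`. -/
def RightLamIso (Λ : Subalgebra R A) {m : ℕ} (P Q : AddSubgroup (Fin m → A)) : Prop :=
  ∃ e : P ≃+ Q, ∀ (z : P) (a : A), a ∈ Λ →
    ∀ h : (fun i => z.val i * a) ∈ P,
      (e ⟨fun i => z.val i * a, h⟩).val = fun i => (e z).val i * a

/-- The external direct sum `M 0 ⊕ ⋯ ⊕ M (m-1)` of `R`-submodules of `A`, realised as an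
additive subgroup of `Fin m → A`. -/
def sumLat {m : ℕ} (Ms : Fin m → Submodule R A) : AddSubgroup (Fin m → A) :=
  AddSubgroup.pi Set.univ fun i => (Ms i).toAddSubgroup

/-- Isomorphism of locally free right `Λ`-ideals as right `Λ`-modules. -/
def IdealIso (Λ : Subalgebra R A) (I I' : LocallyFreeIdeal R K A Λ) : Prop :=
  RightLamIso Λ (sumLat ![I.carrier]) (sumLat ![I'.carrier])

/-- The lattice `J ⊕ Λ^r`, as an additive subgroup of `Fin (r+1) → A`. -/
def stdLat (Λ : Subalgebra R A) (J : Submodule R A) (r : ℕ) :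
    AddSubgroup (Fin (r + 1) → A) :=
  sumLat (Fin.cons J fun _ => Subalgebra.toSubmodule Λ)

/-- Two locally free right `Λ`-ideals `J`, `J'` are *stably isomorphic* if
`J ⊕ Λ^r ≅ J' ⊕ Λ^r` as right `Λ`-modules for some `r ≥ 0`. -/
def StablyIsomorphic (Λ : Subalgebra R A) (I I' : LocallyFreeIdeal R K A Λ) : Prop :=
  ∃ r : ℕ, RightLamIso Λ (stdLat Λ I.carrier r) (stdLat Λ I'.carrier r)

end

/-- A ring is a division ring: it is nontrivial and every non-zero element is invertible. -/
def IsDivisionRingCarrier (B : Type*) [Ring B] : Prop :=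
  Nontrivial B ∧ ∀ x : B, x ≠ 0 → IsUnit x

/-- `A` is (isomorphic to) the quaternion algebra `B_{p,∞}` over `ℚ`: a central simple
`ℚ`-algebra of dimension `4` whose set of ramified places of `ℚ` is exactly `{p, ∞}`,
i.e. it is a division algebra after base change to `ℝ` and to `ℚ_p`, and it is split
(not division) after base change to `ℚ_ℓ` for every prime `ℓ ≠ p`. -/
def IsQuaternionRamifiedExactlyAtPAndInfty (p : ℕ) (A : Type*) [Ring A] [Algebra ℚ A] :
    Prop :=
  Module.finrank ℚ A = 4 ∧ Algebra.IsCentral ℚ A ∧ IsSimpleRing A ∧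
  IsDivisionRingCarrier (ℝ ⊗[ℚ] A) ∧
  (∀ hp : p.Prime, haveI : Fact p.Prime := ⟨hp⟩;
    IsDivisionRingCarrier (ℚ_[p] ⊗[ℚ] A)) ∧
  (∀ (ℓ : ℕ) (hl : ℓ.Prime), ℓ ≠ p → haveI : Fact ℓ.Prime := ⟨hl⟩;
    ¬ IsDivisionRingCarrier (ℚ_[ℓ] ⊗[ℚ] A))

noncomputable section

variable {A : Type*} [Ring A] [Algebra ℚ A] [FiniteDimensional ℚ A]
  [Algebra ℤ A] [IsScalarTower ℤ ℚ A]

/-- The Kronecker symbol `(d/p)` for a prime `p` (agreeing with the Legendre symbol for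
odd `p`, with the usual convention at `p = 2`, and vanishing when `p ∣ d`). -/
def kroneckerSymbol (d : ℤ) (p : ℕ) (hp : p.Prime) : ℤ :=
  if p = 2 then (if (2 : ℤ) ∣ d then 0 else if d % 8 = 1 ∨ d % 8 = 7 then 1 else -1)
  else haveI : Fact p.Prime := ⟨hp⟩; legendreSym p d

namespace Eich

/-- Reduced trace and norm on a definite quaternion division algebra. -/
structure QD (D : Type*) [DivisionRing D] [CharZero D] where
  fin : Module.finrank ℚ D = 4
  central : ∀ x : D, (∀ y, x * y = y * x) → ∃ q : ℚ, x = algebraMap ℚ D q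
  trd : D →ₗ[ℚ] ℚ
  nrd : D → ℚ
  trd_one : trd 1 = 2
  trd_comm : ∀ x y, trd (x * y) = trd (y * x)
  rel : ∀ x, x * x = trd x • x - nrd x • (1 : D)
  pos : ∀ x, x ≠ 0 → 0 < nrd x

namespace QD
variable {D : Type*} [DivisionRing D] [CharZero D] (Q : QD D)

def conj (x : D) : D := Q.trd x • (1 : D) - x

lemma smul_one_inj {a b : ℚ} (h : a • (1 : D) = b • (1 : D)) : a = b :=
  smul_left_injective ℚ (one_ne_zero : (1 : D) ≠ 0) h

lemma mul_conj (x : D) : x * Q.conj x = Q.nrd x • (1 : D) := by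
  rw [conj, mul_sub, Q.rel, mul_smul_comm, mul_one]; abel

lemma conj_mul_self (x : D) : Q.conj x * x = Q.nrd x • (1 : D) := by
  rw [conj, sub_mul, Q.rel, smul_mul_assoc, one_mul]; abel

lemma conj_add (x y : D) : Q.conj (x + y) = Q.conj x + Q.conj y := by
  simp only [conj, map_add, add_smul]; abel

lemma conj_smul (a : ℚ) (x : D) : Q.conj (a • x) = a • Q.conj x := by
  simp only [conj, map_smul, smul_sub, smul_smul, smul_eq_mul]

lemma conj_neg (x : D) : Q.conj (-x) = - Q.conj x := by
  simp only [conj, map_neg, neg_smul]; abel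

lemma trd_smul_one (a : ℚ) : Q.trd (a • (1 : D)) = 2 * a := by
  rw [map_smul, Q.trd_one, smul_eq_mul, mul_comm]

lemma trd_conj (x : D) : Q.trd (Q.conj x) = Q.trd x := by
  rw [conj, map_sub, trd_smul_one]; ring

lemma conj_conj (x : D) : Q.conj (Q.conj x) = x := by
  rw [conj, trd_conj, conj]; abel

lemma nrd_conj (x : D) : Q.nrd (Q.conj x) = Q.nrd x := by
  apply smul_one_inj (D := D)
  rw [← mul_conj, conj_conj, conj_mul_self]

lemma nrd_zero : Q.nrd 0 = 0 := by
  apply smul_one_inj (D := D)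
  rw [← mul_conj, zero_mul, zero_smul]

lemma nrd_nonneg (x : D) : 0 ≤ Q.nrd x := by
  by_cases h : x = 0
  · rw [h, nrd_zero]
  · exact (Q.pos x h).le

lemma nrd_eq_zero {x : D} : Q.nrd x = 0 ↔ x = 0 := by
  constructor
  · intro h; by_contra h'; exact (Q.pos x h').ne' h
  · rintro rfl; exact Q.nrd_zero

/-- Polar form lies in `ℚ`. -/
lemma polar (x y : D) : x * Q.conj y + y * Q.conj x
    = (Q.nrd (x + y) - Q.nrd x - Q.nrd y) • (1 : D) := by
  rw [sub_smul, sub_smul, ← mul_conj, ← mul_conj, ← mul_conj, conj_add, add_mul, mul_add, mul_add]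
  abel

lemma conj_mul (x y : D) : Q.conj (x * y) = Q.conj y * Q.conj x := by
  have h := Q.polar x (Q.conj y)
  rw [conj_conj] at h
  set c := Q.nrd (x + Q.conj y) - Q.nrd x - Q.nrd (Q.conj y)
  have h2 := congrArg Q.trd h
  have h3 : Q.trd (Q.conj y * Q.conj x) = Q.trd (x * y) := by
    simp only [conj, sub_mul, mul_sub, smul_mul_assoc, mul_smul_comm, one_mul, mul_one, map_sub,
      map_smul, Q.trd_one, smul_eq_mul]
    rw [Q.trd_comm y x]; ring
  rw [map_add, h3, trd_smul_one] at h2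
  have h4 : c = Q.trd (x * y) := by linarith
  rw [h4] at h
  rw [conj, ← h]; abel

lemma nrd_mul (x y : D) : Q.nrd (x * y) = Q.nrd x * Q.nrd y := by
  apply smul_one_inj (D := D)
  rw [← mul_conj, conj_mul, mul_assoc, ← mul_assoc y, mul_conj, smul_mul_assoc, one_mul,
    mul_smul_comm, mul_conj, smul_smul, mul_comm]

lemma nrd_smul (a : ℚ) (x : D) : Q.nrd (a • x) = a ^ 2 * Q.nrd x := by
  apply smul_one_inj (D := D)
  rw [← mul_conj, conj_smul, smul_mul_smul_comm, mul_conj, smul_smul, sq]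

lemma nrd_one : Q.nrd 1 = 1 := by
  apply smul_one_inj (D := D)
  have := Q.mul_conj 1
  rw [← this, conj, Q.trd_one, one_mul, two_smul, one_smul]; abel

lemma nrd_neg (x : D) : Q.nrd (-x) = Q.nrd x := by
  have := Q.nrd_smul (-1) x
  rwa [neg_one_smul, neg_one_sq, one_mul] at this

lemma nrd_inv (x : D) : Q.nrd x⁻¹ = (Q.nrd x)⁻¹ := by
  by_cases h : x = 0
  · simp [h, nrd_zero]
  · apply eq_inv_of_mul_eq_one_left
    rw [← nrd_mul, inv_mul_cancel₀ h, nrd_one]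

/-- the bilinear form `trd (x * conj y)` -/
def B (x y : D) : ℚ := Q.trd (x * Q.conj y)

lemma B_comm (x y : D) : Q.B x y = Q.B y x := by
  rw [B, ← trd_conj, conj_mul, conj_conj, B]

lemma nrd_add (x y : D) : Q.nrd (x + y) = Q.nrd x + Q.nrd y + Q.B x y := by
  have h := congrArg Q.trd (Q.polar x y)
  rw [map_add, trd_smul_one] at h
  have : Q.trd (y * Q.conj x) = Q.B x y := Q.B_comm y x
  rw [this] at h
  change Q.B x y + Q.B x y = _ at h
  linarith

lemma B_self (x : D) : Q.B x x = 2 * Q.nrd x := by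
  rw [B, mul_conj, trd_smul_one]

lemma B_add_left (x y z : D) : Q.B (x + y) z = Q.B x z + Q.B y z := by
  simp [B, add_mul]
lemma B_smul_left (a : ℚ) (x z : D) : Q.B (a • x) z = a * Q.B x z := by
  simp [B]
lemma B_mul_left (a x y : D) : Q.B (a * x) (a * y) = Q.nrd a * Q.B x y := by
  rw [B, conj_mul, B, mul_assoc, Q.trd_comm, mul_assoc, mul_assoc, conj_mul_self,
    mul_smul_comm, mul_smul_comm, mul_one, map_smul, smul_eq_mul]

lemma trd_sq (x : D) : Q.trd (x * x) = Q.trd x ^ 2 - 2 * Q.nrd x := by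
  rw [Q.rel, map_sub, trd_smul_one, map_smul, smul_eq_mul, sq]

lemma trd_eq (x : D) : Q.trd x = Q.nrd (x + 1) - Q.nrd x - 1 := by
  rw [nrd_add, nrd_one, B]
  have : Q.conj (1 : D) = 1 := by rw [conj, Q.trd_one, two_smul]; abel
  rw [this, mul_one]; ring

lemma disc_nonpos (x : D) : Q.trd x ^ 2 ≤ 4 * Q.nrd x := by
  have h := Q.nrd_nonneg (x - (Q.trd x / 2) • 1)
  rw [sub_eq_add_neg, nrd_add, ← neg_smul, nrd_smul, nrd_one, B, conj_smul] at h
  have : Q.conj (1 : D) = 1 := by rw [conj, Q.trd_one, two_smul]; abel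
  rw [this, mul_smul_comm, map_smul, smul_eq_mul, mul_one, mul_one] at h
  nlinarith

lemma disc_zero {x : D} (h0 : Q.trd x ^ 2 = 4 * Q.nrd x) : x = (Q.trd x / 2) • (1 : D) := by
  have h : Q.nrd (x - (Q.trd x / 2) • 1) = 0 := by
    rw [sub_eq_add_neg, nrd_add, ← neg_smul, nrd_smul, nrd_one, B, conj_smul]
    have : Q.conj (1 : D) = 1 := by rw [conj, Q.trd_one, two_smul]; abel
    rw [this, mul_smul_comm, map_smul, smul_eq_mul, mul_one, mul_one]
    nlinarith
  exact sub_eq_zero.1 (Q.nrd_eq_zero.1 h)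

lemma rel_unique {x : D} {t n : ℚ} (h : x * x = t • x - n • (1 : D))
    (hx : ∀ q : ℚ, x ≠ q • (1 : D)) : Q.trd x = t ∧ Q.nrd x = n := by
  have h1 := Q.rel x
  rw [h] at h1
  have h2 : (t - Q.trd x) • x = (n - Q.nrd x) • (1 : D) := by
    rw [sub_smul, sub_smul]
    exact sub_eq_sub_iff_sub_eq_sub.1 h1
  have h3 : t - Q.trd x = 0 := by
    by_contra h0
    apply hx ((t - Q.trd x)⁻¹ * (n - Q.nrd x))
    rw [mul_smul, ← h2, smul_smul, inv_mul_cancel₀ h0, one_smul]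
  rw [h3, zero_smul] at h2
  have h4 : n - Q.nrd x = 0 := by
    apply smul_one_inj (D := D); rw [← h2, zero_smul]
  constructor <;> linarith
end QD
end Eich

namespace Eich
section
variable {D : Type*} [DivisionRing D] [CharZero D]

set_option linter.unusedSectionVars false
/-- finitely generated -/
def Fg (I : AddSubgroup D) : Prop := (AddSubgroup.toIntSubmodule I).FG

/-- full lattice -/
def IsLat (I : AddSubgroup D) : Prop := Fg I ∧ ∀ x : D, ∃ m : ℕ, 0 < m ∧ m • x ∈ I

lemma fg_of_le {I J : AddSubgroup D} (h : I ≤ J) (hJ : Fg J) : Fg I :=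
  Submodule.FG.of_le hJ ((AddSubgroup.toIntSubmodule).monotone h)

lemma Fg.map {I : AddSubgroup D} (h : Fg I) (f : D →+ D) : Fg (I.map f) :=
  Submodule.FG.map f.toIntLinearMap h

lemma exists_nsmul_le {I J : AddSubgroup D} (hI : Fg I) (hJ : IsLat J) :
    ∃ m : ℕ, 0 < m ∧ ∀ x ∈ I, m • x ∈ J := by
  obtain ⟨S, hS⟩ := hI
  choose f hf hf' using hJ.2
  refine ⟨∏ s ∈ S, f s, Finset.prod_pos fun i _ => hf i, fun x hx => ?_⟩
  change x ∈ AddSubgroup.toIntSubmodule I at hx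
  rw [← hS] at hx
  induction hx using Submodule.span_induction with
  | mem x hx =>
    obtain ⟨c, hc⟩ := Finset.dvd_prod_of_mem f hx
    rw [hc, mul_comm, mul_smul]; exact J.nsmul_mem (hf' x) c
  | zero => simp
  | add x y _ _ h1 h2 => rw [smul_add]; exact J.add_mem h1 h2
  | smul z x _ h => rw [smul_comm]; exact J.zsmul_mem h z

/-- left multiple of a lattice -/
def lm (x : D) (I : AddSubgroup D) : AddSubgroup D := I.map (AddMonoidHom.mulLeft x)

lemma mem_lm {x y : D} {I : AddSubgroup D} : y ∈ lm x I ↔ ∃ z ∈ I, x * z = y := Iff.rfl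

lemma mem_lm' {x y : D} (hx : x ≠ 0) {I : AddSubgroup D} : y ∈ lm x I ↔ x⁻¹ * y ∈ I := by
  rw [mem_lm]; constructor
  · rintro ⟨z, hz, rfl⟩; rwa [inv_mul_cancel_left₀ hx]
  · intro h; exact ⟨_, h, mul_inv_cancel_left₀ hx y⟩

lemma lm_mul (x y : D) (I : AddSubgroup D) : lm (x * y) I = lm x (lm y I) := by
  ext z; simp only [mem_lm]; constructor
  · rintro ⟨w, hw, rfl⟩; exact ⟨_, ⟨w, hw, rfl⟩, (mul_assoc _ _ _).symm⟩
  · rintro ⟨_, ⟨w, hw, rfl⟩, rfl⟩; exact ⟨w, hw, (mul_assoc _ _ _)⟩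

lemma lm_one (I : AddSubgroup D) : lm 1 I = I := by
  ext z; simp [mem_lm]

lemma lm_mono (x : D) {I J : AddSubgroup D} (h : I ≤ J) : lm x I ≤ lm x J :=
  AddSubgroup.map_mono h

lemma lm_le_iff {x : D} {I J : AddSubgroup D} : lm x I ≤ J ↔ ∀ y ∈ I, x * y ∈ J := by
  constructor
  · intro h y hy; exact h ⟨y, hy, rfl⟩
  · rintro h _ ⟨y, hy, rfl⟩; exact h y hy

lemma IsLat.lm {I : AddSubgroup D} (h : IsLat I) {x : D} (hx : x ≠ 0) : IsLat (lm x I) := by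
  refine ⟨h.1.map _, fun y => ?_⟩
  obtain ⟨m, hm, h'⟩ := h.2 (x⁻¹ * y)
  refine ⟨m, hm, (mem_lm' hx).2 ?_⟩
  rwa [mul_smul_comm]

lemma IsLat.mono {I J : AddSubgroup D} (h : IsLat I) (hIJ : I ≤ J) (hJ : Fg J) : IsLat J :=
  ⟨hJ, fun x => let ⟨m, hm, h'⟩ := h.2 x; ⟨m, hm, hIJ h'⟩⟩

lemma smul_inj_nat {m : ℕ} (hm : 0 < m) {x y : D} (h : m • x = m • y) : x = y :=
  smul_right_injective D hm.ne' h

lemma IsLat.of_nsmul {I J : AddSubgroup D} (h : IsLat J) (hIJ : J ≤ I) {m : ℕ} (hm : 0 < m)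
    (hh : ∀ x ∈ I, m • x ∈ J) : IsLat I := by
  refine h.mono hIJ ?_
  have h1 : Function.Injective (AddMonoidHom.mulLeft (m : D)) := by
    intro x y hxy; simp only [AddMonoidHom.coe_mulLeft] at hxy
    exact mul_left_cancel₀ (by exact_mod_cast hm.ne') hxy
  refine Submodule.fg_of_fg_map_injective (AddMonoidHom.mulLeft (m : D)).toIntLinearMap h1 ?_
  refine fg_of_le (I := I.map (AddMonoidHom.mulLeft (m : D))) ?_ h.1
  rintro _ ⟨x, hx, rfl⟩
  simpa [nsmul_eq_mul] using hh x hx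

lemma IsLat.inf {I J : AddSubgroup D} (hI : IsLat I) (hJ : IsLat J) : IsLat (I ⊓ J) := by
  refine ⟨fg_of_le inf_le_left hI.1, fun x => ?_⟩
  obtain ⟨m, hm, h⟩ := hI.2 x
  obtain ⟨n, hn, h'⟩ := hJ.2 x
  refine ⟨m * n, Nat.mul_pos hm hn, ?_, ?_⟩
  · rw [mul_comm, mul_smul]; exact I.nsmul_mem h n
  · rw [mul_smul]; exact J.nsmul_mem h' m

lemma IsLat.sup {I J : AddSubgroup D} (hI : IsLat I) (hJ : IsLat J) : IsLat (I ⊔ J) :=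
  by
  refine hI.mono le_sup_left ?_
  unfold Fg
  rw [map_sup]; exact Submodule.FG.sup hI.1 hJ.1

namespace QD

lemma finite (Q : QD D) : Module.Finite ℚ D := Module.finite_of_finrank_pos (by rw [Q.fin]; norm_num)

lemma exists_basis (Q : QD D) {I : AddSubgroup D} (h : IsLat I) :
    ∃ b : Module.Basis (Fin 4) ℚ D, ∀ x, x ∈ I ↔ ∀ i, ∃ z : ℤ, b.repr x i = z := by
  have := Q.finite
  let M : Submodule ℤ D := AddSubgroup.toIntSubmodule I
  have hfg : M.FG := h.1
  have hM : M.IsLattice ℚ := by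
    refine ⟨hfg, ?_⟩
    rw [eq_top_iff]
    intro x _
    obtain ⟨m, hm, hx⟩ := h.2 x
    have h1 : x = ((m : ℚ)⁻¹) • (m • x) := by
      rw [← Nat.cast_smul_eq_nsmul ℚ, smul_smul, inv_mul_cancel₀ (by exact_mod_cast hm.ne'), one_smul]
    rw [h1]
    exact Submodule.smul_mem _ _ (Submodule.subset_span hx)
  have hfree : Module.Free ℤ M := Submodule.IsLattice.free ℚ M
  have hfin : Module.Finite ℤ M := (Module.Finite.iff_fg).2 hfg
  have hr : Module.finrank ℤ M = 4 := by
    rw [← Q.fin]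
    unfold Module.finrank; rw [Submodule.IsLattice.rank' ℚ M]
  let b : Module.Basis (Fin 4) ℤ M := Module.finBasisOfFinrankEq ℤ M hr
  refine ⟨b.extendOfIsLattice ℚ, fun x => ?_⟩
  have := (b.extendOfIsLattice ℚ).mem_span_iff_repr_mem ℤ x
  have h2 : Submodule.span ℤ (Set.range (b.extendOfIsLattice ℚ)) = M := by
    have : Set.range (b.extendOfIsLattice ℚ) = M.subtype '' (Set.range b) := by
      rw [← Set.range_comp]; congr 1; ext i; simp
    rw [this, Submodule.span_image, b.span_eq]; simp
  rw [h2] at this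
  change x ∈ M ↔ _
  rw [this]
  simp [eq_comm]
end QD
end
end Eich

namespace Eich
open Module
section
set_option linter.unusedSectionVars false
variable {D : Type*} [DivisionRing D] [CharZero D]
namespace QD
variable (Q : QD D)

lemma B_add_right (x y z : D) : Q.B x (y + z) = Q.B x y + Q.B x z := by
  rw [B_comm, B_add_left, Q.B_comm y, Q.B_comm z]
lemma B_smul_right (a : ℚ) (x z : D) : Q.B x (a • z) = a * Q.B x z := by
  rw [B_comm, B_smul_left, B_comm]

/-- bilinear form -/
def bf : LinearMap.BilinForm ℚ D :=
  LinearMap.mk₂ ℚ Q.B Q.B_add_left (fun c m n => by rw [B_smul_left, smul_eq_mul])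
    Q.B_add_right (fun c m n => by rw [B_smul_right, smul_eq_mul])

lemma bf_apply (x y : D) : Q.bf x y = Q.B x y := rfl

lemma exists_emb : ∃ e : D →ₗ[ℚ] (Fin 4 → ℝ), (∀ x, ∑ i, e x i ^ 2 = (Q.nrd x : ℝ)) ∧
    Submodule.span ℝ (Set.range e) = ⊤ := by
  have := Q.finite
  obtain ⟨v', hv'⟩ := LinearMap.BilinForm.exists_orthogonal_basis (B := Q.bf)
    ⟨fun x y => Q.B_comm x y⟩
  let v := v'.reindex (finCongr Q.fin)
  have hv : ∀ i j, i ≠ j → Q.B (v i) (v j) = 0 := by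
    intro i j hij
    have := LinearMap.isOrthoᵢ_def.1 hv' ((finCongr Q.fin).symm i) ((finCongr Q.fin).symm j)
      (by simpa using hij)
    simpa [v, bf_apply] using this
  have hw : ∀ i, (0 : ℝ) < (Q.nrd (v i) : ℝ) := fun i => by
    exact_mod_cast Q.pos _ (v.ne_zero i)
  let e : D →ₗ[ℚ] (Fin 4 → ℝ) :=
    { toFun := fun x i => (v.repr x i : ℝ) * √(Q.nrd (v i))
      map_add' := fun x y => by ext i; simp [add_mul]
      map_smul' := fun a x => by ext i; rw [map_smul]; simp [Rat.smul_def, mul_assoc] }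
  refine ⟨e, fun x => ?_, ?_⟩
  · have h1 : ∀ i, e x i ^ 2 = ((v.repr x i ^ 2 * Q.nrd (v i) : ℚ) : ℝ) := by
      intro i
      simp only [e, LinearMap.coe_mk, AddHom.coe_mk, mul_pow, Real.sq_sqrt (hw i).le]
      push_cast; rfl
    simp only [h1]
    rw [← Rat.cast_sum]
    congr 1
    have h2 : Q.B x x = ∑ i, v.repr x i ^ 2 * (2 * Q.nrd (v i)) := by
      conv_lhs => rw [← v.sum_repr x]
      rw [← bf_apply, LinearMap.map_sum₂]
      refine Finset.sum_congr rfl fun i _ => ?_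
      rw [map_sum, Finset.sum_eq_single i]
      · rw [bf_apply, B_smul_left, B_smul_right, B_self]; ring
      · intro j _ hj; rw [bf_apply, B_smul_left, B_smul_right, hv i j hj.symm]; ring
      · simp
    rw [B_self] at h2
    have h3 : (2 : ℚ) * Q.nrd x = 2 * ∑ i, v.repr x i ^ 2 * Q.nrd (v i) := by
      rw [h2, Finset.mul_sum]; exact Finset.sum_congr rfl fun i _ => by ring
    linarith
  · rw [eq_top_iff, ← (Pi.basisFun ℝ (Fin 4)).span_eq, Submodule.span_le]
    rintro _ ⟨i, rfl⟩
    have : Pi.basisFun ℝ (Fin 4) i = (√(Q.nrd (v i)))⁻¹ • e (v i) := by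
      ext j
      by_cases h : i = j
      · subst h
        simp [e, (Real.sqrt_pos.2 (hw i)).ne']
      · simp [e, h, Finsupp.single_apply, Ne.symm h]
    rw [this]
    exact Submodule.smul_mem _ _ (Submodule.subset_span ⟨_, rfl⟩)

/-- the Euclidean embedding -/
noncomputable def emb : D →ₗ[ℚ] (Fin 4 → ℝ) := Q.exists_emb.choose

lemma emb_sq (x : D) : ∑ i, Q.emb x i ^ 2 = (Q.nrd x : ℝ) := Q.exists_emb.choose_spec.1 x
lemma emb_span : Submodule.span ℝ (Set.range Q.emb) = ⊤ := Q.exists_emb.choose_spec.2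

lemma emb_inner (x y : D) : ∑ i, Q.emb x i * Q.emb y i = (Q.B x y : ℝ) / 2 := by
  have h := Q.emb_sq (x + y)
  rw [nrd_add, map_add] at h
  simp only [Pi.add_apply, add_sq, Finset.sum_add_distrib] at h
  rw [emb_sq, emb_sq] at h
  have h2 : ∑ i, 2 * Q.emb x i * Q.emb y i = 2 * ∑ i, Q.emb x i * Q.emb y i := by
    rw [Finset.mul_sum]; exact Finset.sum_congr rfl fun i _ => by ring
  rw [h2] at h
  push_cast at h; linarith

lemma emb_inj : Function.Injective Q.emb := by
  rw [injective_iff_map_eq_zero]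
  intro x hx
  have := Q.emb_sq x
  rw [hx] at this
  simp only [Pi.zero_apply, ne_eq, OfNat.ofNat_ne_zero, not_false_eq_true, zero_pow,
    Finset.sum_const_zero] at this
  exact Q.nrd_eq_zero.1 (by exact_mod_cast this.symm)

/-- Euclidean lattice attached to `I` -/
noncomputable def eL (I : AddSubgroup D) : Submodule ℤ (Fin 4 → ℝ) :=
  AddSubgroup.toIntSubmodule (I.map Q.emb.toAddMonoidHom)

lemma mem_eL {I : AddSubgroup D} {v} : v ∈ Q.eL I ↔ ∃ x ∈ I, Q.emb x = v := Iff.rfl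

lemma eL_basis {b : Basis (Fin 4) ℚ D} {I : AddSubgroup D}
    (hb : ∀ x, x ∈ I ↔ ∀ i, ∃ z : ℤ, b.repr x i = z) :
    ∃ c : Basis (Fin 4) ℝ (Fin 4 → ℝ), (∀ i, c i = Q.emb (b i)) ∧
      Q.eL I = Submodule.span ℤ (Set.range c) := by
  have h1 : ⊤ ≤ Submodule.span ℝ (Set.range (Q.emb ∘ b)) := by
    rw [← Q.emb_span, Submodule.span_le]
    rintro _ ⟨x, rfl⟩
    rw [← b.sum_repr x, map_sum]
    refine Submodule.sum_mem _ fun i _ => ?_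
    rw [map_smul, ← Rat.cast_smul_eq_qsmul ℝ]
    exact Submodule.smul_mem _ _ (Submodule.subset_span ⟨i, rfl⟩)
  let c := basisOfTopLeSpanOfCardEqFinrank (Q.emb ∘ b) h1 (by simp)
  have hc : ∀ i, c i = Q.emb (b i) := fun i => by simp [c]
  refine ⟨c, hc, ?_⟩
  ext v
  constructor
  · rintro ⟨x, hx, rfl⟩
    rw [← b.sum_repr x]
    change Q.emb _ ∈ _
    rw [map_sum]
    refine Submodule.sum_mem _ fun i _ => ?_
    obtain ⟨z, hz⟩ := (hb x).1 hx i
    rw [map_smul, hz, ← hc, Int.cast_smul_eq_zsmul]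
    exact Submodule.smul_mem _ _ (Submodule.subset_span ⟨i, rfl⟩)
  · have : Submodule.span ℤ (Set.range c) ≤ Q.eL I := by
      rw [Submodule.span_le]
      rintro _ ⟨i, rfl⟩
      rw [hc]
      refine ⟨_, (hb _).2 fun j => ?_, rfl⟩
      rw [b.repr_self, Finsupp.single_apply]
      split_ifs
      · exact ⟨1, by simp⟩
      · exact ⟨0, by simp⟩
    exact fun h => this h

lemma eL_discrete {I : AddSubgroup D} (h : IsLat I) : DiscreteTopology (Q.eL I) := by
  obtain ⟨b, hb⟩ := Q.exists_basis h
  obtain ⟨c, -, hc⟩ := Q.eL_basis hb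
  rw [hc]; infer_instance

lemma eL_zlat {I : AddSubgroup D} (h : IsLat I) [DiscreteTopology (Q.eL I)] : IsZLattice ℝ (Q.eL I) := by
  obtain ⟨b, hb⟩ := Q.exists_basis h
  obtain ⟨c, -, hc⟩ := Q.eL_basis hb
  constructor
  rw [hc, Submodule.span_span_of_tower, c.span_eq]

/-- covolume -/
noncomputable def cov (I : AddSubgroup D) : ℝ := ZLattice.covolume (Q.eL I)

lemma cov_pos {I : AddSubgroup D} (h : IsLat I) : 0 < Q.cov I := by
  have := Q.eL_discrete h
  have := Q.eL_zlat h
  exact ZLattice.covolume_pos _ _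

lemma cov_eq_det {b : Basis (Fin 4) ℚ D} {I : AddSubgroup D} (hI : IsLat I)
    (hb : ∀ x, x ∈ I ↔ ∀ i, ∃ z : ℤ, b.repr x i = z) :
    Q.cov I = |(Matrix.of fun i => Q.emb (b i)).det| := by
  obtain ⟨c, hc, hc'⟩ := Q.eL_basis hb
  have := Q.eL_discrete hI
  have := Q.eL_zlat hI
  let d : Basis (Fin 4) ℤ (Q.eL I) := (c.restrictScalars ℤ).map (LinearEquiv.ofEq _ _ hc'.symm)
  rw [cov, ZLattice.covolume_eq_det _ d]
  congr 3
  ext i j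
  simp [d, hc]

lemma cov_relIndex {I J : AddSubgroup D} (hI : IsLat I) (hJ : IsLat J) (h : J ≤ I) :
    Q.cov J = Q.cov I * (J.relIndex I : ℝ) := by
  have := Q.eL_discrete hI
  have := Q.eL_zlat hI
  have := Q.eL_discrete hJ
  have := Q.eL_zlat hJ
  have h2 := ZLattice.covolume_div_covolume_eq_relIndex (Q.eL J) (Q.eL I)
    (AddSubgroup.map_mono h)
  have h3 : (Q.eL J).toAddSubgroup.relIndex (Q.eL I).toAddSubgroup = J.relIndex I :=
    AddSubgroup.relIndex_map_map_of_injective J I Q.emb_inj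
  rw [h3] at h2
  change Q.cov J / Q.cov I = _ at h2
  rw [div_eq_iff (Q.cov_pos hI).ne'] at h2
  rw [h2, mul_comm]

lemma relIndex_pos (Q : QD D) {I J : AddSubgroup D} (hI : IsLat I) (hJ : IsLat J) (h : J ≤ I) :
    0 < J.relIndex I := by
  have h1 := Q.cov_relIndex hI hJ h
  rcases Nat.eq_zero_or_pos (J.relIndex I) with h2 | h2
  · rw [h2, Nat.cast_zero, mul_zero] at h1; exact absurd h1 (Q.cov_pos hJ).ne'
  · exact h2

lemma gram {u w : Fin 4 → D} : (Matrix.of fun i => Q.emb (u i)) *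
    (Matrix.of fun i => Q.emb (w i)).transpose =
      Matrix.of fun i j => (Q.B (u i) (w j) : ℝ) / 2 := by
  ext i j
  rw [Matrix.mul_apply, Matrix.of_apply, ← emb_inner]; rfl

lemma cov_lm {I : AddSubgroup D} (hI : IsLat I) {x : D} (hx : x ≠ 0) :
    Q.cov (lm x I) = (Q.nrd x : ℝ) ^ 2 * Q.cov I := by
  obtain ⟨b, hb⟩ := Q.exists_basis hI
  let e : D ≃ₗ[ℚ] D := LinearEquiv.ofBijective (LinearMap.mulLeft ℚ x)
    ⟨mul_right_injective₀ hx, fun y => ⟨x⁻¹ * y, mul_inv_cancel_left₀ hx y⟩⟩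
  have hes : ∀ y, e.symm y = x⁻¹ * y := fun y => by
    rw [LinearEquiv.symm_apply_eq]; exact (mul_inv_cancel_left₀ hx y).symm
  have h1 : ∀ y, y ∈ lm x I ↔ ∀ i, ∃ z : ℤ, (b.map e).repr y i = z := by
    intro y
    rw [mem_lm' hx, hb]; simp [hes]
  rw [Q.cov_eq_det hI hb, Q.cov_eq_det (hI.lm hx) h1]
  have h2 : ∀ i, (b.map e) i = x * b i := fun i => rfl
  have h3 := congrArg Matrix.det (Q.gram (u := b.map e) (w := b.map e))
  have h4 := congrArg Matrix.det (Q.gram (u := b) (w := b))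
  have h5 : (Matrix.of fun i j => (Q.B (b.map e i) (b.map e j) : ℝ) / 2) =
      (Q.nrd x : ℝ) • (Matrix.of fun i j => (Q.B (b i) (b j) : ℝ) / 2) := by
    ext i j
    simp [h2, B_mul_left]; ring
  rw [h5, Matrix.det_smul, ← h4] at h3
  simp only [Matrix.det_mul, Matrix.det_transpose, Fintype.card_fin] at h3
  set M := (Matrix.of fun i => Q.emb (b.map e i)).det
  set N := (Matrix.of fun i => Q.emb (b i)).det
  have hx' : (0 : ℝ) ≤ (Q.nrd x : ℝ) ^ 2 := sq_nonneg _
  rw [← abs_of_nonneg hx', ← abs_mul, ← sq_eq_sq_iff_abs_eq_abs, sq, h3]; ring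

/-- dual lattice w.r.t. `B` -/
def dual (I : AddSubgroup D) : AddSubgroup D where
  carrier := {x | ∀ y ∈ I, ∃ z : ℤ, Q.B x y = z}
  zero_mem' := fun y _ => ⟨0, by simp [B]⟩
  add_mem' := fun {a b} ha hb y hy => by
    obtain ⟨z, hz⟩ := ha y hy
    obtain ⟨w, hw⟩ := hb y hy
    exact ⟨z + w, by rw [B_add_left, hz, hw]; push_cast; rfl⟩
  neg_mem' := fun {a} ha y hy => by
    obtain ⟨z, hz⟩ := ha y hy
    exact ⟨-z, by rw [← neg_one_smul ℚ, B_smul_left, hz]; push_cast; ring⟩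

lemma dual_basis {I : AddSubgroup D} {b : Basis (Fin 4) ℚ D}
    (hb : ∀ x, x ∈ I ↔ ∀ i, ∃ z : ℤ, b.repr x i = z) :
    ∃ c : Basis (Fin 4) ℚ D, (∀ x, x ∈ Q.dual I ↔ ∀ i, ∃ z : ℤ, c.repr x i = z) ∧
      ∀ i j, Q.B (b i) (c j) = if i = j then 1 else 0 := by
  have := Q.finite
  have hnd : Q.bf.Nondegenerate := by
    refine ⟨fun x hx => ?_, fun x hx => ?_⟩ <;>
    · have := hx x
      rw [bf_apply, B_self] at this
      exact Q.nrd_eq_zero.1 (by linarith)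
  let c := Q.bf.dualBasis hnd b
  have h1 : ∀ i j, Q.B (c i) (b j) = if j = i then 1 else 0 := fun i j =>
    LinearMap.BilinForm.apply_dualBasis_left hnd b i j
  have h0 : ∀ x j, c.repr x j = Q.B x (b j) := by
    intro x j
    exact LinearMap.BilinForm.dualBasis_repr_apply hnd b x j
  refine ⟨c, fun x => ?_, fun i j => by rw [B_comm, h1]⟩
  constructor
  · intro hx i
    rw [h0]
    exact hx (b i) ((hb _).2 fun j => by
      rw [b.repr_self, Finsupp.single_apply]
      split_ifs
      · exact ⟨1, by simp⟩
      · exact ⟨0, by simp⟩)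
  · intro hx y hy
    choose f hf using hx
    choose g hg using (hb y).1 hy
    refine ⟨∑ i, g i * f i, ?_⟩
    conv_lhs => rw [← b.sum_repr y]
    rw [← bf_apply, map_sum]
    push_cast
    refine Finset.sum_congr rfl fun i _ => ?_
    rw [bf_apply, B_smul_right, ← h0, hf, hg]

lemma isLat_of_basis {I : AddSubgroup D} {b : Basis (Fin 4) ℚ D}
    (hb : ∀ x, x ∈ I ↔ ∀ i, ∃ z : ℤ, b.repr x i = z) : IsLat I := by
  constructor
  · have : AddSubgroup.toIntSubmodule I = Submodule.span ℤ (Set.range b) := by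
      ext x
      rw [b.mem_span_iff_repr_mem ℤ x]
      change x ∈ I ↔ _
      rw [hb]; simp [eq_comm]
    rw [Fg, this]
    exact Submodule.fg_span (Set.finite_range _)
  · intro x
    refine ⟨∏ i, (b.repr x i).den, Finset.prod_pos fun i _ => (b.repr x i).pos, (hb _).2 fun i => ?_⟩
    obtain ⟨k, hk⟩ := Finset.dvd_prod_of_mem (fun i => (b.repr x i).den) (Finset.mem_univ i)
    refine ⟨k * (b.repr x i).num, ?_⟩
    rw [← Nat.cast_smul_eq_nsmul ℚ, map_smul, Finsupp.smul_apply, smul_eq_mul, hk]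
    push_cast
    rw [mul_comm _ (k : ℚ), mul_assoc, Rat.den_mul_eq_num]

lemma isLat_dual {I : AddSubgroup D} (hI : IsLat I) : IsLat (Q.dual I) := by
  obtain ⟨b, hb⟩ := Q.exists_basis hI
  obtain ⟨c, hc, -⟩ := Q.dual_basis hb
  exact isLat_of_basis hc

lemma cov_dual {I : AddSubgroup D} (hI : IsLat I) : Q.cov I * Q.cov (Q.dual I) = 1 / 16 := by
  obtain ⟨b, hb⟩ := Q.exists_basis hI
  obtain ⟨c, hc, hbc⟩ := Q.dual_basis hb
  rw [Q.cov_eq_det hI hb, Q.cov_eq_det (Q.isLat_dual hI) hc]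
  have h3 := congrArg Matrix.det (Q.gram (u := b) (w := c))
  have h5 : (Matrix.of fun i j => (Q.B (b i) (c j) : ℝ) / 2) =
      (1 / 2 : ℝ) • (1 : Matrix (Fin 4) (Fin 4) ℝ) := by
    ext i j
    rw [Matrix.of_apply, hbc, Matrix.smul_apply, Matrix.one_apply]
    split_ifs <;> simp
  rw [h5, Matrix.det_smul, Matrix.det_one] at h3
  simp only [Matrix.det_mul, Matrix.det_transpose, Fintype.card_fin] at h3
  rw [← abs_mul, h3]; norm_num

end QD
end
end Eich

namespace Eich
open Module

lemma rat_int_of_pow {q : ℚ} {N : ℕ} (hN : 0 < N) (h : ∀ k : ℕ, ∃ z : ℤ, (N : ℚ) * q ^ k = z) :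
    ∃ z : ℤ, q = z := by
  have h1 : ∀ k, q.den ^ k ∣ N := by
    intro k
    obtain ⟨z, hz⟩ := h k
    have h2 : q ^ k = (z : ℚ) / ((N : ℤ) : ℚ) := by
      rw [← hz]; push_cast; field_simp
    have h3 := Rat.den_dvd z (N : ℤ)
    rw [Rat.divInt_eq_div, ← h2, Rat.den_pow] at h3
    exact_mod_cast h3
  have h2 : q.den = 1 := by
    by_contra h0
    have h3 : 1 < q.den := by have := q.pos; omega
    have h4 := Nat.le_of_dvd hN (h1 N)
    exact absurd (Nat.lt_pow_self h3 (n := N)) (by omega)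
  exact ⟨q.num, by conv_lhs => rw [← Rat.num_div_den q, h2]
                   simp⟩

lemma padic_le_one_iff {ℓ : ℕ} [Fact ℓ.Prime] {q : ℚ} : padicNorm ℓ q ≤ 1 ↔ ¬ ℓ ∣ q.den := by
  constructor
  · intro h hd
    have h1 : ¬ (ℓ : ℤ) ∣ q.num := by
      intro h2
      have := Nat.dvd_gcd (Int.natCast_dvd.1 h2) hd
      rw [q.reduced] at this
      exact (Fact.out : ℓ.Prime).one_lt.ne' (Nat.dvd_one.1 this)
    have h2 := padicNorm.int_eq_one_iff (p := ℓ) q.num |>.2 h1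
    have h3 := (padicNorm.nat_lt_one_iff (p := ℓ) q.den).2 hd
    have h4 : padicNorm ℓ q * padicNorm ℓ (q.den : ℚ) = 1 := by
      rw [← padicNorm.mul, Rat.mul_den_eq_num, h2]
    have := padicNorm.nonneg (p := ℓ) (q.den : ℚ)
    nlinarith
  · intro h
    have h2 := (padicNorm.nat_eq_one_iff (p := ℓ) q.den).2 h
    have h4 : padicNorm ℓ q * padicNorm ℓ (q.den : ℚ) ≤ 1 := by
      rw [← padicNorm.mul, Rat.mul_den_eq_num]; exact padicNorm.of_int _
    rwa [h2, mul_one] at h4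

lemma padic_smul_int {ℓ : ℕ} [Fact ℓ.Prime] {q : ℚ} (h : padicNorm ℓ q ≤ 1) :
    ∃ m : ℕ, ¬ ℓ ∣ m ∧ ∃ z : ℤ, (m : ℚ) * q = z :=
  ⟨q.den, padic_le_one_iff.1 h, q.num, by rw [mul_comm, Rat.mul_den_eq_num]⟩

lemma rat_int_of_padic {q : ℚ} (h : ∀ (ℓ : ℕ) [Fact ℓ.Prime], padicNorm ℓ q ≤ 1) :
    ∃ z : ℤ, q = z := by
  have h2 : q.den = 1 := by
    by_contra h0
    obtain ⟨l, hl, hd⟩ := Nat.exists_prime_and_dvd h0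
    have := Fact.mk hl
    exact padic_le_one_iff.1 (h l) hd
  exact ⟨q.num, by conv_lhs => rw [← Rat.num_div_den q, h2]
                   simp⟩

section
set_option linter.unusedSectionVars false
variable {D : Type*} [DivisionRing D] [CharZero D]

/-- localisation at `ℓ` -/
def Loc (ℓ : ℕ) [hl : Fact ℓ.Prime] (I : AddSubgroup D) : AddSubgroup D where
  carrier := {x | ∃ m : ℕ, ¬ ℓ ∣ m ∧ m • x ∈ I}
  zero_mem' := ⟨1, hl.out.one_lt.ne' ∘ Nat.dvd_one.1, by simp⟩
  add_mem' := fun {a b} ⟨m, hm, h⟩ ⟨n, hn, h'⟩ => ⟨m * n, fun hd => (hl.out.dvd_mul.1 hd).elim hm hn,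
    by
      rw [smul_add]
      refine I.add_mem ?_ ?_
      · rw [mul_comm, mul_smul]; exact I.nsmul_mem h n
      · rw [mul_smul]; exact I.nsmul_mem h' m⟩
  neg_mem' := fun {a} ⟨m, hm, h⟩ => ⟨m, hm, by rw [smul_neg]; exact I.neg_mem h⟩

lemma mem_Loc {ℓ : ℕ} [hl : Fact ℓ.Prime] {I : AddSubgroup D} {x : D} :
    x ∈ Loc ℓ I ↔ ∃ m : ℕ, ¬ ℓ ∣ m ∧ m • x ∈ I := Iff.rfl

lemma le_Loc {ℓ : ℕ} [hl : Fact ℓ.Prime] {I : AddSubgroup D} : I ≤ Loc ℓ I :=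
  fun x hx => ⟨1, hl.out.one_lt.ne' ∘ Nat.dvd_one.1, by simpa⟩

lemma Loc_mono {ℓ : ℕ} [hl : Fact ℓ.Prime] {I J : AddSubgroup D} (h : I ≤ J) : Loc ℓ I ≤ Loc ℓ J :=
  fun _ ⟨m, hm, h'⟩ => ⟨m, hm, h h'⟩

lemma Loc_Loc {ℓ : ℕ} [hl : Fact ℓ.Prime] {I : AddSubgroup D} {x : D} {m : ℕ} (hm : ¬ ℓ ∣ m)
    (h : m • x ∈ Loc ℓ I) : x ∈ Loc ℓ I := by
  obtain ⟨n, hn, h'⟩ := h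
  exact ⟨n * m, fun hd => (hl.out.dvd_mul.1 hd).elim hn hm, by rwa [mul_smul]⟩

lemma mem_of_coprime {I : AddSubgroup D} {x : D} {m n : ℕ} (h : Nat.Coprime m n)
    (hm : m • x ∈ I) (hn : n • x ∈ I) : x ∈ I := by
  have h1 := Nat.isCoprime_iff_coprime.2 h
  obtain ⟨a, b, hab⟩ := h1
  rw [← one_zsmul x, ← hab, add_smul, mul_smul, mul_smul]
  refine I.add_mem (I.zsmul_mem ?_ a) (I.zsmul_mem ?_ b)
  · rwa [natCast_zsmul]
  · rwa [natCast_zsmul]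

lemma mem_of_forall_Loc {I : AddSubgroup D} {x : D}
    (h : ∀ (ℓ : ℕ) [Fact ℓ.Prime], x ∈ Loc ℓ I) : x ∈ I := by
  obtain ⟨m0, hm0, hx0⟩ := @h 2 ⟨Nat.prime_two⟩
  have hpos : 0 < m0 := Nat.pos_of_ne_zero (by rintro rfl; exact hm0 (dvd_zero _))
  have hex : ∃ m : ℕ, 0 < m ∧ m • x ∈ I := ⟨m0, hpos, hx0⟩
  classical
  obtain ⟨h1, h2⟩ := Nat.find_spec hex
  set n := Nat.find hex
  by_cases hn : n = 1
  · rw [hn, one_smul] at h2; exact h2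
  · obtain ⟨l, hl, k, hk⟩ := Nat.exists_prime_and_dvd hn
    have := Fact.mk hl
    obtain ⟨m, hm, hmx⟩ := h l
    have hkm : k • x ∈ I := by
      apply mem_of_coprime (I := I) (m := m) (n := l)
      · exact (hl.coprime_iff_not_dvd.2 hm).symm
      · rw [smul_comm]; exact I.nsmul_mem hmx k
      · rwa [← mul_smul, ← hk]
    have hk0 : 0 < k := Nat.pos_of_ne_zero (by rintro rfl; simp at hk; omega)
    have := Nat.find_min' hex ⟨hk0, hkm⟩
    have h3 := hl.two_le
    have : n ≤ k := this
    nlinarith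

/-- the data of the problem -/
structure Setup (p : ℕ) (Q : QD D) (Λ : Subring D) : Prop where
  hp : p.Prime
  lat : IsLat Λ.toAddSubgroup
  maxl : ∀ Λ' : Subring D, Fg Λ'.toAddSubgroup → Λ ≤ Λ' → Λ' = Λ
  ram : ∀ x, [Fact p.Prime] → padicNorm p (Q.trd x) ^ 2 ≤ padicNorm p (Q.nrd x)
  split : ∀ (ℓ : ℕ) [Fact ℓ.Prime], ℓ ≠ p → ∃ φ : D →+* Matrix (Fin 2) (Fin 2) ℚ_[ℓ],
    ∀ x, (φ x).trace = (Q.trd x : ℚ_[ℓ]) ∧ (φ x).det = (Q.nrd x : ℚ_[ℓ])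

namespace QD
variable (Q : QD D)

lemma trd_bdd {I : AddSubgroup D} (h : Fg I) :
    ∃ M : ℕ, 0 < M ∧ ∀ x ∈ I, ∃ z : ℤ, (M : ℚ) * Q.trd x = z := by
  obtain ⟨S, hS⟩ := h
  refine ⟨∏ s ∈ S, (Q.trd s).den, Finset.prod_pos fun s _ => (Q.trd s).pos, fun x hx => ?_⟩
  change x ∈ AddSubgroup.toIntSubmodule I at hx
  rw [← hS] at hx
  induction hx using Submodule.span_induction with
  | mem x hx =>
    obtain ⟨c, hc⟩ := Finset.dvd_prod_of_mem (fun s => (Q.trd s).den) hx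
    refine ⟨c * (Q.trd x).num, ?_⟩
    rw [hc]; push_cast
    rw [mul_comm _ (c : ℚ), mul_assoc, Rat.den_mul_eq_num]
  | zero => exact ⟨0, by simp⟩
  | add x y _ _ h1 h2 =>
    obtain ⟨a, ha⟩ := h1
    obtain ⟨b, hb⟩ := h2
    exact ⟨a + b, by rw [map_add, mul_add, ha, hb]; push_cast; rfl⟩
  | smul z x _ h1 =>
    obtain ⟨a, ha⟩ := h1
    exact ⟨z * a, by
      rw [map_zsmul, zsmul_eq_mul, mul_left_comm, ha]; push_cast; rfl⟩

lemma nrd_int {R : Subring D} (h : Fg R.toAddSubgroup) {x : D} (hx : x ∈ R) :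
    ∃ z : ℤ, Q.nrd x = z := by
  obtain ⟨M, hM, hM'⟩ := Q.trd_bdd h
  have hN : ∀ y ∈ R, ∃ z : ℤ, ((2 * M ^ 2 : ℕ) : ℚ) * Q.nrd y = z := by
    intro y hy
    obtain ⟨a, ha⟩ := hM' y hy
    obtain ⟨b, hb⟩ := hM' (y * y) (R.mul_mem hy hy)
    refine ⟨a ^ 2 - M * b, ?_⟩
    have := Q.trd_sq y
    push_cast
    rw [← ha, ← hb, this]; ring
  have hpow : ∀ k : ℕ, Q.nrd (x ^ k) = Q.nrd x ^ k := by
    intro k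
    induction k with
    | zero => simp [nrd_one]
    | succ k ih => rw [pow_succ, nrd_mul, ih, pow_succ]
  refine rat_int_of_pow (N := 2 * M ^ 2) (by positivity) fun k => ?_
  rw [← hpow]; exact hN _ (R.pow_mem hx k)

lemma trd_int {R : Subring D} (h : Fg R.toAddSubgroup) {x : D} (hx : x ∈ R) :
    ∃ z : ℤ, Q.trd x = z := by
  obtain ⟨a, ha⟩ := Q.nrd_int h hx
  obtain ⟨b, hb⟩ := Q.nrd_int h (R.add_mem hx R.one_mem)
  exact ⟨b - a - 1, by rw [trd_eq, ha, hb]; push_cast; rfl⟩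
end QD

namespace Setup
variable {p : ℕ} {Q : QD D} {Λ : Subring D} (S : Setup p Q Λ)
include S

lemma trd_int {x : D} (hx : x ∈ Λ) : ∃ z : ℤ, Q.trd x = z := Q.trd_int S.lat.1 hx
lemma nrd_int {x : D} (hx : x ∈ Λ) : ∃ z : ℤ, Q.nrd x = z := Q.nrd_int S.lat.1 hx

lemma conj_mem {x : D} (hx : x ∈ Λ) : Q.conj x ∈ Λ := by
  obtain ⟨z, hz⟩ := S.trd_int hx
  rw [QD.conj, hz, Int.cast_smul_eq_zsmul]
  exact Λ.sub_mem (Λ.zsmul_mem Λ.one_mem z) hx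

lemma mem_dual_of_trd {x : D} (h : ∀ y ∈ Λ, ∃ z : ℤ, Q.trd (x * y) = z) :
    x ∈ Q.dual Λ.toAddSubgroup := fun _ hy => h _ (S.conj_mem hy)

lemma le_dual : Λ.toAddSubgroup ≤ Q.dual Λ.toAddSubgroup := fun _ hx =>
  S.mem_dual_of_trd fun _ hy => S.trd_int (Λ.mul_mem hx hy)

lemma lemM {R : Subring D} (h : Λ ≤ R) (ht : ∀ x ∈ R, ∃ z : ℤ, Q.trd x = z) : R = Λ :=
  S.maxl R (fg_of_le (J := Q.dual Λ.toAddSubgroup) (fun _ hx => S.mem_dual_of_trd fun _ hy =>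
    ht _ (R.mul_mem hx (h hy))) (Q.isLat_dual S.lat).1) h

lemma lemM' {ℓ : ℕ} [hl : Fact ℓ.Prime] {R : Subring D} (h : Λ ≤ R)
    (ht : ∀ x ∈ R, padicNorm ℓ (Q.trd x) ≤ 1) {x : D} (hx : x ∈ R) : x ∈ Loc ℓ Λ.toAddSubgroup := by
  let R' : Subring D :=
    { carrier := {x | x ∈ R ∧ ∃ k : ℕ, ℓ ^ k • x ∈ Λ}
      zero_mem' := ⟨R.zero_mem, 0, by simp [Λ.zero_mem]⟩
      one_mem' := ⟨R.one_mem, 0, by simp [Λ.one_mem]⟩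
      add_mem' := fun {a b} ha hb => ⟨R.add_mem ha.1 hb.1, by
        obtain ⟨k, hk⟩ := ha.2
        obtain ⟨l, hl⟩ := hb.2
        refine ⟨k + l, ?_⟩
        rw [smul_add, pow_add]
        refine Λ.add_mem ?_ ?_
        · rw [mul_comm, mul_smul]; exact Λ.nsmul_mem hk _
        · rw [mul_smul]; exact Λ.nsmul_mem hl _⟩
      mul_mem' := fun {a b} ha hb => ⟨R.mul_mem ha.1 hb.1, by
        obtain ⟨k, hk⟩ := ha.2
        obtain ⟨l, hl⟩ := hb.2
        refine ⟨k + l, ?_⟩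
        rw [pow_add, ← smul_mul_smul_comm]
        exact Λ.mul_mem hk hl⟩
      neg_mem' := fun {a} ha => ⟨R.neg_mem ha.1, by
        obtain ⟨k, hk⟩ := ha.2
        exact ⟨k, by rw [smul_neg]; exact Λ.neg_mem hk⟩⟩ }
  have hR : R' = Λ := by
    refine S.lemM (fun y hy => ⟨h hy, 0, by simpa using hy⟩) fun y hy => ?_
    refine rat_int_of_padic fun q hq => ?_
    by_cases hql : q = ℓ
    · subst hql; exact ht y hy.1
    · obtain ⟨k, hk⟩ := hy.2
      obtain ⟨z, hz⟩ := S.trd_int hk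
      rw [map_nsmul, nsmul_eq_mul] at hz
      have h1 : padicNorm q ((ℓ ^ k : ℕ) : ℚ) = 1 := by
        rw [padicNorm.nat_eq_one_iff]
        intro hd
        exact hql ((Nat.prime_dvd_prime_iff_eq hq.out hl.out).1 (hq.out.dvd_of_dvd_pow hd))
      have h2 := padicNorm.of_int (p := q) z
      rwa [← hz, padicNorm.mul, h1, one_mul] at h2
  obtain ⟨m, hm, hmx⟩ := S.lat.2 x
  obtain ⟨k, n, hn, rfl⟩ := Nat.exists_eq_pow_mul_and_not_dvd hm.ne' ℓ hl.out.one_lt.ne'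
  refine ⟨n, hn, ?_⟩
  change n • x ∈ Λ
  rw [← hR]
  exact ⟨R.nsmul_mem hx n, k, by rwa [← mul_smul]⟩

end Setup
end
end Eich

namespace Eich
open Module

section
set_option linter.unusedSectionVars false
variable {D : Type*} [DivisionRing D] [CharZero D]

lemma lm_nat_le (m : ℕ) (I : AddSubgroup D) : lm (m : D) I ≤ I :=
  lm_le_iff.2 fun y hy => by rw [← nsmul_eq_mul]; exact I.nsmul_mem hy m

namespace QD
lemma nrd_natCast (Q : QD D) (m : ℕ) : Q.nrd (m : D) = (m : ℚ) ^ 2 := by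
  have := Q.nrd_smul m (1 : D)
  rwa [nrd_one, mul_one, Nat.cast_smul_eq_nsmul, nsmul_one] at this

lemma relIndex_nat (Q : QD D) {I : AddSubgroup D} (hI : IsLat I) {m : ℕ} (hm : 0 < m) :
    (lm (m : D) I).relIndex I = m ^ 4 := by
  have hm' : (m : D) ≠ 0 := by exact_mod_cast hm.ne'
  have h := Q.cov_relIndex hI (hI.lm hm') (lm_nat_le m I)
  rw [Q.cov_lm hI hm', nrd_natCast, mul_comm] at h
  have := mul_left_cancel₀ (Q.cov_pos hI).ne' h
  push_cast at this
  have h2 : ((m ^ 4 : ℕ) : ℝ) = ((lm (m : D) I).relIndex I : ℕ) := by rw [← this]; push_cast; ring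
  exact_mod_cast h2.symm
end QD

namespace Setup
variable {p : ℕ} {Q : QD D} {Λ : Subring D} (S : Setup p Q Λ)
include S

lemma split_int {ℓ : ℕ} [Fact ℓ.Prime] (hl : ℓ ≠ p) : ∃ φ : D →+* Matrix (Fin 2) (Fin 2) ℚ_[ℓ],
    (∀ x, (φ x).trace = (Q.trd x : ℚ_[ℓ])) ∧ ∀ x ∈ Λ, ∀ i j, ‖φ x i j‖ ≤ 1 := by
  obtain ⟨φ, hφ⟩ := S.split ℓ hl
  let V := Fin 2 → ℚ_[ℓ]
  let T : Set V := {v | ∃ a ∈ Λ, ∃ j, v = (φ a).mulVec (Pi.single j 1)}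
  let M : Submodule ℤ_[ℓ] V := Submodule.span ℤ_[ℓ] T
  have hst : ∀ a ∈ Λ, ∀ v ∈ M, (φ a).mulVec v ∈ M := by
    intro a ha v hv
    induction hv using Submodule.span_induction with
    | mem v hv =>
      obtain ⟨b, hb, j, rfl⟩ := hv
      refine Submodule.subset_span ⟨a * b, Λ.mul_mem ha hb, j, ?_⟩
      rw [Matrix.mulVec_mulVec, map_mul]
    | zero => rw [Matrix.mulVec_zero]; exact M.zero_mem
    | add x y _ _ h1 h2 => rw [Matrix.mulVec_add]; exact M.add_mem h1 h2
    | smul c x _ h1 => rw [Matrix.mulVec_smul]; exact M.smul_mem c h1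
  have hfg : M.FG := by
    obtain ⟨F, hF⟩ := S.lat.1
    let T' : Set V := (fun q : D × Fin 2 => (φ q.1).mulVec (Pi.single q.2 1)) ''
      ((F : Set D) ×ˢ Set.univ)
    have hT' : T'.Finite := Set.Finite.image _ (F.finite_toSet.prod Set.finite_univ)
    have : M = Submodule.span ℤ_[ℓ] T' := by
      apply le_antisymm
      · refine Submodule.span_le.2 ?_
        rintro _ ⟨a, ha, j, rfl⟩
        change a ∈ AddSubgroup.toIntSubmodule Λ.toAddSubgroup at ha
        rw [← hF] at ha
        change _ ∈ Submodule.span ℤ_[ℓ] T'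
        induction ha using Submodule.span_induction with
        | mem x hx => exact Submodule.subset_span ⟨(x, j), ⟨hx, trivial⟩, rfl⟩
        | zero => rw [map_zero, Matrix.zero_mulVec]; exact Submodule.zero_mem _
        | add x y _ _ h1 h2 => rw [map_add, Matrix.add_mulVec]; exact Submodule.add_mem _ h1 h2
        | smul c x _ h1 =>
          rw [map_zsmul, Matrix.smul_mulVec]
          exact zsmul_mem h1 c
      · refine Submodule.span_mono ?_
        rintro _ ⟨⟨x, j⟩, ⟨hx, -⟩, rfl⟩
        refine ⟨x, ?_, j, rfl⟩
        change x ∈ AddSubgroup.toIntSubmodule Λ.toAddSubgroup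
        rw [← hF]; exact Submodule.subset_span hx
    rw [this]
    exact Submodule.fg_span hT'
  have hM : M.IsLattice ℚ_[ℓ] := by
    refine ⟨hfg, ?_⟩
    rw [eq_top_iff, ← (Pi.basisFun ℚ_[ℓ] (Fin 2)).span_eq, Submodule.span_le]
    rintro _ ⟨j, rfl⟩
    refine Submodule.subset_span (Submodule.subset_span ⟨1, Λ.one_mem, j, ?_⟩)
    rw [map_one, Matrix.one_mulVec, Pi.basisFun_apply]
  have hfin : Module.Finite ℤ_[ℓ] M := (Module.Finite.iff_fg).2 hfg
  have hfree : Module.Free ℤ_[ℓ] M := Submodule.IsLattice.free ℚ_[ℓ] M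
  have hr : Module.finrank ℤ_[ℓ] M = 2 := by
    have := Submodule.IsLattice.finrank_of_pi ℚ_[ℓ] M
    simpa using this
  let b' : Module.Basis (Fin 2) ℤ_[ℓ] M := Module.finBasisOfFinrankEq ℤ_[ℓ] M hr
  let b : Module.Basis (Fin 2) ℚ_[ℓ] V := b'.extendOfIsLattice ℚ_[ℓ]
  have hb : ∀ i, b i ∈ M := fun i => by
    simp only [b, Module.Basis.extendOfIsLattice_apply]; exact (b' i).2
  have hrep : ∀ v ∈ M, ∀ i, ‖b.repr v i‖ ≤ 1 := by
    intro v hv i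
    have h1 : v = ∑ i, ((b'.repr ⟨v, hv⟩ i : ℤ_[ℓ]) : ℚ_[ℓ]) • b i := by
      have := congrArg M.subtype (b'.sum_repr ⟨v, hv⟩)
      rw [map_sum] at this
      refine this.symm.trans (Finset.sum_congr rfl fun i _ => ?_)
      rw [map_smul]
      simp only [b, Module.Basis.extendOfIsLattice_apply]
      rfl
    have h2 : b.repr v i = ((b'.repr ⟨v, hv⟩ i : ℤ_[ℓ]) : ℚ_[ℓ]) := by
      conv_lhs => rw [h1]
      exact congrFun (b.repr_sum_self _) i
    rw [h2]; exact PadicInt.norm_le_one _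
  let E : Matrix (Fin 2) (Fin 2) ℚ_[ℓ] →+* Matrix (Fin 2) (Fin 2) ℚ_[ℓ] :=
    ((LinearMap.toMatrixAlgEquiv b).toAlgHom.toRingHom).comp
      ((Matrix.toLinAlgEquiv' (R := ℚ_[ℓ]) (n := Fin 2)).toAlgHom.toRingHom)
  have hE : ∀ N, E N = LinearMap.toMatrix b b (Matrix.toLin' N) := fun N => rfl
  refine ⟨E.comp φ, fun x => ?_, fun x hx i j => ?_⟩
  · rw [RingHom.comp_apply, hE, ← LinearMap.trace_eq_matrix_trace, Matrix.trace_toLin'_eq, (hφ x).1]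
  · rw [RingHom.comp_apply, hE, LinearMap.toMatrix_apply]
    exact hrep _ (hst x hx _ (hb j)) i

lemma exists_psi {ℓ : ℕ} [Fact ℓ.Prime] (hl : ℓ ≠ p) :
    ∃ ψ : Λ →+* Matrix (Fin 2) (Fin 2) ℤ_[ℓ],
    (∀ (x : Λ) (z : ℤ), Q.trd x = z → (ψ x).trace = z) ∧
    ∀ (k : ℕ) (x : Λ) N, ψ x = ((ℓ : ℤ_[ℓ]) ^ k) • N → ∃ y : Λ, x = ℓ ^ k • y := by
  obtain ⟨φ, hφ, hφ'⟩ := S.split_int hl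
  let f : Matrix (Fin 2) (Fin 2) ℤ_[ℓ] →+* Matrix (Fin 2) (Fin 2) ℚ_[ℓ] :=
    (PadicInt.Coe.ringHom (p := ℓ)).mapMatrix
  have hf : Function.Injective f := by
    intro a b hab
    ext i j
    exact Subtype.ext (congrFun (congrFun hab i) j)
  have hr : ∀ N, (∀ i j, ‖N i j‖ ≤ 1) → N ∈ f.range := fun N hN =>
    ⟨Matrix.of fun i j => ⟨N i j, hN i j⟩, rfl⟩
  let g : Λ →+* f.range := (φ.comp Λ.subtype).codRestrict f.range fun x => hr _ (hφ' x x.2)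
  let e := RingEquiv.ofBijective f.rangeRestrict
    ⟨fun a b hab => hf (congrArg Subtype.val hab), f.rangeRestrict_surjective⟩
  let ψ : Λ →+* Matrix (Fin 2) (Fin 2) ℤ_[ℓ] := e.symm.toRingHom.comp g
  have hψ : ∀ x, f (ψ x) = φ x := fun x => by
    have : e (ψ x) = g x := e.apply_symm_apply (g x)
    exact congrArg Subtype.val this
  have hR : ∀ x, x ∈ f.range.comap φ → x ∈ Loc ℓ Λ.toAddSubgroup := fun x hx => by
    refine S.lemM' (fun a ha => hr _ (hφ' a ha)) (fun y hy => ?_) hx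
    obtain ⟨N, hN⟩ := hy
    have h1 : ((N.trace : ℤ_[ℓ]) : ℚ_[ℓ]) = (Q.trd y : ℚ_[ℓ]) := by
      rw [← hφ, ← hN]
      simp only [Matrix.trace_fin_two]; push_cast; rfl
    have h2 := PadicInt.norm_le_one N.trace
    rw [PadicInt.norm_def, h1, Padic.eq_padicNorm] at h2
    exact_mod_cast h2
  refine ⟨ψ, fun x z hz => ?_, fun k x N hN => ?_⟩
  · have h1 := hφ x
    rw [← hψ, hz] at h1
    apply PadicInt.ext
    rw [PadicInt.coe_intCast]
    rw [Rat.cast_intCast] at h1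
    rw [← h1]
    simp only [Matrix.trace_fin_two]; push_cast; rfl
  · have hl0 : (ℓ : ℚ) ≠ 0 := by exact_mod_cast (Fact.out : ℓ.Prime).ne_zero
    let y : D := ((ℓ : ℚ) ^ k)⁻¹ • (x : D)
    have hy : ℓ ^ k • y = x := by
      rw [← Nat.cast_smul_eq_nsmul ℚ, smul_smul]; push_cast
      rw [mul_inv_cancel₀ (pow_ne_zero _ hl0), one_smul]
    have h2 : φ y = f N := by
      have h3 : ℓ ^ k • φ y = ℓ ^ k • f N := by
        rw [← map_nsmul, hy, ← hψ, hN, ← map_nsmul]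
        congr 1
        rw [← Nat.cast_smul_eq_nsmul ℤ_[ℓ]]; push_cast; rfl
      rw [← Nat.cast_smul_eq_nsmul ℚ_[ℓ], ← Nat.cast_smul_eq_nsmul ℚ_[ℓ]] at h3
      exact smul_right_injective _
        (by exact_mod_cast pow_ne_zero k (Fact.out : ℓ.Prime).ne_zero) h3
    obtain ⟨m, hm, hmy⟩ := hR y ⟨N, h2.symm⟩
    refine ⟨⟨y, ?_⟩, Subtype.ext hy.symm⟩
    refine mem_of_coprime (I := Λ.toAddSubgroup) (m := m) (n := ℓ ^ k) ?_ hmy (by rw [hy]; exact x.2)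
    exact Nat.Coprime.pow_right k ((Fact.out : ℓ.Prime).coprime_iff_not_dvd.2 hm).symm

lemma exists_rho {ℓ : ℕ} [hF : Fact ℓ.Prime] (hl : ℓ ≠ p) (k : ℕ) :
    ∃ ρ : Λ →+* Matrix (Fin 2) (Fin 2) (ZMod (ℓ ^ k)), Function.Surjective ρ ∧
    (∀ (x : Λ) (z : ℤ), Q.trd x = z → (ρ x).trace = z) ∧
    ∀ (x : Λ), ρ x = 0 ↔ ∃ y : Λ, x = ℓ ^ k • y := by
  obtain ⟨ψ, h1, h2⟩ := S.exists_psi hl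
  let ρ : Λ →+* Matrix (Fin 2) (Fin 2) (ZMod (ℓ ^ k)) := (PadicInt.toZModPow k).mapMatrix.comp ψ
  have hker : ∀ (x : Λ), ρ x = 0 ↔ ∃ y : Λ, x = ℓ ^ k • y := by
    intro x
    constructor
    · intro hx
      have h3 : ∀ i j, ∃ c, ψ x i j = (ℓ : ℤ_[ℓ]) ^ k * c := by
        intro i j
        have h4 : PadicInt.toZModPow k (ψ x i j) = 0 := congrFun (congrFun hx i) j
        rw [← RingHom.mem_ker, PadicInt.ker_toZModPow, Ideal.mem_span_singleton] at h4
        exact h4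
      choose c hc using h3
      exact h2 k x (Matrix.of c) (by ext i j; simp [hc])
    · rintro ⟨y, rfl⟩
      rw [map_nsmul]
      ext i j
      rw [Matrix.smul_apply, nsmul_eq_mul, ZMod.natCast_self, zero_mul]; rfl
  have hl0 : 0 < ℓ ^ k := pow_pos hF.out.pos k
  have : NeZero (ℓ ^ k) := ⟨hl0.ne'⟩
  refine ⟨ρ, ?_, fun x z hz => ?_, hker⟩
  · have h3 : ρ.toAddMonoidHom.ker.index = (ℓ ^ k) ^ 4 := by
      rw [← Q.relIndex_nat S.lat hl0]
      have : ρ.toAddMonoidHom.ker = (lm ((ℓ ^ k : ℕ) : D) Λ.toAddSubgroup).addSubgroupOf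
          Λ.toAddSubgroup := by
        ext x
        rw [AddMonoidHom.mem_ker, AddSubgroup.mem_addSubgroupOf, mem_lm]
        change ρ x = 0 ↔ _
        rw [hker]
        constructor
        · rintro ⟨y, rfl⟩; exact ⟨y, y.2, by rw [← nsmul_eq_mul]; rfl⟩
        · rintro ⟨y, hy, h⟩; exact ⟨⟨y, hy⟩, Subtype.ext (by rw [← nsmul_eq_mul] at h; exact h.symm)⟩
      rw [this]; rfl
    rw [AddSubgroup.index_ker] at h3
    have h4 : Nat.card (Matrix (Fin 2) (Fin 2) (ZMod (ℓ ^ k))) = (ℓ ^ k) ^ 4 := by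
      change Nat.card (Fin 2 → Fin 2 → ZMod (ℓ ^ k)) = _
      simp; ring
    have h5 := AddSubgroup.eq_top_of_card_eq ρ.toAddMonoidHom.range (h3.trans h4.symm)
    exact AddMonoidHom.range_eq_top.1 h5
  · have h3 := congrArg (PadicInt.toZModPow k) (h1 x z hz)
    rw [map_intCast] at h3
    rw [← h3]
    simp [ρ, Matrix.trace_fin_two]

/-- the dual is locally trivial away from `p` -/
lemma dual_le_Loc {ℓ : ℕ} [hF : Fact ℓ.Prime] (hl : ℓ ≠ p) :
    Q.dual Λ.toAddSubgroup ≤ Loc ℓ Λ.toAddSubgroup := by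
  intro x hx
  obtain ⟨m, hm, hmx⟩ := S.lat.2 x
  obtain ⟨k, n, hn, rfl⟩ := Nat.exists_eq_pow_mul_and_not_dvd hm.ne' ℓ hF.out.one_lt.ne'
  refine ⟨n, hn, ?_⟩
  obtain ⟨ρ, hs, ht, hk⟩ := S.exists_rho hl k
  let w : Λ := ⟨(ℓ ^ k * n) • x, hmx⟩
  have h1 : ∀ a : Λ, (ρ w * ρ a).trace = 0 := by
    intro a
    obtain ⟨z, hz⟩ := hx (Q.conj a) (S.conj_mem a.2)
    rw [QD.B, QD.conj_conj] at hz
    have h2 := ht (w * a) ((ℓ ^ k * n : ℕ) * z) (by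
      change Q.trd (((ℓ ^ k * n) • x) * a) = _
      rw [smul_mul_assoc, map_nsmul, hz, nsmul_eq_mul]; push_cast; ring)
    rw [← map_mul, h2]
    push_cast
    have : ((ℓ : ZMod (ℓ ^ k)) ^ k) = 0 := by
      have := ZMod.natCast_self (ℓ ^ k); push_cast at this; exact this
    rw [this]; ring
  have h2 : ρ w = 0 := by
    have h3 : ∀ N, (ρ w * N).trace = 0 := fun N => by
      obtain ⟨a, rfl⟩ := hs N; exact h1 a
    ext i j
    have := h3 (Matrix.single j i 1)
    rw [Matrix.trace_mul_single] at this
    simpa using this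
  obtain ⟨y, hy⟩ := (hk w).1 h2
  have h3 : (ℓ ^ k) • (n • x) = (ℓ ^ k) • (y : D) := by
    rw [← mul_smul]; exact congrArg Subtype.val hy
  rw [smul_inj_nat (pow_pos hF.out.pos k) h3]
  exact y.2

end Setup
end
end Eich

namespace Eich
open Module

lemma padic_int_pow {ℓ k : ℕ} [hl : Fact ℓ.Prime] {q : ℚ} (h : padicNorm ℓ q ≤ 1)
    (h2 : ∃ z : ℤ, ((ℓ ^ k : ℕ) : ℚ) * q = z) : ∃ z : ℤ, q = z := by
  obtain ⟨z, hz⟩ := h2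
  refine rat_int_of_padic fun r hr => ?_
  by_cases hrl : r = ℓ
  · subst hrl; exact h
  · have h1 : padicNorm r ((ℓ ^ k : ℕ) : ℚ) = 1 := by
      rw [padicNorm.nat_eq_one_iff]
      intro hd
      exact hrl ((Nat.prime_dvd_prime_iff_eq hr.out hl.out).1 (hr.out.dvd_of_dvd_pow hd))
    have h2 := padicNorm.of_int (p := r) z
    rwa [← hz, padicNorm.mul, h1, one_mul] at h2

section
set_option linter.unusedSectionVars false
variable {D : Type*} [DivisionRing D] [CharZero D]

/-- right `Λ`-lattices -/
def IsRt (Λ : Subring D) (I : AddSubgroup D) : Prop := IsLat I ∧ ∀ x ∈ I, ∀ a ∈ Λ, x * a ∈ I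

lemma IsRt.lm {Λ : Subring D} {I : AddSubgroup D} (h : IsRt Λ I) {x : D} (hx : x ≠ 0) :
    IsRt Λ (lm x I) := by
  refine ⟨h.1.lm hx, ?_⟩
  rintro _ ⟨y, hy, rfl⟩ a ha
  exact ⟨y * a, h.2 y hy a ha, (mul_assoc _ _ _).symm⟩

lemma Loc_uniform {ℓ : ℕ} [hl : Fact ℓ.Prime] {I J : AddSubgroup D} (hI : Fg I) (h : I ≤ Loc ℓ J) :
    ∃ m : ℕ, ¬ ℓ ∣ m ∧ ∀ x ∈ I, m • x ∈ J := by
  obtain ⟨S, hS⟩ := hI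
  have hS' : ∀ x ∈ S, x ∈ Loc ℓ J := fun x hx => h (by
    change x ∈ AddSubgroup.toIntSubmodule I
    rw [← hS]; exact Submodule.subset_span hx)
  have : ∀ x, ∃ m : ℕ, ¬ ℓ ∣ m ∧ (x ∈ S → m • x ∈ J) := by
    intro x
    by_cases hx : x ∈ S
    · obtain ⟨m, hm, h⟩ := hS' x hx; exact ⟨m, hm, fun _ => h⟩
    · exact ⟨1, hl.out.one_lt.ne' ∘ Nat.dvd_one.1, fun h => absurd h hx⟩
  choose f hf hf' using this
  refine ⟨∏ s ∈ S, f s, ?_, fun x hx => ?_⟩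
  · intro hd
    obtain ⟨s, -, hs⟩ := (hl.out.prime.dvd_finsetProd_iff _).1 hd
    exact hf s hs
  change x ∈ AddSubgroup.toIntSubmodule I at hx
  rw [← hS] at hx
  induction hx using Submodule.span_induction with
  | mem x hx =>
    obtain ⟨c, hc⟩ := Finset.dvd_prod_of_mem f hx
    rw [hc, mul_comm, mul_smul]; exact J.nsmul_mem (hf' x hx) c
  | zero => simp
  | add x y _ _ h1 h2 => rw [smul_add]; exact J.add_mem h1 h2
  | smul z x _ h => rw [smul_comm]; exact J.zsmul_mem h z

namespace QD
variable (Q : QD D)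
/-- `ℓ`-adic size -/
def v (ℓ : ℕ) (x : D) : ℚ := padicNorm ℓ (Q.nrd x)

variable {ℓ : ℕ} [hl : Fact ℓ.Prime]
lemma v_mul (x y : D) : Q.v ℓ (x * y) = Q.v ℓ x * Q.v ℓ y := by
  rw [v, nrd_mul, padicNorm.mul]; rfl
lemma v_nonneg (x : D) : 0 ≤ Q.v ℓ x := padicNorm.nonneg _
lemma v_neg (x : D) : Q.v ℓ (-x) = Q.v ℓ x := by rw [v, nrd_neg]; rfl
lemma v_zero : Q.v ℓ 0 = 0 := by rw [v, nrd_zero, padicNorm.zero]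
lemma v_one : Q.v ℓ 1 = 1 := by rw [v, nrd_one, padicNorm.one]
lemma v_pos {x : D} (hx : x ≠ 0) : 0 < Q.v ℓ x :=
  lt_of_le_of_ne (Q.v_nonneg x) (padicNorm.nonzero (Q.pos x hx).ne').symm
lemma v_inv (x : D) : Q.v ℓ x⁻¹ = (Q.v ℓ x)⁻¹ := by
  by_cases hx : x = 0
  · simp [hx, v_zero]
  · refine eq_inv_of_mul_eq_one_left ?_
    rw [← v_mul, inv_mul_cancel₀ hx, v_one]
lemma v_nat (m : ℕ) : Q.v ℓ (m : D) = padicNorm ℓ m ^ 2 := by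
  rw [v, nrd_natCast, sq, padicNorm.mul, sq]
lemma v_nsmul (m : ℕ) (x : D) : Q.v ℓ (m • x) = padicNorm ℓ m ^ 2 * Q.v ℓ x := by
  rw [nsmul_eq_mul, v_mul, v_nat]
lemma v_nsmul' {m : ℕ} (hm : ¬ ℓ ∣ m) (x : D) : Q.v ℓ (m • x) = Q.v ℓ x := by
  rw [v_nsmul, (padicNorm.nat_eq_one_iff (p := ℓ) m).2 hm]; ring
lemma v_pow (x : D) (k : ℕ) : Q.v ℓ (x ^ k) = Q.v ℓ x ^ k := by
  induction k with
  | zero => simp [v_one]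
  | succ k ih => rw [pow_succ, v_mul, ih, pow_succ]
lemma v_val {x : D} (hx : x ≠ 0) : ∃ n : ℤ, Q.v ℓ x = (ℓ : ℚ) ^ n := by
  obtain ⟨n, hn⟩ := padicNorm.values_discrete (p := ℓ) (Q.pos x hx).ne'
  exact ⟨-n, hn⟩
end QD

namespace Setup
variable {p : ℕ} {Q : QD D} {Λ : Subring D} (S : Setup p Q Λ)
include S

lemma isRt : IsRt Λ Λ.toAddSubgroup := ⟨S.lat, fun _ hx _ ha => Λ.mul_mem hx ha⟩

section
variable {ℓ : ℕ} [hl : Fact ℓ.Prime]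

lemma v_le_one {x : D} (hx : x ∈ Loc ℓ Λ.toAddSubgroup) : Q.v ℓ x ≤ 1 := by
  obtain ⟨m, hm, h⟩ := hx
  obtain ⟨z, hz⟩ := S.nrd_int h
  rw [← Q.v_nsmul' hm, QD.v, hz]
  exact padicNorm.of_int z

lemma exists_max {I : AddSubgroup D} (hI : IsLat I) :
    ∃ u ∈ I, u ≠ 0 ∧ ∀ x ∈ I, Q.v ℓ x ≤ Q.v ℓ u := by
  obtain ⟨m, hm, hmI⟩ := exists_nsmul_le hI.1 S.lat
  obtain ⟨k, hk, h1⟩ := hI.2 1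
  have hl1 : (1 : ℚ) < ℓ := by exact_mod_cast hl.out.one_lt
  have hm0 : (m : D) ≠ 0 := by exact_mod_cast hm.ne'
  obtain ⟨c, hc⟩ := Q.v_val (ℓ := ℓ) hm0
  have hb : ∀ n : ℤ, (∃ x ∈ I, x ≠ 0 ∧ Q.v ℓ x = (ℓ : ℚ) ^ n) → n ≤ -c := by
    rintro n ⟨x, hx, hx0, hn⟩
    have h2 := S.v_le_one (ℓ := ℓ) (le_Loc (hmI x hx))
    rw [nsmul_eq_mul, Q.v_mul, hc, hn, ← zpow_add₀ (by positivity)] at h2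
    have := (zpow_le_one_iff_right₀ hl1).1 h2
    omega
  have hk0 : (k • 1 : D) ≠ 0 := by rw [nsmul_one]; exact_mod_cast hk.ne'
  obtain ⟨c', hc'⟩ := Q.v_val (ℓ := ℓ) hk0
  obtain ⟨n, ⟨u, hu, hu0, hun⟩, hmax⟩ := Int.exists_greatest_of_bdd ⟨-c, hb⟩ ⟨c', _, h1, hk0, hc'⟩
  refine ⟨u, hu, hu0, fun x hx => ?_⟩
  by_cases hx0 : x = 0
  · rw [hx0, QD.v_zero]; exact Q.v_nonneg u
  · obtain ⟨n', hn'⟩ := Q.v_val (ℓ := ℓ) hx0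
    rw [hn', hun]
    exact zpow_le_zpow_right₀ hl1.le (hmax n' ⟨x, hx, hx0, hn'⟩)
end

section
variable [hP : Fact p.Prime]

lemma v_add (x y : D) : Q.v p (x + y) ≤ max (Q.v p x) (Q.v p y) := by
  rw [QD.v, Q.nrd_add]
  refine (padicNorm.nonarchimedean).trans (max_le (padicNorm.nonarchimedean) ?_)
  have h := S.ram (x * Q.conj y)
  change padicNorm p (Q.B x y) ^ 2 ≤ Q.v p _ at h
  have h2 : Q.v p (Q.conj y) = Q.v p y := by rw [QD.v, QD.nrd_conj]; rfl
  rw [Q.v_mul, h2] at h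
  have h3 : Q.v p x * Q.v p y ≤ max (Q.v p x) (Q.v p y) ^ 2 := by
    rw [sq]
    exact mul_le_mul (le_max_left _ _) (le_max_right _ _) (Q.v_nonneg y)
      ((Q.v_nonneg x).trans (le_max_left _ _))
  exact (sq_le_sq₀ (padicNorm.nonneg _) ((Q.v_nonneg x).trans (le_max_left _ _))).1 (h.trans h3)

lemma mem_Loc_p {x : D} : x ∈ Loc p Λ.toAddSubgroup ↔ Q.v p x ≤ 1 := by
  refine ⟨S.v_le_one, fun hx => ?_⟩
  let R : Subring D :=
    { carrier := {x | Q.v p x ≤ 1}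
      zero_mem' := by simp [QD.v_zero]
      one_mem' := by simp [QD.v_one]
      add_mem' := fun {a b} ha hb => (S.v_add a b).trans (max_le ha hb)
      mul_mem' := fun {a b} ha hb => by
        change Q.v p (a * b) ≤ 1
        rw [Q.v_mul]; exact mul_le_one₀ ha (Q.v_nonneg b) hb
      neg_mem' := fun {a} ha => by change Q.v p (-a) ≤ 1; rwa [Q.v_neg] }
  refine S.lemM' (R := R) (fun a ha => S.v_le_one (le_Loc ha)) (fun y hy => ?_) hx
  have h := (S.ram y).trans hy
  exact (sq_le_one_iff₀ (padicNorm.nonneg _)).1 h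

/-- a right lattice at `p` is a ball -/
lemma Loc_p_eq {I : AddSubgroup D} (hI : IsRt Λ I) {u : D} (hu : u ∈ I) (hu0 : u ≠ 0)
    (hmax : ∀ x ∈ I, Q.v p x ≤ Q.v p u) (x : D) : x ∈ Loc p I ↔ Q.v p x ≤ Q.v p u := by
  constructor
  · rintro ⟨m, hm, h⟩
    rw [← Q.v_nsmul' hm]; exact hmax _ h
  · intro hx
    have h1 : u⁻¹ * x ∈ Loc p Λ.toAddSubgroup := by
      rw [S.mem_Loc_p, Q.v_mul, Q.v_inv, inv_mul_le_one₀ (Q.v_pos hu0)]; exact hx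
    obtain ⟨m, hm, h⟩ := h1
    refine ⟨m, hm, ?_⟩
    have := hI.2 u hu _ h
    rwa [mul_smul_comm, mul_inv_cancel_left₀ hu0] at this
end

/-- right lattices are locally principal -/
lemma loc_principal {ℓ : ℕ} [hl : Fact ℓ.Prime] {I : AddSubgroup D} (hI : IsRt Λ I) :
    ∃ u ∈ I, u ≠ 0 ∧ ∃ m : ℕ, ¬ ℓ ∣ m ∧ ∀ x ∈ I, m • x ∈ lm u Λ.toAddSubgroup := by
  obtain ⟨u, hu, hu0, hmax⟩ := S.exists_max (ℓ := ℓ) hI.1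
  refine ⟨u, hu, hu0, ?_⟩
  suffices h : ∀ x ∈ I, u⁻¹ * x ∈ Loc ℓ Λ.toAddSubgroup by
    obtain ⟨m, hm, h'⟩ := Loc_uniform (ℓ := ℓ) (I := lm u⁻¹ I) (J := Λ.toAddSubgroup)
      (hI.1.lm (inv_ne_zero hu0)).1 (lm_le_iff.2 h)
    refine ⟨m, hm, fun x hx => ⟨m • (u⁻¹ * x), h' _ ⟨x, hx, rfl⟩, ?_⟩⟩
    change u * _ = _
    rw [mul_smul_comm, mul_inv_cancel_left₀ hu0]
  intro x hx
  have hy : ∀ x ∈ I, Q.v ℓ (u⁻¹ * x) ≤ 1 := fun x hx => by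
    rw [Q.v_mul, Q.v_inv, inv_mul_le_one₀ (Q.v_pos hu0)]; exact hmax x hx
  by_cases hlp : ℓ = p
  · subst hlp
    rw [S.mem_Loc_p]; exact hy x hx
  set y := u⁻¹ * x with hyd
  have hB : ∀ a ∈ Λ, padicNorm ℓ (Q.B y a) ≤ 1 := by
    intro a ha
    have h1 := hy (x + u * a) (I.add_mem hx (hI.2 u hu a ha))
    rw [mul_add, inv_mul_cancel_left₀ hu0, ← hyd] at h1
    have h2 : Q.B y a = Q.nrd (y + a) - Q.nrd y - Q.nrd a := by rw [QD.nrd_add]; ring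
    have h3 : padicNorm ℓ (Q.nrd a) ≤ 1 := S.v_le_one (le_Loc ha)
    have h4 : padicNorm ℓ (Q.nrd y) ≤ 1 := hy x hx
    rw [h2]
    exact (padicNorm.sub).trans (max_le ((padicNorm.sub).trans (max_le h1 h4)) h3)
  obtain ⟨N, hN, hNy⟩ := S.lat.2 y
  obtain ⟨k, m, hm, rfl⟩ := Nat.exists_eq_pow_mul_and_not_dvd hN.ne' ℓ hl.out.one_lt.ne'
  refine Loc_Loc hm (S.dual_le_Loc hlp fun a ha => ?_)
  apply padic_int_pow (ℓ := ℓ) (k := k)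
  · rw [← Nat.cast_smul_eq_nsmul ℚ, QD.B_smul_left, padicNorm.mul]
    exact mul_le_one₀ (padicNorm.of_nat m) (padicNorm.nonneg _) (hB a ha)
  · obtain ⟨z, hz⟩ := S.le_dual hNy a ha
    refine ⟨z, ?_⟩
    rw [← hz, mul_smul, ← Nat.cast_smul_eq_nsmul ℚ (ℓ ^ k), QD.B_smul_left]
end Setup
end
end Eich

namespace Eich
open Module

lemma chev {p : ℕ} [hp : Fact p.Prime] (c : Fin 4 → Fin 4 → ℤ) :
    ∃ x : Fin 4 → ℤ, (∃ i, ¬ (p : ℤ) ∣ x i) ∧ (p : ℤ) ∣ ∑ i, ∑ j, c i j * (x i * x j) := by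
  classical
  let f : MvPolynomial (Fin 4) (ZMod p) :=
    ∑ i, ∑ j, MvPolynomial.C (c i j : ZMod p) * (MvPolynomial.X i * MvPolynomial.X j)
  have hd : f.totalDegree < Fintype.card (Fin 4) := by
    refine lt_of_le_of_lt (b := 2) ?_ (by simp)
    refine MvPolynomial.totalDegree_finsetSum_le fun i _ =>
      MvPolynomial.totalDegree_finsetSum_le fun j _ => ?_
    refine (MvPolynomial.totalDegree_mul _ _).trans ?_
    rw [MvPolynomial.totalDegree_C, zero_add]
    refine (MvPolynomial.totalDegree_mul _ _).trans ?_
    rw [MvPolynomial.totalDegree_X, MvPolynomial.totalDegree_X]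
  have h := char_dvd_card_solutions p hd
  have h0 : MvPolynomial.eval (0 : Fin 4 → ZMod p) f = 0 := by simp [f]
  have h1 : 1 < Fintype.card {x // MvPolynomial.eval x f = 0} :=
    lt_of_lt_of_le hp.out.one_lt (Nat.le_of_dvd (Fintype.card_pos_iff.2 ⟨⟨0, h0⟩⟩) h)
  obtain ⟨⟨y, hy⟩, hne⟩ := Fintype.exists_ne_of_one_lt_card h1 ⟨0, h0⟩
  have hy0 : y ≠ 0 := fun h => hne (Subtype.ext h)
  obtain ⟨i, hi⟩ := Function.ne_iff.1 hy0
  choose x hx using fun i => ZMod.intCast_surjective (y i)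
  refine ⟨x, ⟨i, fun h => hi ?_⟩, ?_⟩
  · rw [← hx i]; exact (ZMod.intCast_zmod_eq_zero_iff_dvd _ p).2 h
  · rw [← ZMod.intCast_zmod_eq_zero_iff_dvd]
    simp only [f, map_sum, map_mul, MvPolynomial.eval_C, MvPolynomial.eval_X] at hy
    push_cast
    simp only [hx]
    exact hy

section
set_option linter.unusedSectionVars false
variable {D : Type*} [DivisionRing D] [CharZero D]

lemma QD.nrd_pow (Q : QD D) (x : D) (k : ℕ) : Q.nrd (x ^ k) = Q.nrd x ^ k := by
  induction k with
  | zero => simp [nrd_one]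
  | succ k ih => rw [pow_succ, nrd_mul, ih, pow_succ]

namespace Setup
variable {p : ℕ} {Q : QD D} {Λ : Subring D} (S : Setup p Q Λ) [hP : Fact p.Prime]
include S

lemma mem_of_pow {x : D} {k : ℕ} (h : p ^ k • x ∈ Λ) (hv : Q.v p x ≤ 1) : x ∈ Λ := by
  obtain ⟨m, hm, h2⟩ := S.mem_Loc_p.2 hv
  exact mem_of_coprime (I := Λ.toAddSubgroup)
    (((Nat.Prime.coprime_iff_not_dvd hP.out).2 hm).pow_left k) h h2

lemma exists_pi : ∃ x ∈ Λ, Q.v p x = (p : ℚ)⁻¹ := by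
  have hp1 : (1 : ℚ) < p := by exact_mod_cast hP.out.one_lt
  obtain ⟨b, hb⟩ := Q.exists_basis S.lat
  have hbm : ∀ i, b i ∈ Λ := fun i => (hb (b i)).2 fun j => by
    rw [b.repr_self, Finsupp.single_apply]; split_ifs
    · exact ⟨1, by simp⟩
    · exact ⟨0, by simp⟩
  choose n hn using fun i => S.nrd_int (hbm i)
  have hB : ∀ i j, ∃ z : ℤ, Q.B (b i) (b j) = z := fun i j => S.le_dual (hbm i) _ (hbm j)
  choose e he using hB
  obtain ⟨x, ⟨i, hi⟩, hx⟩ := chev (p := p)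
    (fun i j => if i = j then n i else if i < j then e i j else 0)
  set X : D := ∑ i, (x i : ℚ) • b i with hX
  have hrepr : ∀ j, b.repr X j = x j := fun j => by rw [hX, b.repr_sum_self]
  have hXm : X ∈ Λ := (hb X).2 fun j => ⟨x j, hrepr j⟩
  obtain ⟨z, hz⟩ := hx
  have hnX : Q.nrd X = (p : ℚ) * z := by
    have : Q.nrd X = ((∑ i, ∑ j, (if i = j then n i else if i < j then e i j else 0)
        * (x i * x j) : ℤ) : ℚ) := by
      rw [hX]
      simp only [Fin.sum_univ_four, QD.nrd_add, QD.B_add_left, QD.nrd_smul, QD.B_smul_left,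
        QD.B_smul_right, hn, he]
      simp [Fin.ext_iff, Fin.lt_def]
      ring
    rw [this, hz]; push_cast; ring
  have hX0 : X ≠ 0 := by
    intro h; apply hi
    have := hrepr i
    rw [h] at this
    simp at this
    have h0 : x i = 0 := by exact_mod_cast this.symm
    rw [h0]; exact dvd_zero _
  obtain ⟨k, hk⟩ := Q.v_val (ℓ := p) hX0
  have hk1 : k ≤ -1 := by
    have h1 : Q.v p X ≤ (p : ℚ) ^ (-1 : ℤ) := by
      rw [QD.v, hnX, padicNorm.mul, padicNorm.padicNorm_p hP.out.one_lt, zpow_neg_one]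
      exact mul_le_of_le_one_right (by positivity) (padicNorm.of_int z)
    rw [hk] at h1
    exact (zpow_le_zpow_iff_right₀ hp1).1 h1
  refine ⟨X, hXm, ?_⟩
  rw [hk, ← zpow_neg_one]
  congr 1
  by_contra hne
  have hk2 : k ≤ -2 := by omega
  apply hi
  have hp0 : (p : D) ≠ 0 := by exact_mod_cast hP.out.ne_zero
  have hq : (p : D)⁻¹ * X ∈ Λ := by
    refine S.mem_of_pow (k := 1) ?_ ?_
    · rw [pow_one, nsmul_eq_mul, mul_inv_cancel_left₀ hp0]; exact hXm
    · rw [Q.v_mul, Q.v_inv, Q.v_nat, padicNorm.padicNorm_p hP.out.one_lt, hk, inv_pow, inv_inv,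
        ← zpow_natCast, ← zpow_add₀ (by positivity)]
      exact zpow_le_one_of_nonpos₀ hp1.le (by push_cast; omega)
  obtain ⟨w, hw⟩ := (hb _).1 hq i
  refine ⟨w, ?_⟩
  have h3 : X = (p : ℚ) • ((p : D)⁻¹ * X) := by
    rw [Nat.cast_smul_eq_nsmul, nsmul_eq_mul, mul_inv_cancel_left₀ hp0]
  have := hrepr i
  rw [h3, map_smul, Finsupp.smul_apply, hw, smul_eq_mul] at this
  exact_mod_cast this.symm

/-- the right overlattices at `p` -/
def Ip (c : ℕ) : AddSubgroup D where
  carrier := {x | (∃ k : ℕ, p ^ k • x ∈ Λ) ∧ Q.v p x ≤ (p : ℚ) ^ c}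
  zero_mem' := ⟨⟨0, by simp⟩, by rw [QD.v_zero]; positivity⟩
  add_mem' := by
    rintro x y ⟨⟨k, hk⟩, hx⟩ ⟨⟨l, hl⟩, hy⟩
    refine ⟨⟨k + l, ?_⟩, (S.v_add x y).trans (max_le hx hy)⟩
    rw [smul_add]
    refine Λ.add_mem ?_ ?_
    · rw [pow_add, mul_comm, mul_smul]; exact nsmul_mem hk _
    · rw [pow_add, mul_smul]; exact nsmul_mem hl _
  neg_mem' := by
    rintro x ⟨⟨k, hk⟩, hx⟩
    exact ⟨⟨k, by rw [smul_neg]; exact neg_mem hk⟩, by rwa [QD.v_neg]⟩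

lemma mem_Ip {c : ℕ} {x : D} : x ∈ S.Ip c ↔ (∃ k : ℕ, p ^ k • x ∈ Λ) ∧ Q.v p x ≤ (p : ℚ) ^ c :=
  Iff.rfl

lemma le_Ip (c : ℕ) : Λ.toAddSubgroup ≤ S.Ip c := fun x hx =>
  ⟨⟨0, by simpa using hx⟩, (S.v_le_one (le_Loc hx)).trans
    (one_le_pow₀ (by exact_mod_cast hP.out.one_le))⟩

lemma v_p : Q.v p (p : D) = ((p : ℚ) ^ 2)⁻¹ := by
  rw [Q.v_nat, padicNorm.padicNorm_p hP.out.one_lt, inv_pow]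

lemma Ip_smul {c : ℕ} {x : D} (hx : x ∈ S.Ip c) : p ^ c • x ∈ Λ := by
  obtain ⟨⟨k, hk⟩, hv⟩ := hx
  have hp1 : (1 : ℚ) ≤ p := by exact_mod_cast hP.out.one_le
  refine S.mem_of_pow (k := k) ?_ ?_
  · rw [smul_comm]; exact nsmul_mem hk _
  · rw [nsmul_eq_mul, Q.v_mul, Nat.cast_pow, Q.v_pow, S.v_p, inv_pow,
      inv_mul_le_one₀ (by positivity)]
    exact hv.trans (pow_le_pow_left₀ (by positivity) (by nlinarith) c)

lemma isRt_Ip (c : ℕ) : IsRt Λ (S.Ip c) := by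
  refine ⟨S.lat.of_nsmul (S.le_Ip c) (m := p ^ c) (pow_pos hP.out.pos c)
    fun x hx => S.Ip_smul hx, ?_⟩
  rintro x ⟨⟨k, hk⟩, hv⟩ a ha
  refine ⟨⟨k, by rw [← smul_mul_assoc]; exact Λ.mul_mem hk ha⟩, ?_⟩
  rw [Q.v_mul]
  exact (mul_le_of_le_one_right (Q.v_nonneg x) (S.v_le_one (le_Loc ha))).trans hv

lemma Ip_index (c : ℕ) : Λ.toAddSubgroup.relIndex (S.Ip c) = p ^ (2 * c) := by
  obtain ⟨π, hπ, hv⟩ := S.exists_pi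
  have hp0 : (p : ℚ) ≠ 0 := by exact_mod_cast hP.out.ne_zero
  have hp0' : (p : D) ≠ 0 := by exact_mod_cast hP.out.ne_zero
  have hπ0 : π ≠ 0 := by
    rintro rfl; rw [Q.v_zero] at hv; exact inv_ne_zero hp0 hv.symm
  obtain ⟨m, hm, hmn⟩ : ∃ m : ℕ, ¬ p ∣ m ∧ Q.nrd π = p * m := by
    obtain ⟨z, hz⟩ := S.nrd_int hπ
    have hz0 : 0 < z := by have := Q.pos π hπ0; rw [hz] at this; exact_mod_cast this
    lift z to ℕ using hz0.le
    rw [QD.v, hz] at hv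
    have h1 : p ∣ z := by
      by_contra h
      have := (padicNorm.nat_eq_one_iff (p := p) z).2 h
      push_cast at hv
      rw [this] at hv
      have h2 : (p : ℚ) = 1 := by rw [← inv_inv (p : ℚ), ← hv, inv_one]
      exact hP.out.one_lt.ne' (by exact_mod_cast h2)
    obtain ⟨m, rfl⟩ := h1
    refine ⟨m, fun h => ?_, by rw [hz]; push_cast; ring⟩
    have h3 := (padicNorm.nat_lt_one_iff (p := p) m).2 h
    push_cast at hv
    rw [padicNorm.mul, padicNorm.padicNorm_p hP.out.one_lt] at hv
    have : padicNorm p (m : ℚ) = 1 := by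
      have := inv_ne_zero hp0
      field_simp at hv; exact hv
    linarith
  have hm0 : 0 < m := Nat.pos_of_ne_zero fun h => hm (h ▸ dvd_zero p)
  set τ := π ^ c with hτ
  have hτ0 : τ ≠ 0 := pow_ne_zero _ hπ0
  have hτm : τ ∈ Λ := pow_mem hπ c
  have hvτ : Q.v p τ = ((p : ℚ) ^ c)⁻¹ := by rw [hτ, Q.v_pow, hv, inv_pow]
  have hnτ : Q.nrd τ = (p : ℚ) ^ c * m ^ c := by
    rw [hτ, ← mul_pow, ← hmn, QD.nrd_pow]
  have h1 : lm τ (S.Ip c) ≤ Λ.toAddSubgroup := by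
    rw [lm_le_iff]
    rintro y ⟨⟨k, hk⟩, hy⟩
    refine S.mem_of_pow (k := k) (by rw [← mul_smul_comm]; exact Λ.mul_mem hτm hk) ?_
    rw [Q.v_mul, hvτ, inv_mul_le_one₀ (by have := hP.out.pos; positivity)]; exact hy
  have h2 : lm ((m ^ c : ℕ) : D) Λ.toAddSubgroup ≤ lm τ (S.Ip c) := by
    rw [lm_le_iff]
    intro a ha
    rw [mem_lm' hτ0]
    have h3 : p ^ c • (τ⁻¹ * (((m ^ c : ℕ) : D) * a)) = Q.conj τ * a := by
      rw [← mul_right_inj' hτ0, ← mul_assoc τ (Q.conj τ), Q.mul_conj, hnτ, mul_smul_comm,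
        mul_inv_cancel_left₀ hτ0, nsmul_eq_mul, ← mul_assoc, ← Nat.cast_mul, ← nsmul_eq_mul,
        smul_mul_assoc, one_mul, ← Nat.cast_smul_eq_nsmul ℚ]
      push_cast; rfl
    refine ⟨⟨c, by rw [h3]; exact Λ.mul_mem (S.conj_mem hτm) ha⟩, ?_⟩
    rw [Q.v_mul, Q.v_inv, hvτ, inv_inv]
    exact mul_le_of_le_one_right (by positivity)
      (S.v_le_one (le_Loc (Λ.mul_mem (natCast_mem Λ _) ha)))
  have hI := (S.isRt_Ip c).1
  have e1 := Q.cov_lm hI hτ0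
  have e2 := Q.cov_relIndex hI S.lat (S.le_Ip c)
  have e3 := Q.cov_relIndex S.lat (hI.lm hτ0) h1
  have hpos := Q.cov_pos hI
  set a := Λ.toAddSubgroup.relIndex (S.Ip c)
  set b := (lm τ (S.Ip c)).relIndex Λ.toAddSubgroup
  have hab : a * b = p ^ (2 * c) * m ^ (2 * c) := by
    have : (a * b : ℝ) = p ^ (2 * c) * m ^ (2 * c) := by
      rw [e1, e2, hnτ] at e3
      push_cast at e3
      rw [mul_comm, mul_assoc] at e3
      have := mul_left_cancel₀ hpos.ne' e3
      rw [← this]; ring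
    exact_mod_cast this
  have hb : b ∣ m ^ (c * 4) := by
    have := AddSubgroup.relIndex_mul_relIndex _ _ _ h2 h1
    rw [Q.relIndex_nat S.lat (pow_pos hm0 c), ← pow_mul] at this
    exact ⟨_, (mul_comm b _).symm ▸ this.symm⟩
  have ha : a ∣ p ^ (c * 4) := by
    have h4 : lm ((p ^ c : ℕ) : D) (S.Ip c) ≤ Λ.toAddSubgroup := lm_le_iff.2 fun x hx => by
      rw [← nsmul_eq_mul]; exact S.Ip_smul hx
    have := AddSubgroup.relIndex_mul_relIndex _ _ _ h4 (S.le_Ip c)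
    rw [Q.relIndex_nat hI (pow_pos hP.out.pos c), ← pow_mul] at this
    exact ⟨_, (mul_comm a _).symm ▸ this.symm⟩
  have hcop : p.Coprime m := (Nat.Prime.coprime_iff_not_dvd hP.out).2 hm
  refine Nat.dvd_antisymm ?_ ?_
  · have : a.Coprime (m ^ (2 * c)) := Nat.Coprime.coprime_dvd_left ha (hcop.pow _ _)
    exact this.dvd_of_dvd_mul_right (hab ▸ dvd_mul_right a b)
  · have : (p ^ (2 * c)).Coprime b := Nat.Coprime.coprime_dvd_right hb (hcop.pow _ _)
    exact this.dvd_of_dvd_mul_right (hab ▸ dvd_mul_right _ _)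

lemma eq_Ip {I : AddSubgroup D} (hI : IsRt Λ I) (h1 : Λ.toAddSubgroup ≤ I)
    (h2 : ∀ x ∈ I, ∃ k : ℕ, p ^ k • x ∈ Λ) : ∃ c, I = S.Ip c := by
  have hp1 : (1 : ℚ) < p := by exact_mod_cast hP.out.one_lt
  obtain ⟨u, hu, hu0, hmax⟩ := S.exists_max (ℓ := p) hI.1
  obtain ⟨n, hn⟩ := Q.v_val (ℓ := p) hu0
  have hn0 : 0 ≤ n := by
    have := hmax 1 (h1 Λ.one_mem)
    rw [Q.v_one, hn] at this
    exact (one_le_zpow_iff_right₀ hp1).1 this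
  lift n to ℕ using hn0
  rw [zpow_natCast] at hn
  refine ⟨n, le_antisymm (fun x hx => ⟨h2 x hx, hn ▸ hmax x hx⟩) ?_⟩
  rintro x ⟨⟨k, hk⟩, hx⟩
  obtain ⟨m, hm, h⟩ := (S.Loc_p_eq hI hu hu0 hmax x).2 (hn ▸ hx)
  exact mem_of_coprime (((Nat.Prime.coprime_iff_not_dvd hP.out).2 hm).pow_left k) (h1 hk) h

lemma Ip_le_dual : S.Ip 1 ≤ Q.dual Λ.toAddSubgroup := by
  have hp1 : (1 : ℚ) < p := by exact_mod_cast hP.out.one_lt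
  rintro x ⟨⟨k, hk⟩, hx⟩ y hy
  refine padic_int_pow (ℓ := p) (k := k) ?_ ?_
  · have h1 := S.ram (x * Q.conj y)
    change padicNorm p (Q.B x y) ^ 2 ≤ Q.v p _ at h1
    rw [Q.v_mul] at h1
    have h2 := h1.trans (mul_le_of_le_one_right (Q.v_nonneg x)
      (S.v_le_one (le_Loc (S.conj_mem hy))))
    by_cases h0 : Q.B x y = 0
    · rw [h0, padicNorm.zero]; exact zero_le_one
    obtain ⟨n, hn⟩ := padicNorm.values_discrete (p := p) h0
    have h3 := h2.trans hx
    rw [hn, ← zpow_natCast, ← zpow_natCast, ← zpow_mul, zpow_le_zpow_iff_right₀ hp1] at h3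
    rw [hn]
    exact zpow_le_one_of_nonpos₀ hp1.le (by push_cast at h3; omega)
  · rw [← Q.B_smul_left, Nat.cast_smul_eq_nsmul]
    exact S.le_dual hk y hy

lemma dual_eq : Q.dual Λ.toAddSubgroup = S.Ip 1 := by
  refine le_antisymm (fun x hx => ⟨?_, ?_⟩) S.Ip_le_dual
  · obtain ⟨N, hN, hNx⟩ := S.lat.2 x
    obtain ⟨k, m, hm, rfl⟩ := Nat.exists_eq_pow_mul_and_not_dvd hN.ne' p hP.out.one_lt.ne'
    refine ⟨k, mem_of_forall_Loc (I := Λ.toAddSubgroup) fun ℓ hl => ?_⟩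
    by_cases hlp : ℓ = p
    · subst hlp
      exact ⟨m, hm, by rw [smul_smul, mul_comm]; exact hNx⟩
    · exact AddSubgroup.nsmul_mem _ (S.dual_le_Loc hlp hx) _
  by_contra hv
  have hp1 : (1 : ℚ) < p := by exact_mod_cast hP.out.one_lt
  have hp0' : (p : D) ≠ 0 := by exact_mod_cast hP.out.ne_zero
  have hx0 : x ≠ 0 := by rintro rfl; apply hv; rw [Q.v_zero]; positivity
  obtain ⟨n, hn⟩ := Q.v_val (ℓ := p) hx0
  have hv2 : (p : ℚ) ^ 2 ≤ Q.v p x := by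
    rw [hn, ← zpow_natCast, zpow_le_zpow_iff_right₀ hp1]
    rw [hn, ← zpow_natCast, zpow_le_zpow_iff_right₀ hp1] at hv
    push_cast at *; omega
  have key : ∀ z ∈ Λ, ∀ t : ℤ, Q.trd z = t → (p : ℤ) ∣ t := by
    intro z hz t ht
    set w := (p : D)⁻¹ * (x⁻¹ * z) with hw
    have hwL : w ∈ Loc p Λ.toAddSubgroup := by
      rw [S.mem_Loc_p, hw, Q.v_mul, Q.v_mul, Q.v_inv, Q.v_inv, S.v_p, inv_inv, ← mul_assoc]
      refine mul_le_one₀ ?_ (Q.v_nonneg z) (S.v_le_one (le_Loc hz))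
      rw [← div_eq_mul_inv, div_le_one (Q.v_pos hx0)]; exact hv2
    obtain ⟨m, hm, hmw⟩ := hwL
    obtain ⟨y, hy⟩ := hx _ (S.conj_mem hmw)
    have h1 : (p : ℚ) * Q.B x (Q.conj (m • w)) = m * t := by
      rw [QD.B, QD.conj_conj, ← ht, ← smul_eq_mul (p : ℚ), ← smul_eq_mul (m : ℚ), ← map_smul, ← map_smul,
        Nat.cast_smul_eq_nsmul, Nat.cast_smul_eq_nsmul, hw]
      congr 1
      rw [mul_smul_comm, smul_comm]
      congr 1
      rw [nsmul_eq_mul, (Nat.cast_commute p x).left_comm, mul_inv_cancel_left₀ hp0',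
        mul_inv_cancel_left₀ hx0]
    rw [hy] at h1
    have h2 : (p : ℤ) ∣ m * t := ⟨y, by exact_mod_cast h1.symm⟩
    exact (Int.Prime.dvd_mul' hP.out h2).resolve_left fun h => hm (by exact_mod_cast h)
  have h2 : p = 2 := by
    have h3 : (p : ℤ) ∣ 2 := key 1 Λ.one_mem 2 (by rw [Q.trd_one]; rfl)
    exact (Nat.prime_dvd_prime_iff_eq hP.out Nat.prime_two).1 (by exact_mod_cast h3)
  subst h2
  have hI := (S.isRt_Ip 1).1
  have hK : ∀ z ∈ Λ, z ∈ lm ((2 : ℕ) : D) (S.Ip 1) ↔ Q.v 2 z < 1 := by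
    intro z hz
    rw [mem_lm' hp0', mem_Ip, Q.v_mul, Q.v_inv, S.v_p, inv_inv]
    constructor
    · rintro ⟨-, h⟩; push_cast at h; linarith
    · intro h
      refine ⟨⟨1, by rw [pow_one, nsmul_eq_mul, mul_inv_cancel_left₀ hp0']; exact hz⟩, ?_⟩
      by_cases hz0 : z = 0
      · rw [hz0, Q.v_zero]; norm_num
      obtain ⟨n, hn⟩ := Q.v_val (ℓ := 2) hz0
      have h5 : n ≤ -1 := by
        rw [hn] at h
        have := (zpow_lt_one_iff_right₀ hp1).1 h
        omega
      have : Q.v 2 z ≤ ((2 : ℕ) : ℚ) ^ (-1 : ℤ) := by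
        rw [hn]; exact zpow_le_zpow_right₀ hp1.le h5
      rw [zpow_neg_one] at this
      push_cast at this ⊢
      linarith
  have hle : lm ((2 : ℕ) : D) (S.Ip 1) ≤ Λ.toAddSubgroup := lm_le_iff.2 fun y hy => by
    have := S.Ip_smul hy
    rwa [pow_one, nsmul_eq_mul] at this
  have h4 : (lm ((2 : ℕ) : D) (S.Ip 1)).relIndex Λ.toAddSubgroup = 2 := by
    rw [AddSubgroup.relIndex_eq_two_iff]
    refine ⟨1, Λ.one_mem, fun b hb => ?_⟩
    rw [hK b hb, hK (b + 1) (Λ.add_mem hb Λ.one_mem)]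
    obtain ⟨t, ht⟩ := S.trd_int hb
    obtain ⟨s, hs⟩ := key b hb t ht
    obtain ⟨n, hn⟩ := S.nrd_int hb
    have h6 : Q.nrd (b + 1) = ((n + 1 + 2 * s : ℤ) : ℚ) := by
      have := Q.trd_eq b
      rw [ht, hs, hn] at this
      push_cast at this ⊢
      linarith
    rw [QD.v, QD.v, h6, hn, padicNorm.int_lt_one_iff, padicNorm.int_lt_one_iff]
    push_cast
    rw [xor_iff_not_iff']
    omega
  have h5 := AddSubgroup.relIndex_mul_relIndex _ _ _ hle (S.le_Ip 1)
  rw [h4, S.Ip_index, Q.relIndex_nat hI (by norm_num)] at h5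
  norm_num at h5

lemma cov_Λ : Q.cov Λ.toAddSubgroup = p / 4 := by
  have h1 := Q.cov_dual S.lat
  rw [S.dual_eq] at h1
  have h2 := Q.cov_relIndex (S.isRt_Ip 1).1 S.lat (S.le_Ip 1)
  rw [S.Ip_index] at h2
  push_cast at h2
  have h3 := Q.cov_pos S.lat
  have hp0 : (0 : ℝ) < p := by exact_mod_cast hP.out.pos
  have h4 : Q.cov Λ.toAddSubgroup ^ 2 = (p / 4 : ℝ) ^ 2 := by
    have : Q.cov Λ.toAddSubgroup ^ 2 = Q.cov Λ.toAddSubgroup * (Q.cov (S.Ip 1)) * p ^ 2 := by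
      rw [sq]; nth_rw 2 [h2]; ring
    rw [this, h1]; ring
  exact (sq_eq_sq₀ h3.le (by positivity)).1 h4
end Setup
end
end Eich

namespace Eich

section Count
set_option linter.unusedSectionVars false
variable {N : ℕ} [NeZero N]

lemma card_zm {a e : ℕ} (h : a * e = N) :
    Nat.card (AddSubgroup.zmultiples (e : ZMod N)) = a := by
  have hN := NeZero.ne N
  have he : e ≠ 0 := fun h0 => hN (by rw [← h, h0, mul_zero])
  rw [Nat.card_zmultiples, ZMod.addOrderOf_coe e hN, ← h, Nat.gcd_eq_right (dvd_mul_left e a),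
    Nat.mul_div_cancel _ (Nat.pos_of_ne_zero he)]

lemma mem_zm {a e : ℕ} (h : a * e = N) {x : ZMod N} (hx : a • x = 0) :
    x ∈ AddSubgroup.zmultiples (e : ZMod N) := by
  have hN := NeZero.ne N
  have ha : a ≠ 0 := fun h0 => hN (by rw [← h, h0, zero_mul])
  obtain ⟨z, rfl⟩ := ZMod.intCast_surjective x
  rw [← natCast_zsmul, zsmul_eq_mul, ← Int.cast_mul, ZMod.intCast_zmod_eq_zero_iff_dvd] at hx
  obtain ⟨w, hw⟩ := hx
  refine ⟨w, ?_⟩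
  have : z = w * e := by
    have ha' : (a : ℤ) ≠ 0 := by exact_mod_cast ha
    apply mul_left_cancel₀ ha'
    rw [hw, ← h]; push_cast; ring
  simp [this]

lemma eq_zm {a e : ℕ} (h : a * e = N) {H : AddSubgroup (ZMod N)} (hH : Nat.card H = a) :
    H = AddSubgroup.zmultiples (e : ZMod N) := by
  have hle : H ≤ AddSubgroup.zmultiples (e : ZMod N) := fun x hx => mem_zm h (by
    have := card_nsmul_eq_zero' (G := H) (x := ⟨x, hx⟩)
    rw [hH] at this
    exact congrArg Subtype.val this)
  exact AddSubgroup.eq_of_le_of_card_ge hle (by rw [hH, card_zm h])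

/-- fibre over zero -/
def ker0 (W : AddSubgroup (ZMod N × ZMod N)) : AddSubgroup (ZMod N) :=
  W.comap (AddMonoidHom.inr _ _)

lemma mem_ker0 {W : AddSubgroup (ZMod N × ZMod N)} {y : ZMod N} : y ∈ ker0 W ↔ ((0, y) : ZMod N × ZMod N) ∈ W :=
  Iff.rfl

lemma card_W (W : AddSubgroup (ZMod N × ZMod N)) :
    Nat.card W = Nat.card (W.map (AddMonoidHom.fst _ _)) * Nat.card (ker0 W) := by
  let f : W →+ ZMod N := (AddMonoidHom.fst _ _).comp W.subtype
  have h1 := AddSubgroup.card_mul_index f.ker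
  rw [AddSubgroup.index_ker] at h1
  have h2 : f.range = W.map (AddMonoidHom.fst _ _) := by
    ext x; simp [f, AddMonoidHom.mem_range]
  have h3 : Nat.card f.ker = Nat.card (ker0 W) := Nat.card_congr
    { toFun := fun w => ⟨w.1.1.2, by
        have h : w.1.1.1 = 0 := w.2
        have h' := w.1.2
        rw [mem_ker0, ← h]; exact h'⟩
      invFun := fun y => ⟨⟨(0, y.1), y.2⟩, rfl⟩
      left_inv := fun w => by
        have h : w.1.1.1 = 0 := w.2
        apply Subtype.ext; apply Subtype.ext
        exact Prod.ext h.symm rfl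
      right_inv := fun y => rfl }
  rw [← h1, h2, h3, mul_comm]

/-- the standard subgroups -/
def Wac (e f c g : ℕ) : AddSubgroup (ZMod N × ZMod N) :=
  AddSubgroup.zmultiples ((e : ZMod N), ((c * g : ℕ) : ZMod N)) ⊔
    AddSubgroup.zmultiples ((0 : ZMod N), (f : ZMod N))

lemma mem_Wac {e f c g : ℕ} {w : ZMod N × ZMod N} : w ∈ Wac (N := N) e f c g ↔
    ∃ s t : ℤ, w = (((s * e : ℤ) : ZMod N), ((s * (c * g) + t * f : ℤ) : ZMod N)) := by
  simp only [Wac, AddSubgroup.mem_sup, AddSubgroup.mem_zmultiples_iff]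
  constructor
  · rintro ⟨_, ⟨s, rfl⟩, _, ⟨t, rfl⟩, rfl⟩
    exact ⟨s, t, by ext <;> simp⟩
  · rintro ⟨s, t, rfl⟩
    exact ⟨_, ⟨s, rfl⟩, _, ⟨t, rfl⟩, by ext <;> simp⟩

variable {a d g : ℕ} (h : a * d * g = N)
include h

lemma Wac_fst (c : ℕ) : (Wac (N := N) (d * g) (a * g) c g).map (AddMonoidHom.fst _ _)
    = AddSubgroup.zmultiples ((d * g : ℕ) : ZMod N) := by
  rw [Wac, AddSubgroup.map_sup, AddMonoidHom.map_zmultiples, AddMonoidHom.map_zmultiples]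
  simp

lemma Wac_ker (c : ℕ) : ker0 (Wac (N := N) (d * g) (a * g) c g)
    = AddSubgroup.zmultiples ((a * g : ℕ) : ZMod N) := by
  have hN := NeZero.ne N
  ext y
  rw [mem_ker0, mem_Wac]
  constructor
  · rintro ⟨s, t, hst⟩
    rw [Prod.mk.injEq] at hst
    obtain ⟨h1, rfl⟩ := hst
    have h1 := (ZMod.intCast_zmod_eq_zero_iff_dvd _ N).1 h1.symm
    have : (a : ℤ) ∣ s := by
      have h0 : ((d * g : ℕ) : ℤ) ≠ 0 := by
        intro h0
        have : d * g = 0 := by exact_mod_cast h0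
        apply hN; rw [← h, mul_assoc, this, mul_zero]
      apply Int.dvd_of_mul_dvd_mul_right h0
      refine dvd_trans ?_ h1
      rw [← h]; push_cast; exact ⟨1, by ring⟩
    obtain ⟨s, rfl⟩ := this
    refine ⟨s * c + t, ?_⟩
    simp; ring
  · rintro ⟨t, rfl⟩
    exact ⟨0, t, by simp⟩

lemma Wac_card (c : ℕ) : Nat.card (Wac (N := N) (d * g) (a * g) c g) = a * d := by
  rw [card_W, Wac_fst h, Wac_ker h, card_zm (a := a) (by rw [← h]; ring),
    card_zm (a := d) (by rw [← h]; ring)]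

lemma Wac_inj {c c' : ℕ} (hc : c < a) (hc' : c' < a)
    (hW : Wac (N := N) (d * g) (a * g) c g = Wac (d * g) (a * g) c' g) : c = c' := by
  have hN := NeZero.ne N
  have h1 : (((d * g : ℕ) : ZMod N), ((c * g : ℕ) : ZMod N)) ∈ Wac (N := N) (d * g) (a * g) c' g := by
    rw [← hW]; exact mem_Wac.2 ⟨1, 0, by simp⟩
  have h2 : (((d * g : ℕ) : ZMod N), ((c' * g : ℕ) : ZMod N)) ∈ Wac (N := N) (d * g) (a * g) c' g :=
    mem_Wac.2 ⟨1, 0, by simp⟩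
  have h3 := AddSubgroup.sub_mem _ h1 h2
  rw [Prod.mk_sub_mk, sub_self, ← mem_ker0, Wac_ker h] at h3
  obtain ⟨t, ht⟩ := h3
  have h4 : ((t * (a * g) - (c * g - c' * g) : ℤ) : ZMod N) = 0 := by
    simp at ht ⊢; rw [ht]; ring
  rw [ZMod.intCast_zmod_eq_zero_iff_dvd, ← h] at h4
  obtain ⟨w, hw⟩ := h4
  have hg : (g : ℤ) ≠ 0 := by
    intro h0; apply hN; have : g = 0 := by exact_mod_cast h0
    rw [← h, this, mul_zero]
  have h5 : (c : ℤ) - c' = a * (t - d * w) := by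
    apply mul_left_cancel₀ hg
    push_cast at hw
    linear_combination -hw
  have h6 : (c : ℤ) % a = c' % a := by
    exact (Int.emod_emod_of_dvd _ dvd_rfl).symm.trans
      ((Int.ModEq.symm (Int.modEq_iff_dvd.2 ⟨_, h5⟩)).eq ▸ Int.emod_emod_of_dvd _ dvd_rfl)
  rw [Int.emod_eq_of_lt (by positivity) (by exact_mod_cast hc),
    Int.emod_eq_of_lt (by positivity) (by exact_mod_cast hc')] at h6
  exact_mod_cast h6

lemma exists_Wac {W : AddSubgroup (ZMod N × ZMod N)}
    (h1 : Nat.card (W.map (AddMonoidHom.fst _ _)) = a) (h2 : Nat.card (ker0 W) = d) :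
    ∃ c < a, W = Wac (d * g) (a * g) c g := by
  have hN := NeZero.ne N
  have ha0 : 0 < a := Nat.pos_of_ne_zero fun h0 => hN (by rw [← h, h0]; ring)
  have h1' := eq_zm (a := a) (e := d * g) (by rw [← h]; ring) h1
  have h2' := eq_zm (a := d) (e := a * g) (by rw [← h]; ring) h2
  have hm : ((d * g : ℕ) : ZMod N) ∈ W.map (AddMonoidHom.fst _ _) := by
    rw [h1']; exact AddSubgroup.mem_zmultiples _
  obtain ⟨⟨x, y⟩, hxy, hx⟩ := hm
  change x = _ at hx
  subst hx
  have hay : a • y ∈ ker0 W := by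
    have := W.nsmul_mem hxy a
    rw [mem_ker0]
    convert this using 1
    ext
    · change (0 : ZMod N) = a • ((d * g : ℕ) : ZMod N)
      rw [nsmul_eq_mul]
      rw [← Nat.cast_mul, ← mul_assoc, h, ZMod.natCast_self]
    · rfl
  have hy : y ∈ AddSubgroup.zmultiples ((g : ℕ) : ZMod N) := by
    apply mem_zm (a := a * d) h
    rw [mul_comm, mul_smul]
    have := card_nsmul_eq_zero' (G := ker0 W) (x := ⟨_, hay⟩)
    rw [h2] at this
    exact congrArg Subtype.val this
  obtain ⟨s, rfl⟩ := hy
  have hmod : (((d * g : ℕ) : ZMod N), (((s % a).toNat * g : ℕ) : ZMod N)) ∈ W := by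
    have h3 : (((s / a) • ((a * g : ℕ) : ZMod N))) ∈ ker0 W := by
      rw [h2']; exact ⟨_, rfl⟩
    have := W.sub_mem hxy h3
    convert this using 1
    ext
    · simp
    · have h4 := Int.emod_add_mul_ediv s a
      have h5 : (((s % a).toNat : ℤ)) = s % a := Int.toNat_of_nonneg (Int.emod_nonneg _ (by omega))
      have h6 : (((s % a).toNat * g : ℕ) : ZMod N) = (((s % a) * g : ℤ) : ZMod N) := by
        rw [← h5]; push_cast; rfl
      simp only [AddMonoidHom.inr_apply, Prod.mk_sub_mk, h6]
      rw [show s % a = s - a * (s / a) by omega]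
      simp; ring
  refine ⟨(s % a).toNat, ?_, ?_⟩
  · have := Int.emod_lt_of_pos s (b := a) (by omega)
    omega
  · symm
    apply AddSubgroup.eq_of_le_of_card_ge
    · rw [Wac, sup_le_iff, AddSubgroup.zmultiples_le, AddSubgroup.zmultiples_le]
      refine ⟨hmod, ?_⟩
      rw [← mem_ker0, h2']; exact AddSubgroup.mem_zmultiples _
    · rw [Wac_card h, card_W, h1, h2]

end Count

lemma card_sub {N : ℕ} [NeZero N] {n g : ℕ} (hn : n * g = N) :
    Nat.card {W : AddSubgroup (ZMod N × ZMod N) // Nat.card W = n} = ∑ x ∈ n.divisors, x := by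
  have hN := NeZero.ne N
  have hn0 : n ≠ 0 := fun h0 => hN (by rw [← hn, h0, zero_mul])
  have key : Nat.card (Σ x : n.divisors, Fin x.1) =
      Nat.card {W : AddSubgroup (ZMod N × ZMod N) // Nat.card W = n} := by
    have hd : ∀ x : n.divisors, x.1 * (n / x.1) = n := fun x =>
      Nat.mul_div_cancel' (Nat.dvd_of_mem_divisors x.2)
    have hd' : ∀ x : n.divisors, x.1 * (n / x.1) * g = N := fun x => by rw [hd, hn]
    refine Nat.card_congr (Equiv.ofBijective
      (fun x => ⟨Wac ((n / x.1.1) * g) (x.1.1 * g) x.2 g, by rw [Wac_card (hd' _), hd]⟩) ⟨?_, ?_⟩)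
    · rintro ⟨x, c⟩ ⟨y, c'⟩ h
      have h := congrArg Subtype.val h
      simp only at h
      have hxy : x = y := by
        apply Subtype.ext
        rw [← card_zm (a := x.1) (e := n / x.1 * g) (N := N) (by rw [← hd' x]; ring),
          ← card_zm (a := y.1) (e := n / y.1 * g) (N := N) (by rw [← hd' y]; ring),
          ← Wac_fst (hd' x) c, ← Wac_fst (hd' y) c', h]
      subst hxy
      have := Wac_inj (hd' x) c.2 c'.2 h
      rw [Fin.ext this]
    · rintro ⟨W, hW⟩
      have hc := card_W W
      rw [hW] at hc
      have hx : Nat.card (W.map (AddMonoidHom.fst _ _)) ∈ n.divisors :=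
        Nat.mem_divisors.2 ⟨⟨_, hc⟩, hn0⟩
      obtain ⟨c, hc', h⟩ := exists_Wac (hd' ⟨_, hx⟩) (W := W) rfl (by
        have h1 := hd ⟨_, hx⟩
        have h2 : Nat.card (W.map (AddMonoidHom.fst _ _)) ≠ 0 := fun h0 => hn0 (by
          rw [hc, h0, zero_mul])
        apply Nat.eq_of_mul_eq_mul_left (Nat.pos_of_ne_zero h2)
        rw [← hc]; exact h1.symm)
      exact ⟨⟨⟨_, hx⟩, ⟨c, hc'⟩⟩, Subtype.ext h.symm⟩
  rw [← key, Nat.card_sigma]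
  simp only [Nat.card_eq_fintype_card, Fintype.card_fin]
  exact Finset.sum_coe_sort n.divisors (fun x => x)
end Eich

namespace Eich
open Module

lemma relIndex_nsmul {G : Type*} [AddCommGroup G] {H K : AddSubgroup G} {x : G} (hx : x ∈ K) :
    H.relIndex K • x ∈ H := by
  have h := card_nsmul_eq_zero' (G := K ⧸ H.addSubgroupOf K) (x := QuotientAddGroup.mk ⟨x, hx⟩)
  change H.relIndex K • _ = _ at h
  rw [← QuotientAddGroup.mk_nsmul, QuotientAddGroup.eq_zero_iff, AddSubgroup.mem_addSubgroupOf] at h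
  exact h

lemma prime_dvd_of_relIndex {G : Type*} [AddCommGroup G] {H K : AddSubgroup G}
    (h0 : H.relIndex K ≠ 0) {q a : ℕ} (hq : q.Prime) (hd : q ∣ H.relIndex K)
    (ha : ∀ x ∈ K, a • x ∈ H) : q ∣ a := by
  have : Finite (K ⧸ H.addSubgroupOf K) := Nat.finite_of_card_ne_zero h0
  have : Fact q.Prime := ⟨hq⟩
  obtain ⟨x, hx⟩ := exists_prime_addOrderOf_dvd_card' (G := K ⧸ H.addSubgroupOf K) q hd
  rw [← hx, addOrderOf_dvd_iff_nsmul_eq_zero]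
  obtain ⟨y, rfl⟩ := QuotientAddGroup.mk_surjective x
  rw [← QuotientAddGroup.mk_nsmul, QuotientAddGroup.eq_zero_iff, AddSubgroup.mem_addSubgroupOf]
  exact ha _ y.2

/-- the local-to-global divisor function: sum of the divisors of `n` prime to `p` -/
def hp (p : ℕ) : ArithmeticFunction ℕ := ⟨fun d => if p ∣ d then 0 else d, by simp⟩

/-- sum of the divisors of `n` prime to `p` -/
def gp (p : ℕ) : ArithmeticFunction ℕ := hp p * ArithmeticFunction.zeta

lemma gp_apply (p n : ℕ) : gp p n = ∑ d ∈ n.divisors, if p ∣ d then 0 else d := by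
  rw [gp, ArithmeticFunction.mul_zeta_apply]; rfl

lemma gp_mult (p : ℕ) [hP : Fact p.Prime] : (gp p).IsMultiplicative := by
  refine ArithmeticFunction.IsMultiplicative.mul ⟨?_, ?_⟩ ArithmeticFunction.isMultiplicative_zeta
  · change (if p ∣ 1 then 0 else 1) = 1
    rw [if_neg (hP.out.one_lt.ne' ∘ Nat.dvd_one.1)]
  · intro m n _
    change (if p ∣ m * n then 0 else m * n) = (if p ∣ m then 0 else m) * (if p ∣ n then 0 else n)
    by_cases h1 : p ∣ m <;> by_cases h2 : p ∣ n <;> simp [hP.out.dvd_mul, h1, h2]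

lemma gp_pow_self (p : ℕ) [hP : Fact p.Prime] (k : ℕ) : gp p (p ^ k) = 1 := by
  rw [gp_apply, Nat.sum_divisors_prime_pow hP.out, Finset.sum_range_succ']
  simp [Nat.dvd_one, hP.out.one_lt.ne', pow_succ]

lemma gp_pow_ne {p ℓ : ℕ} [hP : Fact p.Prime] [hl : Fact ℓ.Prime] (k : ℕ) (h : ℓ ≠ p) :
    gp p (ℓ ^ k) = ∑ x ∈ (ℓ ^ k).divisors, x := by
  rw [gp_apply]
  refine Finset.sum_congr rfl fun x hx => if_neg fun hd => h ?_
  have := hP.out.dvd_of_dvd_pow (hd.trans (Nat.dvd_of_mem_divisors hx))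
  exact ((Nat.prime_dvd_prime_iff_eq hP.out hl.out).1 this).symm

section
set_option linter.unusedSectionVars false
variable {D : Type*} [DivisionRing D] [CharZero D]

/-- right overlattices of index `N` -/
def IsOv (Λ : Subring D) (N : ℕ) (I : AddSubgroup D) : Prop :=
  IsRt Λ I ∧ Λ.toAddSubgroup ≤ I ∧ Λ.toAddSubgroup.relIndex I = N

/-- type of overlattices -/
def Ov (Λ : Subring D) (N : ℕ) : Type _ := {I : AddSubgroup D // IsOv Λ N I}

/-- `a`-torsion part -/
def tor (Λ : Subring D) (a : ℕ) (I : AddSubgroup D) : AddSubgroup D :=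
  I ⊓ Λ.toAddSubgroup.comap (nsmulAddMonoidHom a)

lemma mem_tor {Λ : Subring D} {a : ℕ} {I : AddSubgroup D} {x : D} :
    x ∈ tor Λ a I ↔ x ∈ I ∧ a • x ∈ Λ := Iff.rfl

namespace Setup
variable {p : ℕ} {Q : QD D} {Λ : Subring D} (S : Setup p Q Λ)
include S

lemma isRt_tor {I : AddSubgroup D} (hI : IsRt Λ I) (h : Λ.toAddSubgroup ≤ I) (a : ℕ) :
    IsRt Λ (tor Λ a I) ∧ Λ.toAddSubgroup ≤ tor Λ a I := by
  have h2 : Λ.toAddSubgroup ≤ tor Λ a I := fun x hx => mem_tor.2 ⟨h hx, Λ.nsmul_mem hx a⟩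
  refine ⟨⟨S.lat.mono h2 (fg_of_le inf_le_left hI.1.1), ?_⟩, h2⟩
  rintro x ⟨h1, h3⟩ y hy
  refine ⟨hI.2 x h1 y hy, ?_⟩
  change a • (x * y) ∈ Λ
  rw [← smul_mul_assoc]; exact Λ.mul_mem h3 hy

lemma sup_index {A B : AddSubgroup D} (hA : Λ.toAddSubgroup ≤ A) (hAB : A ⊓ B = Λ.toAddSubgroup) :
    Λ.toAddSubgroup.relIndex (A ⊔ B) = Λ.toAddSubgroup.relIndex A * Λ.toAddSubgroup.relIndex B := by
  rw [← AddSubgroup.relIndex_mul_relIndex _ _ _ hA (le_sup_left (b := B)),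
    AddSubgroup.relIndex_sup_left, ← AddSubgroup.inf_relIndex_right A B, hAB]

lemma mem_of_cop {a b : ℕ} (hab : a.Coprime b) {x : D} (h1 : a • x ∈ Λ) (h2 : b • x ∈ Λ) : x ∈ Λ :=
  mem_of_coprime (I := Λ.toAddSubgroup) hab h1 h2

lemma tor_ov {a b : ℕ} (hab : a.Coprime b) (ha : 0 < a) (hb : 0 < b) {I : AddSubgroup D}
    (hI : IsOv Λ (a * b) I) :
    IsOv Λ a (tor Λ a I) ∧ IsOv Λ b (tor Λ b I) ∧ tor Λ a I ⊔ tor Λ b I = I := by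
  obtain ⟨h1, h2, h3⟩ := hI
  obtain ⟨a1, a2⟩ := S.isRt_tor h1 h2 a
  obtain ⟨b1, b2⟩ := S.isRt_tor h1 h2 b
  have hsup : tor Λ a I ⊔ tor Λ b I = I := by
    refine le_antisymm (sup_le inf_le_left inf_le_left) fun x hx => ?_
    have hx' : (a * b) • x ∈ Λ := h3 ▸ relIndex_nsmul (H := Λ.toAddSubgroup) hx
    have hbz := Nat.gcd_eq_gcd_ab a b
    rw [hab] at hbz
    have e : x = (Nat.gcdB a b) • (b • x) + (Nat.gcdA a b) • (a • x) := by
      rw [← natCast_zsmul, ← natCast_zsmul, smul_smul, smul_smul, ← add_smul]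
      rw [show Nat.gcdB a b * (b : ℤ) + Nat.gcdA a b * a = 1 by rw [mul_comm, add_comm, mul_comm _ (a : ℤ)]; exact_mod_cast hbz.symm, one_smul]
    rw [e]
    refine AddSubgroup.add_mem_sup (AddSubgroup.zsmul_mem _ (mem_tor.2 ⟨I.nsmul_mem hx b, ?_⟩) _)
      (AddSubgroup.zsmul_mem _ (mem_tor.2 ⟨I.nsmul_mem hx a, ?_⟩) _)
    · rw [smul_smul]; exact hx'
    · rw [smul_smul, mul_comm]; exact hx'
  have hinf : tor Λ a I ⊓ tor Λ b I = Λ.toAddSubgroup :=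
    le_antisymm (fun x hx => S.mem_of_cop hab hx.1.2 hx.2.2) (le_inf a2 b2)
  have hi := S.sup_index a2 hinf
  rw [hsup, h3] at hi
  have hpa := Q.relIndex_pos a1.1 S.lat a2
  have hpb := Q.relIndex_pos b1.1 S.lat b2
  have ca : (Λ.toAddSubgroup.relIndex (tor Λ a I)).Coprime b := by
    refine Nat.coprime_of_dvd fun q hq h1 h2 => ?_
    have h4 := prime_dvd_of_relIndex hpa.ne' hq h1 fun x hx => hx.2
    exact hq.one_lt.ne' (Nat.dvd_one.1 (hab ▸ Nat.dvd_gcd h4 h2))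
  have cb : (Λ.toAddSubgroup.relIndex (tor Λ b I)).Coprime a := by
    refine Nat.coprime_of_dvd fun q hq h1 h2 => ?_
    have h4 := prime_dvd_of_relIndex hpb.ne' hq h1 fun x hx => hx.2
    exact hq.one_lt.ne' (Nat.dvd_one.1 (hab ▸ Nat.dvd_gcd h2 h4))
  have da : Λ.toAddSubgroup.relIndex (tor Λ a I) ∣ a :=
    ca.dvd_of_dvd_mul_right (hi ▸ dvd_mul_right _ _)
  have db : Λ.toAddSubgroup.relIndex (tor Λ b I) ∣ b :=
    cb.dvd_of_dvd_mul_left (hi ▸ dvd_mul_left _ _)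
  have la := Nat.le_of_dvd ha da
  have lb := Nat.le_of_dvd hb db
  exact ⟨⟨a1, a2, by nlinarith⟩, ⟨b1, b2, by nlinarith⟩, hsup⟩

lemma sup_ov {a b : ℕ} (hab : a.Coprime b) {I J : AddSubgroup D}
    (hI : IsOv Λ a I) (hJ : IsOv Λ b J) :
    IsOv Λ (a * b) (I ⊔ J) ∧ tor Λ a (I ⊔ J) = I := by
  have hai : ∀ x ∈ I, a • x ∈ Λ := fun x hx => hI.2.2 ▸ relIndex_nsmul (H := Λ.toAddSubgroup) hx
  have hbj : ∀ x ∈ J, b • x ∈ Λ := fun x hx => hJ.2.2 ▸ relIndex_nsmul (H := Λ.toAddSubgroup) hx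
  have hinf : I ⊓ J = Λ.toAddSubgroup :=
    le_antisymm (fun x hx => S.mem_of_cop hab (hai x hx.1) (hbj x hx.2)) (le_inf hI.2.1 hJ.2.1)
  refine ⟨⟨⟨hI.1.1.sup hJ.1.1, ?_⟩, hI.2.1.trans le_sup_left, ?_⟩, ?_⟩
  · intro x hx c hc
    obtain ⟨y, hy, z, hz, rfl⟩ := AddSubgroup.mem_sup.1 hx
    rw [add_mul]
    exact AddSubgroup.add_mem_sup (hI.1.2 y hy c hc) (hJ.1.2 z hz c hc)
  · rw [S.sup_index hI.2.1 hinf, hI.2.2, hJ.2.2]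
  · refine le_antisymm ?_ fun x hx => mem_tor.2 ⟨AddSubgroup.mem_sup_left hx, hai x hx⟩
    rintro x ⟨hx, h⟩
    change a • x ∈ Λ at h
    obtain ⟨y, hy, z, hz, rfl⟩ := AddSubgroup.mem_sup.1 hx
    rw [smul_add] at h
    have h2 := Λ.sub_mem h (hai y hy)
    rw [add_sub_cancel_left] at h2
    exact I.add_mem hy (hI.2.1 (S.mem_of_cop hab h2 (hbj z hz)))

/-- multiplicativity -/
def ovEquiv {a b : ℕ} (hab : a.Coprime b) (ha : 0 < a) (hb : 0 < b) :
    Ov Λ (a * b) ≃ Ov Λ a × Ov Λ b where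
  toFun I := (⟨_, (S.tor_ov hab ha hb I.2).1⟩, ⟨_, (S.tor_ov hab ha hb I.2).2.1⟩)
  invFun x := ⟨x.1.1 ⊔ x.2.1, (S.sup_ov hab x.1.2 x.2.2).1⟩
  left_inv I := Subtype.ext (S.tor_ov hab ha hb I.2).2.2
  right_inv x := Prod.ext (Subtype.ext (S.sup_ov hab x.1.2 x.2.2).2) (Subtype.ext (by
    change tor Λ b (x.1.1 ⊔ x.2.1) = _
    rw [sup_comm]; exact (S.sup_ov hab.symm x.2.2 x.1.2).2))

lemma ov_p [hP : Fact p.Prime] (e : ℕ) : Finite (Ov Λ (p ^ e)) ∧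
    (Nonempty (Ov Λ (p ^ e)) → Even e) ∧ ∀ k, e = 2 * k → Nat.card (Ov Λ (p ^ e)) = 1 := by
  have key : ∀ I, IsOv Λ (p ^ e) I → ∃ c, I = S.Ip c ∧ e = 2 * c := by
    intro I hI
    obtain ⟨c, hc⟩ := S.eq_Ip hI.1 hI.2.1 fun x hx => ⟨e, hI.2.2 ▸ relIndex_nsmul (H := Λ.toAddSubgroup) hx⟩
    refine ⟨c, hc, ?_⟩
    have := hI.2.2
    rw [hc, S.Ip_index] at this
    exact (Nat.pow_right_injective hP.out.two_le this).symm
  have hss : Subsingleton (Ov Λ (p ^ e)) := ⟨fun I J => by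
    obtain ⟨c, h1, h2⟩ := key I.1 I.2
    obtain ⟨c', h1', h2'⟩ := key J.1 J.2
    have : c = c' := by omega
    exact Subtype.ext (by rw [h1, h1', this])⟩
  refine ⟨inferInstance, ?_, ?_⟩
  · rintro ⟨I⟩
    obtain ⟨c, -, h⟩ := key I.1 I.2
    exact ⟨c, by omega⟩
  · intro k hk
    rw [Nat.card_eq_one_iff_unique]
    exact ⟨hss, ⟨S.Ip k, S.isRt_Ip k, S.le_Ip k, by rw [S.Ip_index, hk]⟩⟩

section
variable {N : ℕ} [NeZero N] (ρ : Λ →+* Matrix (Fin 2) (Fin 2) (ZMod N))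
/-- pair of columns -/
def cols : Λ →+ (ZMod N × ZMod N) × (ZMod N × ZMod N) where
  toFun y := ((ρ y 0 0, ρ y 1 0), (ρ y 0 1, ρ y 1 1))
  map_zero' := by simp
  map_add' x y := by simp

/-- overlattice attached to a subgroup -/
def IW (W : AddSubgroup (ZMod N × ZMod N)) : AddSubgroup D :=
  lm (N : D)⁻¹ (((W.prod W).comap (cols ρ)).map Λ.subtype.toAddMonoidHom)

lemma mem_IW {W : AddSubgroup (ZMod N × ZMod N)} {y : Λ} :
    (N : D)⁻¹ * y ∈ IW ρ W ↔ cols ρ y ∈ W.prod W := by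
  have hN : (N : D) ≠ 0 := by exact_mod_cast NeZero.ne N
  rw [IW, mem_lm' (inv_ne_zero hN), inv_inv, mul_inv_cancel_left₀ hN]
  constructor
  · rintro ⟨z, hz, h⟩
    rw [← Subtype.ext h]; exact hz
  · exact fun h => ⟨y, h, rfl⟩

lemma IW_elim {W : AddSubgroup (ZMod N × ZMod N)} {x : D} (hx : x ∈ IW ρ W) :
    ∃ y : Λ, x = (N : D)⁻¹ * y ∧ cols ρ y ∈ W.prod W := by
  obtain ⟨_, ⟨y, hy, rfl⟩, h⟩ := hx
  exact ⟨y, h.symm, hy⟩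

variable (hs : Function.Surjective ρ) (hk : ∀ x : Λ, ρ x = 0 ↔ ∃ y : Λ, x = N • y)
include hs hk

lemma cols_surj : Function.Surjective (cols ρ) := by
  rintro ⟨⟨a, b⟩, ⟨c, d⟩⟩
  obtain ⟨y, hy⟩ := hs !![a, c; b, d]
  exact ⟨y, by simp [cols, hy]⟩

lemma IW_ov (W : AddSubgroup (ZMod N × ZMod N)) : IsOv Λ (Nat.card W ^ 2) (IW ρ W) := by
  have hN : (N : D) ≠ 0 := by exact_mod_cast NeZero.ne N
  have hle : Λ.toAddSubgroup ≤ IW ρ W := by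
    intro x hx
    have : x = (N : D)⁻¹ * (N • ⟨x, hx⟩ : Λ) := by
      rw [AddSubmonoidClass.coe_nsmul, nsmul_eq_mul, inv_mul_cancel_left₀ hN]
    rw [this, S.mem_IW ρ]
    have h0 := (hk (N • ⟨x, hx⟩)).2 ⟨_, rfl⟩
    simp only [cols, AddMonoidHom.coe_mk, ZeroHom.coe_mk, h0]
    exact ⟨W.zero_mem, W.zero_mem⟩
  have hΛ : Λ.toAddSubgroup = lm (N : D)⁻¹ ((cols ρ).ker.map Λ.subtype.toAddMonoidHom) := by
    ext x
    rw [mem_lm' (inv_ne_zero hN), inv_inv]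
    have hker : ∀ y : Λ, y ∈ (cols ρ).ker ↔ ρ y = 0 := fun y => by
      rw [AddMonoidHom.mem_ker]
      simp only [cols, AddMonoidHom.coe_mk, ZeroHom.coe_mk, Prod.ext_iff, Prod.fst_zero, Prod.snd_zero]
      constructor
      · rintro ⟨⟨h1, h2⟩, h3, h4⟩
        ext i j; fin_cases i <;> fin_cases j <;> assumption
      · intro h; simp [h]
    constructor
    · intro hx
      refine ⟨N • ⟨x, hx⟩, (hker _).2 ((hk _).2 ⟨_, rfl⟩), ?_⟩
      exact nsmul_eq_mul _ _
    · rintro ⟨y, hy, h⟩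
      obtain ⟨z, rfl⟩ := (hk y).1 ((hker y).1 hy)
      change ((N • z : Λ) : D) = _ at h
      rw [AddSubmonoidClass.coe_nsmul, nsmul_eq_mul] at h
      rw [← mul_left_cancel₀ hN h]; exact z.2
  refine ⟨⟨S.lat.of_nsmul hle (m := N) (NeZero.pos N) fun x hx => ?_, ?_⟩, hle, ?_⟩
  · obtain ⟨y, rfl, -⟩ := S.IW_elim ρ hx
    rw [nsmul_eq_mul, mul_inv_cancel_left₀ hN]; exact y.2
  · intro x hx a ha
    obtain ⟨y, rfl, hy⟩ := S.IW_elim ρ hx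
    have : (N : D)⁻¹ * y * a = (N : D)⁻¹ * (y * ⟨a, ha⟩ : Λ) := by rw [mul_assoc]; rfl
    rw [this, S.mem_IW ρ]
    obtain ⟨h1, h2⟩ := hy
    have hcol : ∀ j, ((ρ (y * ⟨a, ha⟩) 0 j, ρ (y * ⟨a, ha⟩) 1 j) : ZMod N × ZMod N) ∈ W := by
      intro j
      have : ((ρ (y * ⟨a, ha⟩) 0 j, ρ (y * ⟨a, ha⟩) 1 j) : ZMod N × ZMod N) =
          (ρ ⟨a, ha⟩ 0 j) • (ρ y 0 0, ρ y 1 0) + (ρ ⟨a, ha⟩ 1 j) • (ρ y 0 1, ρ y 1 1) := by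
        rw [map_mul]
        ext <;> simp [Matrix.mul_apply, Fin.sum_univ_two, mul_comm]
      rw [this]
      exact W.add_mem (ZMod.smul_mem (K := W) h1 _) (ZMod.smul_mem (K := W) h2 _)
    exact ⟨hcol 0, hcol 1⟩
  · rw [hΛ, IW, lm, lm, AddSubgroup.relIndex_map_map_of_injective _ _
      (mul_right_injective₀ (inv_ne_zero hN)),
      AddSubgroup.relIndex_map_map_of_injective _ _ (Subtype.val_injective),
      AddSubgroup.relIndex_ker, AddSubgroup.map_comap_eq_self_of_surjective (S.cols_surj ρ hs hk),
      Nat.card_congr (AddSubgroup.prodEquiv W W).toEquiv, Nat.card_prod, sq]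

lemma IW_inj {W W' : AddSubgroup (ZMod N × ZMod N)} (h : IW ρ W = IW ρ W') : W = W' := by
  ext w
  obtain ⟨y, hy⟩ := S.cols_surj ρ hs hk (w, 0)
  have := S.mem_IW ρ (W := W) (y := y)
  rw [h, S.mem_IW ρ, hy] at this
  simpa [AddSubgroup.mem_prod, W.zero_mem, W'.zero_mem] using this.symm

lemma exists_IW {I : AddSubgroup D} (hI : IsOv Λ N I) : ∃ W, I = IW ρ W := by
  have hN : (N : D) ≠ 0 := by exact_mod_cast NeZero.ne N
  have hsm : ∀ x ∈ I, N • x ∈ Λ := fun x hx =>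
    hI.2.2 ▸ relIndex_nsmul (H := Λ.toAddSubgroup) hx
  let T : AddSubgroup ((ZMod N × ZMod N) × (ZMod N × ZMod N)) :=
    ((lm (N : D) I).comap Λ.subtype.toAddMonoidHom).map (cols ρ)
  have hT : ∀ y : Λ, cols ρ y ∈ T ↔ (N : D)⁻¹ * y ∈ I := by
    intro y
    constructor
    · rintro ⟨z, hz, h⟩
      have h1 : (N : D)⁻¹ * z ∈ I := (mem_lm' hN).1 hz
      have h2 : ρ (y - z) = 0 := by
        rw [map_sub, sub_eq_zero]
        simp only [cols, AddMonoidHom.coe_mk, ZeroHom.coe_mk, Prod.ext_iff] at h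
        obtain ⟨⟨h1, h2⟩, h3, h4⟩ := h
        ext i j; fin_cases i <;> fin_cases j <;> simp <;> first | exact h1.symm | exact h2.symm | exact h3.symm | exact h4.symm
      obtain ⟨u, hu⟩ := (hk _).1 h2
      have h3 : (y : D) = z + N • u := by
        rw [← AddSubmonoidClass.coe_nsmul, ← hu]; simp
      rw [h3, mul_add, nsmul_eq_mul, inv_mul_cancel_left₀ hN]
      exact I.add_mem h1 (hI.2.1 u.2)
    · intro h
      exact ⟨y, (mem_lm' hN).2 h, rfl⟩
  have hmul : ∀ (y a : Λ), cols ρ y ∈ T → cols ρ (y * a) ∈ T := by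
    intro y a h
    rw [hT] at h ⊢
    have := hI.1.2 _ h a a.2
    rwa [mul_assoc] at this
  have hc : ∀ (y a : Λ) (j : Fin 2), ((ρ (y * a) 0 j, ρ (y * a) 1 j) : ZMod N × ZMod N) =
      (ρ a 0 j) • (ρ y 0 0, ρ y 1 0) + (ρ a 1 j) • (ρ y 0 1, ρ y 1 1) := by
    intro y a j
    rw [map_mul]
    ext <;> simp [Matrix.mul_apply, Fin.sum_univ_two, mul_comm]
  have hmat : ∀ M : Matrix (Fin 2) (Fin 2) (ZMod N), ∀ w w', (w, w') ∈ T →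
      (M 0 0 • w + M 1 0 • w', M 0 1 • w + M 1 1 • w') ∈ T := by
    intro M w w' h
    obtain ⟨y, hy⟩ := S.cols_surj ρ hs hk (w, w')
    obtain ⟨a, rfl⟩ := hs M
    have h1 := hmul y a (hy ▸ h)
    change ((ρ (y * a) 0 0, ρ (y * a) 1 0), (ρ (y * a) 0 1, ρ (y * a) 1 1)) ∈ T at h1
    rw [hc, hc] at h1
    have h2 := Prod.ext_iff.1 hy
    change (ρ y 0 0, ρ y 1 0) = w ∧ (ρ y 0 1, ρ y 1 1) = w' at h2
    rwa [h2.1, h2.2] at h1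
  refine ⟨T.comap (AddMonoidHom.inl _ _), ?_⟩
  have hprod : ∀ w w', (w, w') ∈ T ↔ (w, 0) ∈ T ∧ (w', 0) ∈ T := by
    intro w w'
    constructor
    · intro h
      have h1 := hmat !![1, 0; 0, 0] w w' h
      have h2 := hmat !![0, 0; 1, 0] w w' h
      simp at h1 h2
      exact ⟨h1, h2⟩
    · rintro ⟨h1, h2⟩
      have h3 := hmat !![0, 1; 0, 0] w' 0 h2
      simp at h3
      simpa using T.add_mem h1 h3
  have hiff : ∀ y : Λ, (N : D)⁻¹ * y ∈ I ↔
      (N : D)⁻¹ * y ∈ IW ρ (T.comap (AddMonoidHom.inl _ _)) := by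
    intro y
    rw [S.mem_IW ρ, ← hT]
    exact hprod _ _
  ext x
  constructor
  · intro hx
    have := hiff ⟨_, hsm x hx⟩
    simp only [nsmul_eq_mul, inv_mul_cancel_left₀ hN] at this
    exact this.1 hx
  · intro hx
    obtain ⟨y, rfl, -⟩ := S.IW_elim ρ hx
    exact (hiff y).2 hx

end

lemma ov_l {ℓ : ℕ} [hl : Fact ℓ.Prime] (hlp : ℓ ≠ p) (e : ℕ) : Finite (Ov Λ (ℓ ^ e)) ∧
    (Nonempty (Ov Λ (ℓ ^ e)) → Even e) ∧
    ∀ k, e = 2 * k → Nat.card (Ov Λ (ℓ ^ e)) = ∑ x ∈ (ℓ ^ k).divisors, x := by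
  obtain ⟨ρ, hs, -, hk⟩ := S.exists_rho hlp e
  have : NeZero (ℓ ^ e) := ⟨pow_ne_zero _ hl.out.ne_zero⟩
  let E : {W : AddSubgroup (ZMod (ℓ ^ e) × ZMod (ℓ ^ e)) // Nat.card W ^ 2 = ℓ ^ e} ≃ Ov Λ (ℓ ^ e) :=
    Equiv.ofBijective (fun W => ⟨IW ρ W.1, by have := S.IW_ov ρ hs hk W.1; rwa [W.2] at this⟩)
      ⟨fun W W' h => Subtype.ext (S.IW_inj ρ hs hk (congrArg Subtype.val h)), fun I => by
        obtain ⟨W, hW⟩ := S.exists_IW ρ hs hk I.2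
        refine ⟨⟨W, ?_⟩, Subtype.ext hW.symm⟩
        rw [← (S.IW_ov ρ hs hk W).2.2, ← hW]; exact I.2.2.2⟩
  have hfin : Finite (AddSubgroup (ZMod (ℓ ^ e) × ZMod (ℓ ^ e))) :=
    Finite.of_injective (SetLike.coe (B := ZMod (ℓ ^ e) × ZMod (ℓ ^ e))) SetLike.coe_injective
  refine ⟨Finite.of_equiv _ E, ?_, ?_⟩
  · rintro ⟨I⟩
    obtain ⟨W, hW⟩ := E.symm I
    obtain ⟨k, -, hk'⟩ := (Nat.dvd_prime_pow hl.out).1 (Dvd.intro_left _ ((sq _).symm.trans hW) :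
      Nat.card W ∣ ℓ ^ e)
    rw [hk', ← pow_mul] at hW
    have := Nat.pow_right_injective hl.out.two_le hW
    exact ⟨k, by omega⟩
  · rintro k rfl
    rw [← Nat.card_congr E, ← card_sub (N := ℓ ^ (2 * k)) (n := ℓ ^ k) (g := ℓ ^ k)
      (by rw [← pow_add]; congr 1; omega)]
    refine Nat.card_congr (Equiv.subtypeEquivRight fun W => ?_)
    have e2 : ℓ ^ (2 * k) = (ℓ ^ k) ^ 2 := by rw [← pow_mul, mul_comm]
    refine Iff.trans (Eq.congr_right e2) ?_
    exact (Nat.pow_left_injective (n := 2) (by norm_num)).eq_iff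

/-- the counting function -/
theorem ov_main (N : ℕ) (hN : 0 < N) : Finite (Ov Λ N) ∧ (Nonempty (Ov Λ N) → IsSquare N) ∧
    ∀ n, N = n ^ 2 → Nat.card (Ov Λ N) = gp p n := by
  have hP : Fact p.Prime := ⟨S.hp⟩
  induction N using Nat.recOnPosPrimePosCoprime with
  | zero => exact absurd hN (lt_irrefl 0)
  | one =>
    obtain ⟨h1, -, h3⟩ := S.ov_p 0
    rw [pow_zero] at h1 h3
    refine ⟨h1, fun _ => ⟨1, rfl⟩, fun n hn => ?_⟩
    have : n = 1 := by nlinarith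
    rw [h3 0 rfl, this, (gp_mult p).map_one]
  | prime_pow ℓ e hl he =>
    have hl' : Fact ℓ.Prime := ⟨hl⟩
    have hn : ∀ n, ℓ ^ e = n ^ 2 → ∃ k, n = ℓ ^ k ∧ e = 2 * k := by
      intro n hn
      obtain ⟨k, -, hk'⟩ := (Nat.dvd_prime_pow hl).1 (Dvd.intro_left _ (by rw [hn, sq]) : n ∣ ℓ ^ e)
      refine ⟨k, hk', ?_⟩
      rw [hk', ← pow_mul] at hn
      have := Nat.pow_right_injective hl.two_le hn
      omega
    have hsq : Even e → IsSquare (ℓ ^ e) := fun h => h.isSquare_pow _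
    by_cases hlp : ℓ = p
    · subst hlp
      obtain ⟨h1, h2, h3⟩ := S.ov_p e
      refine ⟨h1, fun h => hsq (h2 h), fun n h => ?_⟩
      obtain ⟨k, rfl, hk⟩ := hn n h
      rw [h3 k hk, gp_pow_self]
    · obtain ⟨h1, h2, h3⟩ := S.ov_l hlp e
      refine ⟨h1, fun h => hsq (h2 h), fun n h => ?_⟩
      obtain ⟨k, rfl, hk⟩ := hn n h
      rw [h3 k hk, gp_pow_ne _ hlp]
  | coprime a b ha hb hab iha ihb =>
    obtain ⟨a1, a2, a3⟩ := iha (by omega)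
    obtain ⟨b1, b2, b3⟩ := ihb (by omega)
    have E := S.ovEquiv hab (by omega) (by omega)
    refine ⟨Finite.of_equiv _ E.symm, ?_, ?_⟩
    · rintro ⟨I⟩
      obtain ⟨x, hx⟩ := a2 ⟨(E I).1⟩
      obtain ⟨y, hy⟩ := b2 ⟨(E I).2⟩
      exact ⟨x * y, by rw [hx, hy]; ring⟩
    · intro n hn
      obtain ⟨x, rfl⟩ := exists_eq_pow_of_mul_eq_pow (Nat.isUnit_iff.2 hab) hn
      obtain ⟨y, rfl⟩ := exists_eq_pow_of_mul_eq_pow (Nat.isUnit_iff.2 hab.symm)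
        ((mul_comm _ _).trans hn)
      have hxy : x * y = n :=
        Nat.pow_left_injective (n := 2) (by norm_num) ((mul_pow x y 2).trans hn)
      rw [Nat.card_congr E, Nat.card_prod, a3 x rfl, b3 y rfl, ← hxy,
        (gp_mult p).map_mul_of_coprime]
      exact Nat.Coprime.coprime_dvd_left (dvd_pow_self x two_ne_zero)
        (Nat.Coprime.coprime_dvd_right (dvd_pow_self y two_ne_zero) hab)

end Setup
end
end Eich

namespace Eich
open Module Filter Topology MeasureTheory

lemma sum_hp (p : ℕ) [hP : Fact p.Prime] (m : ℕ) :
    2 * ((∑ d ∈ Finset.Ioc 0 m, hp p d : ℕ) : ℝ) = m * (m + 1) - p * (m / p : ℕ) * ((m / p : ℕ) + 1) := by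
  induction m with
  | zero => simp
  | succ m ih =>
    rw [Finset.sum_Ioc_succ_top (Nat.zero_le m), Nat.cast_add, mul_add, ih, Nat.succ_div]
    change _ + 2 * (((if p ∣ m + 1 then 0 else m + 1 : ℕ)) : ℝ) = _
    split_ifs with h
    · have : ((m + 1 : ℕ) : ℝ) = p * ((m / p : ℕ) + 1) := by
        have h2 : (m + 1) / p = m / p + 1 := by rw [Nat.succ_div, if_pos h]
        have := Nat.mul_div_cancel' h
        rw [h2] at this
        exact_mod_cast this.symm
      push_cast at this ⊢
      linear_combination -2 * this
    · push_cast; ring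

lemma sum_hp_le (p : ℕ) (m : ℕ) : ∑ d ∈ Finset.Ioc 0 m, hp p d ≤ m ^ 2 := by
  calc _ ≤ ∑ d ∈ Finset.Ioc 0 m, m := Finset.sum_le_sum fun d hd => by
        change (if p ∣ d then 0 else d) ≤ m
        split_ifs
        · simp
        · exact (Finset.mem_Ioc.1 hd).2
    _ = m ^ 2 := by simp [sq]

lemma tendsto_div_nat (k : ℕ) : Tendsto (fun X : ℕ => ((X / k : ℕ) : ℝ) / X) atTop (𝓝 (1 / k)) := by
  have h := (tendsto_nat_floor_mul_div_atTop (R := ℝ) (a := 1 / k) (by positivity)).comp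
    tendsto_natCast_atTop_atTop
  refine h.congr fun X => ?_
  simp only [Function.comp]
  rw [← Nat.floor_div_eq_div (K := ℝ)]
  congr 3; ring

lemma tendsto_hp (p : ℕ) [hP : Fact p.Prime] (k : ℕ) :
    Tendsto (fun X : ℕ => ((∑ d ∈ Finset.Ioc 0 (X / k), hp p d : ℕ) : ℝ) / X ^ 2) atTop
      (𝓝 ((1 - 1 / p) / 2 * (1 / (k : ℝ) ^ 2))) := by
  have h1 := tendsto_div_nat k
  have h2 := tendsto_div_nat (k * p)
  have h3 : Tendsto (fun X : ℕ => (1 : ℝ) / X) atTop (𝓝 0) := tendsto_one_div_atTop_nhds_zero_nat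
  have h4 := ((h1.mul (h1.add h3)).sub ((h2.const_mul (p : ℝ)).mul (h2.add h3))).const_mul (1 / 2 : ℝ)
  have hp0 : (p : ℝ) ≠ 0 := by exact_mod_cast hP.out.ne_zero
  convert h4.congr' ?_ using 2
  · push_cast
    rcases eq_or_ne (k : ℝ) 0 with h | h
    · simp [h]
    · field_simp; ring
  · filter_upwards [eventually_gt_atTop 0] with X hX
    have hX' : (X : ℝ) ≠ 0 := by positivity
    have := sum_hp p (X / k)
    rw [Nat.div_div_eq_div_mul] at this
    rw [eq_div_iff (by positivity)]
    field_simp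
    linear_combination -this

lemma tendsto_gp (p : ℕ) [hP : Fact p.Prime] :
    Tendsto (fun X : ℕ => ((∑ n ∈ Finset.Ioc 0 X, gp p n : ℕ) : ℝ) / X ^ 2) atTop
      (𝓝 ((1 - 1 / p) / 2 * (Real.pi ^ 2 / 6))) := by
  have hz := hasSum_zeta_two
  have h := tendsto_tsum_of_dominated_convergence (𝓕 := atTop)
    (f := fun X k : ℕ => ((∑ d ∈ Finset.Ioc 0 (X / k), hp p d : ℕ) : ℝ) / X ^ 2)
    (g := fun k : ℕ => (1 - 1 / p) / 2 * (1 / (k : ℝ) ^ 2)) hz.summable (tendsto_hp p) ?_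
  · rw [(hz.mul_left _).tsum_eq] at h
    refine h.congr fun X => ?_
    rw [tsum_eq_sum (s := Finset.Ioc 0 X), ← Finset.sum_div, gp, mul_comm,
      ArithmeticFunction.sum_Ioc_mul_eq_sum_sum]
    · push_cast
      congr 1
      refine Finset.sum_congr rfl fun k hk => ?_
      rw [ArithmeticFunction.zeta_apply_ne (by have := Finset.mem_Ioc.1 hk; omega)]
      simp
    · intro k hk
      have : X / k = 0 := by
        rw [Finset.mem_Ioc, not_and_or] at hk
        rcases hk with hk | hk
        · simp [show k = 0 by omega]
        · exact Nat.div_eq_of_lt (by omega)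
      simp [this]
  · filter_upwards [eventually_gt_atTop 0] with X hX k
    have hX' : (0 : ℝ) < X := by positivity
    rw [Real.norm_of_nonneg (by positivity)]
    have h1 : ((∑ d ∈ Finset.Ioc 0 (X / k), hp p d : ℕ) : ℝ) ≤ ((X / k : ℕ) : ℝ) ^ 2 := by
      exact_mod_cast sum_hp_le p (X / k)
    have h2 : ((X / k : ℕ) : ℝ) ≤ X / k := Nat.cast_div_le
    calc _ ≤ ((X : ℝ) / k) ^ 2 / X ^ 2 := by gcongr; exact h1.trans (by gcongr)
      _ = _ := by
        rw [div_pow]; field_simp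

/-- the quartic form -/
def FF (v : Fin 4 → ℝ) : ℝ := (∑ i, v i ^ 2) ^ 2

lemma FF_le_one (v : Fin 4 → ℝ) : FF v ≤ 1 ↔ ∑ i, v i ^ 2 ≤ 1 := by
  have : 0 ≤ ∑ i, v i ^ 2 := Finset.sum_nonneg fun i _ => sq_nonneg _
  rw [FF, sq_le_one_iff₀ this]

lemma vol_FF : volume.real {v : Fin 4 → ℝ | FF v ≤ 1} = Real.pi ^ 2 / 2 := by
  have h := MeasureTheory.volume_sum_rpow_le (ι := Fin 4) one_le_two 1
  have h2 : {v : Fin 4 → ℝ | FF v ≤ 1} = {x : Fin 4 → ℝ | (∑ i, |x i| ^ (2:ℝ)) ^ (1 / (2:ℝ)) ≤ 1} := by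
    ext v
    simp only [Set.mem_ofPred_eq, FF_le_one, Real.rpow_two, sq_abs]
    rw [← Real.sqrt_eq_rpow, Real.sqrt_le_one]
  rw [measureReal_def, h2, h, Real.Gamma_add_one (by norm_num), Real.Gamma_one_half_eq]
  have h3 : Real.Gamma (((Fintype.card (Fin 4) : ℕ) : ℝ) / 2 + 1) = 2 := by
    rw [show ((Fintype.card (Fin 4) : ℕ) : ℝ) / 2 = ((2:ℕ):ℝ) by norm_num, Real.Gamma_nat_eq_factorial]
    norm_num
  rw [h3]
  simp only [ENNReal.ofReal_one, one_pow, one_mul, Fintype.card_fin]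
  rw [ENNReal.toReal_ofReal (by positivity)]
  have : Real.sqrt Real.pi ^ 2 = Real.pi := Real.sq_sqrt Real.pi_pos.le
  linear_combination (Real.sqrt Real.pi ^ 2 / 2 + Real.pi / 2) * this

lemma convex_FF : Convex ℝ {v : Fin 4 → ℝ | FF v ≤ 1} := by
  simp only [FF_le_one]
  have : ConvexOn ℝ Set.univ fun v : Fin 4 → ℝ => ∑ i, v i ^ 2 := by
    refine ⟨convex_univ, fun x _ y _ a b ha hb hab => ?_⟩
    simp only [smul_eq_mul, Finset.mul_sum, ← Finset.sum_add_distrib]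
    refine Finset.sum_le_sum fun i _ => ?_
    simp only [Pi.add_apply, Pi.smul_apply, smul_eq_mul]
    obtain rfl : b = 1 - a := by linarith
    nlinarith [mul_nonneg (mul_nonneg ha hb) (sq_nonneg (x i - y i))]
  simpa using this.convex_le 1

lemma bdd_FF (c : ℝ) : Bornology.IsBounded {v : Fin 4 → ℝ | FF v ≤ c} := by
  refine (Metric.isBounded_closedBall (x := (0 : Fin 4 → ℝ)) (r := |c| + 1)).subset fun v hv => ?_
  rw [mem_closedBall_zero_iff, pi_norm_le_iff_of_nonneg (by positivity)]
  intro i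
  have h1 : v i ^ 2 ≤ ∑ i, v i ^ 2 :=
    Finset.single_le_sum (f := fun i => v i ^ 2) (fun i _ => sq_nonneg _) (Finset.mem_univ i)
  have h2 : (∑ i, v i ^ 2) ^ 2 ≤ c := hv
  rw [Real.norm_eq_abs]
  have h3 := le_abs_self c
  by_contra! h
  have h4 : 1 ≤ |v i| := by have := abs_nonneg c; linarith
  have h5 := sq_abs (v i)
  have h6 : |v i| ≤ |v i| ^ 2 := by nlinarith
  have h7 : |v i| ≤ ∑ i, v i ^ 2 := by linarith
  have h8 : |v i| ≤ (∑ i, v i ^ 2) ^ 2 := by nlinarith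
  linarith

lemma closed_FF (c : ℝ) : IsClosed {v : Fin 4 → ℝ | FF v ≤ c} := by
  refine isClosed_le ?_ continuous_const
  unfold FF; fun_prop

section
set_option linter.unusedSectionVars false
variable {D : Type*} [DivisionRing D] [CharZero D]

namespace QD
variable (Q : QD D)

lemma FF_emb (x : D) : FF (Q.emb x) = (Q.nrd x : ℝ) ^ 2 := by rw [FF, Q.emb_sq]

lemma finite_le {I : AddSubgroup D} (h : IsLat I) (c : ℝ) :
    {y | y ∈ I ∧ (Q.nrd y : ℝ) ^ 2 ≤ c}.Finite := by
  have := Q.eL_discrete h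
  have h1 : ({v : Fin 4 → ℝ | FF v ≤ c} ∩ ((Q.eL I).toAddSubgroup : Set (Fin 4 → ℝ))).Finite := by
    have : DiscreteTopology (Q.eL I).toAddSubgroup := this
    exact Metric.finite_isBounded_inter_isClosed (DiscreteTopology.isDiscrete) (bdd_FF c)
      AddSubgroup.isClosed_of_discrete
  refine Set.Finite.of_finite_image (f := Q.emb) (h1.subset ?_) Q.emb_inj.injOn
  rintro _ ⟨y, ⟨hy, hc⟩, rfl⟩
  exact ⟨by simpa [Q.FF_emb] using hc, y, hy, rfl⟩

lemma tendsto_count {I : AddSubgroup D} (h : IsLat I) :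
    Tendsto (fun c : ℝ => (Nat.card {y | y ∈ I ∧ (Q.nrd y : ℝ) ^ 2 ≤ c} : ℝ) / c) atTop
      (𝓝 (Real.pi ^ 2 / 2 / Q.cov I)) := by
  have := Q.eL_discrete h
  have := Q.eL_zlat h
  have h1 := ZLattice.covolume.tendsto_card_le_div (Q.eL I) (X := Set.univ) (by simp) (F := FF)
    (fun x r hr => by simp only [FF, Pi.smul_apply, smul_eq_mul, mul_pow, ← Finset.mul_sum, Fintype.card_fin]; ring) (by simpa using bdd_FF 1)
    (by simpa using (closed_FF 1).measurableSet)
    (by simpa using convex_FF.addHaar_frontier volume)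
  simp only [Set.mem_univ, true_and] at h1
  rw [vol_FF] at h1
  refine h1.congr fun c => ?_
  congr 2
  refine (Nat.card_congr (Equiv.ofBijective (fun y => ⟨Q.emb y.1, by simpa [Q.FF_emb] using y.2.2, y.1, y.2.1, rfl⟩) ⟨?_, ?_⟩)).symm
  · intro x y hxy
    exact Subtype.ext (Q.emb_inj (Subtype.ext_iff.1 hxy))
  · rintro ⟨_, hv, y, hy, rfl⟩
    exact ⟨⟨y, hy, by simpa [Q.FF_emb] using hv⟩, rfl⟩

end QD
end
end Eich

namespace Eich
open Module Filter Topology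

section
set_option linter.unusedSectionVars false
variable {D : Type*} [DivisionRing D] [CharZero D]

lemma ncard_bU {α ι : Type*} (s : Finset ι) {f : ι → Set α} (hf : ∀ i ∈ s, (f i).Finite)
    (h : (s : Set ι).PairwiseDisjoint f) : (⋃ i ∈ s, f i).ncard = ∑ i ∈ s, (f i).ncard := by
  have := s.finite_toSet.ncard_biUnion hf h
  rwa [finsum_mem_coe_finset] at this

/-- unit group of the left order -/
def Gam (I : AddSubgroup D) : Subgroup Dˣ where
  carrier := {u | lm (u : D) I = I}
  one_mem' := by simp [lm_one]
  mul_mem' {u v} hu hv := by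
    change lm ((u * v : Dˣ) : D) I = I
    rw [Units.val_mul, lm_mul, show lm (v : D) I = I from hv, show lm (u : D) I = I from hu]
  inv_mem' {u} hu := by
    change lm ((u⁻¹ : Dˣ) : D) I = I
    have hu : lm (u : D) I = I := hu
    conv_lhs => rw [← hu, ← lm_mul]
    simp [lm_one]

lemma mem_Gam {I : AddSubgroup D} {u : Dˣ} : u ∈ Gam I ↔ lm (u : D) I = I := Iff.rfl

/-- equivalence of lattices -/
def Eqv (I J : AddSubgroup D) : Prop := ∃ y : D, y ≠ 0 ∧ lm y J = I

lemma Eqv.symm {I J : AddSubgroup D} (h : Eqv I J) : Eqv J I := by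
  obtain ⟨y, hy, rfl⟩ := h
  exact ⟨y⁻¹, inv_ne_zero hy, by rw [← lm_mul, inv_mul_cancel₀ hy, lm_one]⟩

lemma Eqv.trans {I J K : AddSubgroup D} (h : Eqv I J) (h' : Eqv J K) : Eqv I K := by
  obtain ⟨y, hy, rfl⟩ := h
  obtain ⟨z, hz, rfl⟩ := h'
  exact ⟨y * z, mul_ne_zero hy hz, lm_mul _ _ _⟩

/-- overlattices of index at most `X ^ 2` -/
def Om (Λ : Subring D) (X : ℕ) : Set (AddSubgroup D) :=
  {J | ∃ n ∈ Finset.Ioc 0 X, IsOv Λ (n ^ 2) J}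

/-- overlattices in a given class -/
def TT (Λ : Subring D) (I : AddSubgroup D) (X : ℕ) : Set (AddSubgroup D) :=
  {J | J ∈ Om Λ X ∧ Eqv I J}

namespace QD
variable (Q : QD D)

lemma nrd_Gam {I : AddSubgroup D} (hI : IsLat I) {u : Dˣ} (hu : u ∈ Gam I) : Q.nrd u = 1 := by
  have h := Q.cov_lm hI u.ne_zero
  rw [mem_Gam.1 hu] at h
  have h2 : (Q.nrd u : ℝ) ^ 2 = 1 := by
    have := (Q.cov_pos hI).ne'
    field_simp at h
    linarith
  have h3 : (0 : ℝ) ≤ Q.nrd u := by exact_mod_cast Q.nrd_nonneg u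
  have : (Q.nrd u : ℝ) = 1 := (pow_eq_one_iff_of_nonneg h3 two_ne_zero).1 h2
  exact_mod_cast this

lemma exists_ne {I : AddSubgroup D} (hI : IsLat I) : ∃ y ∈ I, y ≠ 0 := by
  obtain ⟨m, hm, h⟩ := hI.2 1
  exact ⟨_, h, by simpa using hm.ne'⟩

lemma finite_Gam (Q : QD D) {I : AddSubgroup D} (hI : IsLat I) : Finite (Gam I) := by
  obtain ⟨y, hy, hy0⟩ := exists_ne hI
  have := (Q.finite_le hI ((Q.nrd y : ℝ) ^ 2)).to_subtype
  refine Finite.of_injective (β := {z | z ∈ I ∧ (Q.nrd z : ℝ) ^ 2 ≤ (Q.nrd y : ℝ) ^ 2})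
    (fun u => ⟨(u : Dˣ) * y, ?_, ?_⟩) fun u v huv => ?_
  · have h := mem_Gam.1 u.2
    exact h.le (mem_lm.2 ⟨y, hy, rfl⟩)
  · rw [Q.nrd_mul, Q.nrd_Gam hI u.2, one_mul]
  · exact Subtype.ext (Units.ext (mul_right_cancel₀ hy0 (Subtype.ext_iff.1 huv)))

end QD

namespace Setup
variable {p : ℕ} {Q : QD D} {Λ : Subring D} (S : Setup p Q Λ)
include S

lemma Om_finite (X : ℕ) : (Om Λ X).Finite := by
  have : Om Λ X = ⋃ n ∈ Finset.Ioc 0 X, {J | IsOv Λ (n ^ 2) J} := by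
    ext J; simp [Om]
  rw [this]
  refine Set.Finite.biUnion (Finset.finite_toSet _) fun n hn => ?_
  have hn := Finset.mem_Ioc.1 hn
  exact Set.finite_coe_iff.1 (S.ov_main (n ^ 2) (pow_pos hn.1 2)).1

lemma Om_card (X : ℕ) : (Om Λ X).ncard = ∑ n ∈ Finset.Ioc 0 X, gp p n := by
  classical
  have hf : ∀ n ∈ Finset.Ioc 0 X, {J | IsOv Λ (n ^ 2) J}.Finite := fun n hn =>
    Set.finite_coe_iff.1 (S.ov_main (n ^ 2) (pow_pos (Finset.mem_Ioc.1 hn).1 2)).1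
  have h1 : ∀ n ∈ Finset.Ioc 0 X, gp p n = {J | IsOv Λ (n ^ 2) J}.ncard := fun n hn =>
    ((S.ov_main (n ^ 2) (pow_pos (Finset.mem_Ioc.1 hn).1 2)).2.2 n rfl).symm
  rw [Finset.sum_congr rfl h1]
  have h2 : Om Λ X = ⋃ n ∈ (Finset.Ioc 0 X : Finset ℕ), {J | IsOv Λ (n ^ 2) J} := by
    ext J; simp [Om]
  rw [h2]
  refine ncard_bU _ hf ?_
  intro i _ j _ hij
  rw [Function.onFun, Set.disjoint_left]
  rintro K ⟨-, -, h1⟩ ⟨-, -, h2⟩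
  exact hij ((Nat.pow_left_injective two_ne_zero) (h1.symm.trans h2))

lemma ov_iff {I : AddSubgroup D} (hI : IsRt Λ I) {y : D} (hy : y ≠ 0) (X : ℕ) :
    lm y⁻¹ I ∈ Om Λ X ↔ y ∈ I ∧ (Q.nrd y : ℝ) ^ 2 ≤ (X : ℝ) ^ 2 * (Q.cov I / Q.cov Λ.toAddSubgroup) := by
  have hy' := inv_ne_zero hy
  have hJ := hI.lm hy'
  have hcI := Q.cov_pos hI.1
  have hcL := Q.cov_pos S.lat
  have hmem : y ∈ I ↔ Λ.toAddSubgroup ≤ lm y⁻¹ I := by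
    constructor
    · intro h a ha
      rw [mem_lm' hy', inv_inv]
      exact hI.2 y h a ha
    · intro h
      have := h Λ.one_mem
      rwa [mem_lm' hy', inv_inv, mul_one] at this
  have hidx : Λ.toAddSubgroup ≤ lm y⁻¹ I → (Λ.toAddSubgroup.relIndex (lm y⁻¹ I) : ℝ) =
      (Q.nrd y : ℝ) ^ 2 * (Q.cov Λ.toAddSubgroup / Q.cov I) := by
    intro h
    have h1 := Q.cov_relIndex hJ.1 S.lat h
    rw [Q.cov_lm hI.1 hy', Q.nrd_inv] at h1
    have h3 : (Q.nrd y : ℝ) ≠ 0 := by exact_mod_cast fun h => hy (Q.nrd_eq_zero.1 h)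
    push_cast at h1
    rw [h1]; field_simp
  constructor
  · rintro ⟨n, hn, h1, h2, h3⟩
    refine ⟨hmem.2 h2, ?_⟩
    have h4 := hidx h2
    rw [h3] at h4
    have h5 : ((n ^ 2 : ℕ) : ℝ) ≤ (X : ℝ) ^ 2 := by
      exact_mod_cast Nat.pow_le_pow_left (Finset.mem_Ioc.1 hn).2 2
    rw [h4] at h5
    calc (Q.nrd y : ℝ) ^ 2 = (Q.nrd y : ℝ) ^ 2 * (Q.cov Λ.toAddSubgroup / Q.cov I) *
          (Q.cov I / Q.cov Λ.toAddSubgroup) := by field_simp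
      _ ≤ _ := by gcongr
  · rintro ⟨h1, h2⟩
    have h3 := hmem.1 h1
    have h4 := hidx h3
    have h6 := Q.relIndex_pos hJ.1 S.lat h3
    obtain ⟨n, hn⟩ := (S.ov_main _ h6).2.1 ⟨⟨_, hJ, h3, rfl⟩⟩
    rw [← sq] at hn
    refine ⟨n, Finset.mem_Ioc.2 ⟨?_, ?_⟩, hJ, h3, hn⟩
    · rcases Nat.eq_zero_or_pos n with h | h
      · rw [hn, h] at h6; simp at h6
      · exact h
    · rw [hn] at h4
      have h5 : (n : ℝ) ^ 2 ≤ (X : ℝ) ^ 2 := by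
        push_cast at h4
        rw [h4]
        calc _ ≤ (X : ℝ) ^ 2 * (Q.cov I / Q.cov Λ.toAddSubgroup) * (Q.cov Λ.toAddSubgroup / Q.cov I) := by
              gcongr
          _ = _ := by field_simp
      have h6 : n ^ 2 ≤ X ^ 2 := by exact_mod_cast h5
      exact (Nat.pow_le_pow_iff_left two_ne_zero).1 h6

lemma count_eq {I : AddSubgroup D} (hI : IsRt Λ I) (X : ℕ) :
    Nat.card {y | y ∈ I ∧ (Q.nrd y : ℝ) ^ 2 ≤ (X : ℝ) ^ 2 * (Q.cov I / Q.cov Λ.toAddSubgroup)} =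
      Nat.card (Gam I) * (TT Λ I X).ncard + 1 := by
  set T := {y | y ∈ I ∧ (Q.nrd y : ℝ) ^ 2 ≤ (X : ℝ) ^ 2 * (Q.cov I / Q.cov Λ.toAddSubgroup)} with hT
  have hTf : T.Finite := Q.finite_le hI.1 _
  have h0 : (0 : D) ∈ T := ⟨I.zero_mem, by
    have := Q.cov_pos hI.1; have := Q.cov_pos S.lat
    rw [Q.nrd_zero]; simp; positivity⟩
  change T.ncard = _
  rw [← Set.ncard_sdiff_singleton_add_one h0 hTf]
  congr 1
  have hch : ∀ J : TT Λ I X, ∃ y : D, y ≠ 0 ∧ lm y J.1 = I := fun J => J.2.2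
  choose f hf0 hf using hch
  have hinv : ∀ {y : D} {J : AddSubgroup D}, y ≠ 0 → lm y J = I → J = lm y⁻¹ I := by
    rintro y J hy rfl
    rw [← lm_mul, inv_mul_cancel₀ hy, lm_one]
  have hmul : ∀ (u : Gam I) (J : TT Λ I X), lm ((u : Dˣ) * f J) J.1 = I := fun u J => by
    rw [lm_mul, hf, mem_Gam.1 u.2]
  rw [← Nat.card_coe_set_eq, ← Nat.card_coe_set_eq, ← Nat.card_prod]
  symm
  refine Nat.card_congr (Equiv.ofBijective (fun x : Gam I × TT Λ I X =>
    ⟨((x.1 : Dˣ) : D) * f x.2, ?_, ?_⟩) ⟨?_, ?_⟩)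
  · have h1 := mul_ne_zero (x.1 : Dˣ).ne_zero (hf0 x.2)
    refine (S.ov_iff hI h1 X).1 ?_
    rw [← hinv h1 (hmul _ _)]
    exact x.2.2.1
  · exact mul_ne_zero (x.1 : Dˣ).ne_zero (hf0 x.2)
  · rintro ⟨u, J⟩ ⟨v, K⟩ h
    have h : ((u : Dˣ) : D) * f J = ((v : Dˣ) : D) * f K := Subtype.ext_iff.1 h
    have h1 := hinv (mul_ne_zero (u : Dˣ).ne_zero (hf0 J)) (hmul u J)
    have h2 := hinv (mul_ne_zero (v : Dˣ).ne_zero (hf0 K)) (hmul v K)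
    rw [h, ← h2] at h1
    obtain rfl : J = K := Subtype.ext h1
    obtain rfl : u = v := Subtype.ext (Units.ext (mul_right_cancel₀ (hf0 J) h))
    rfl
  · rintro ⟨y, hy, hy0⟩
    have hy0 : y ≠ 0 := hy0
    have h1 := (S.ov_iff hI hy0 X).2 hy
    let J : TT Λ I X := ⟨lm y⁻¹ I, h1, y, hy0, by rw [← lm_mul, mul_inv_cancel₀ hy0, lm_one]⟩
    have h2 : y * (f J)⁻¹ ≠ 0 := mul_ne_zero hy0 (inv_ne_zero (hf0 J))
    refine ⟨⟨⟨Units.mk0 _ h2, ?_⟩, J⟩, Subtype.ext ?_⟩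
    · rw [mem_Gam, Units.val_mk0, lm_mul, ← hinv (hf0 J) (hf J), ← lm_mul, mul_inv_cancel₀ hy0, lm_one]
    · simp [mul_assoc, inv_mul_cancel₀ (hf0 J)]

lemma tendsto_TT {I : AddSubgroup D} (hI : IsRt Λ I) :
    Tendsto (fun X : ℕ => ((TT Λ I X).ncard : ℝ) / X ^ 2) atTop
      (𝓝 (2 * Real.pi ^ 2 / p * (1 / Nat.card (Gam I)))) := by
  have hP : Fact p.Prime := ⟨S.hp⟩
  have hcI := Q.cov_pos hI.1
  have hcL := Q.cov_pos S.lat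
  have hc : 0 < Q.cov I / Q.cov Λ.toAddSubgroup := by positivity
  have hfin := Q.finite_Gam hI.1
  have hg : (Nat.card (Gam I) : ℝ) ≠ 0 := by exact_mod_cast Nat.card_pos.ne'
  have hX : Tendsto (fun X : ℕ => (X : ℝ) ^ 2) atTop atTop :=
    (tendsto_pow_atTop two_ne_zero).comp tendsto_natCast_atTop_atTop
  have h1 := (Q.tendsto_count hI.1).comp (hX.atTop_mul_const hc)
  have h2 : Tendsto (fun X : ℕ => (1 : ℝ) / X ^ 2) atTop (𝓝 0) := by
    simp only [one_div]; exact hX.inv_tendsto_atTop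
  have h3 := ((h1.mul_const (Q.cov I / Q.cov Λ.toAddSubgroup)).sub h2).mul_const (1 / (Nat.card (Gam I) : ℝ))
  convert h3.congr' ?_ using 2
  · rw [S.cov_Λ]
    field_simp; ring
  · filter_upwards [eventually_gt_atTop 0] with X hX0
    have : (X : ℝ) ≠ 0 := by positivity
    simp only [Function.comp]
    rw [S.count_eq hI]
    push_cast
    field_simp
    ring

lemma TT_disj {I J : AddSubgroup D} (h : ¬ Eqv I J) (X : ℕ) : Disjoint (TT Λ I X) (TT Λ J X) := by
  rw [Set.disjoint_left]
  rintro K ⟨-, h1⟩ ⟨-, h2⟩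
  exact h (h1.trans h2.symm)

lemma sum_TT {ι : Type*} (s : Finset ι) (I : ι → AddSubgroup D)
    (hne : ∀ i j, i ≠ j → ¬ Eqv (I i) (I j)) (X : ℕ) :
    (⋃ i ∈ s, TT Λ (I i) X).ncard = ∑ i ∈ s, (TT Λ (I i) X).ncard := by
  refine ncard_bU _ (fun i _ => (S.Om_finite X).subset fun _ h => h.1) ?_
  intro i _ j _ hij
  exact S.TT_disj (hne i j hij) X

theorem mass_le {ι : Type*} (s : Finset ι) (I : ι → AddSubgroup D) (hI : ∀ i, IsRt Λ (I i))
    (hne : ∀ i j, i ≠ j → ¬ Eqv (I i) (I j)) :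
    ∑ i ∈ s, (1 : ℝ) / Nat.card (Gam (I i)) ≤ (p - 1) / 24 := by
  have hP : Fact p.Prime := ⟨S.hp⟩
  have hp0 : (0 : ℝ) < p := by exact_mod_cast S.hp.pos
  have h1 := tendsto_finsetSum s fun i _ => S.tendsto_TT (hI i)
  have h2 := le_of_tendsto_of_tendsto' h1 (tendsto_gp p) fun X => by
    rw [← Finset.sum_div]
    gcongr
    rw [← S.Om_card, ← Nat.cast_sum, ← S.sum_TT s I hne X]
    exact_mod_cast Set.ncard_le_ncard (Set.iUnion₂_subset fun i _ J (h : J ∈ TT Λ (I i) X) => h.1) (S.Om_finite X)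
  rw [← Finset.mul_sum] at h2
  have := Real.pi_pos
  have h3 : 2 * Real.pi ^ 2 / p * ∑ i ∈ s, (1 : ℝ) / Nat.card (Gam (I i)) ≤
      2 * Real.pi ^ 2 / p * ((p - 1) / 24) := h2.trans_eq (by field_simp; ring)
  exact le_of_mul_le_mul_left h3 (by positivity)

theorem mass_eq {ι : Type*} (s : Finset ι) (I : ι → AddSubgroup D) (hI : ∀ i, IsRt Λ (I i))
    (hne : ∀ i j, i ≠ j → ¬ Eqv (I i) (I j)) (hex : ∀ J, IsRt Λ J → ∃ i ∈ s, Eqv (I i) J) :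
    ∑ i ∈ s, (1 : ℝ) / Nat.card (Gam (I i)) = (p - 1) / 24 := by
  have hP : Fact p.Prime := ⟨S.hp⟩
  have hp0 : (0 : ℝ) < p := by exact_mod_cast S.hp.pos
  have h1 := tendsto_finsetSum s fun i _ => S.tendsto_TT (hI i)
  have h2 := tendsto_nhds_unique (h1.congr fun X => by
    rw [← Finset.sum_div, ← Nat.cast_sum, ← S.sum_TT s I hne X]
    have : ⋃ i ∈ s, TT Λ (I i) X = Om Λ X := by
      refine Set.Subset.antisymm (Set.iUnion₂_subset fun i _ J (h : J ∈ TT Λ (I i) X) => h.1) fun J hJ => ?_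
      obtain ⟨n, hn, h⟩ := hJ
      obtain ⟨i, hi, hiJ⟩ := hex J h.1
      exact Set.mem_iUnion₂.2 ⟨i, hi, ⟨n, hn, h⟩, hiJ⟩
    rw [this, S.Om_card]) (tendsto_gp p)
  rw [← Finset.mul_sum] at h2
  have := Real.pi_pos
  have h3 : 2 * Real.pi ^ 2 / p * ∑ i ∈ s, (1 : ℝ) / Nat.card (Gam (I i)) =
      2 * Real.pi ^ 2 / p * ((p - 1) / 24) := h2.trans (by field_simp; ring)
  exact mul_left_cancel₀ (by positivity) h3

end Setup
end
end Eich

namespace Eich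
open Module

lemma right_ideal_eig {ℓ : ℕ} [hl : Fact ℓ.Prime]
    (R : AddSubgroup (Matrix (Fin 2) (Fin 2) (ZMod ℓ))) (hR : ∀ M ∈ R, ∀ N, M * N ∈ R)
    (b : Matrix (Fin 2) (Fin 2) (ZMod ℓ)) (hb : ∀ M ∈ R, b * M ∈ R) (ht : R ≠ ⊤) :
    ∃ c : ZMod ℓ, ∀ M ∈ R, b * M = c • M := by
  let g : (Fin 2 → ZMod ℓ) →+ Matrix (Fin 2) (Fin 2) (ZMod ℓ) :=
    { toFun := fun w => Matrix.of fun i j => if j = 0 then w i else 0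
      map_zero' := by ext i j; simp
      map_add' := fun x y => by ext i j; by_cases h : j = 0 <;> simp [h] }
  let W : Submodule (ZMod ℓ) (Fin 2 → ZMod ℓ) := AddSubgroup.toZModSubmodule ℓ (R.comap g)
  have hW : ∀ w, w ∈ W ↔ g w ∈ R := fun w => Iff.rfl
  have hcol : ∀ M ∈ R, ∀ j, (fun i => M i j) ∈ W := by
    intro M hM j
    rw [hW]
    convert hR M hM (Matrix.single j 0 1) using 1
    ext i k
    change (if k = 0 then M i j else 0) = _
    rw [Matrix.mul_apply]
    by_cases hk : k = 0
    · simp [hk, Matrix.single_apply]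
    · simp [hk, Ne.symm hk]
  have hWt : W ≠ ⊤ := by
    rintro h
    refine ht ((AddSubgroup.eq_top_iff' _).2 fun M => ?_)
    have h1 : ∀ w, g w ∈ R := fun w => (hW w).1 (h ▸ Submodule.mem_top)
    have h2 : M = g (fun i => M i 0) * Matrix.single 0 0 1 + g (fun i => M i 1) * Matrix.single 0 1 1 := by
      ext i j
      fin_cases j <;> simp [g, Matrix.mul_apply, Matrix.single_apply]
    rw [h2]
    exact R.add_mem (hR _ (h1 _) _) (hR _ (h1 _) _)
  have hfr : finrank (ZMod ℓ) W ≤ 1 := by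
    have := Submodule.finrank_lt hWt
    simp at this; omega
  obtain ⟨v, hv⟩ := finrank_le_one_iff.1 hfr
  have hbv : b.mulVec v.1 ∈ W := by
    rw [hW]
    have := hb _ ((hW _).1 v.2)
    convert this using 1
    ext i j
    change (if j = 0 then _ else 0) = _
    by_cases hj : j = 0 <;> simp [hj, g, Matrix.mul_apply, Matrix.mulVec, dotProduct]
  obtain ⟨c, hc⟩ := hv ⟨_, hbv⟩
  refine ⟨c, fun M hM => ?_⟩
  ext i j
  obtain ⟨d, hd⟩ := hv ⟨_, hcol M hM j⟩
  have hc' : c • v.1 = b.mulVec v.1 := Subtype.ext_iff.1 hc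
  have hd' : d • v.1 = fun i => M i j := Subtype.ext_iff.1 hd
  have h1 : (b * M) i j = b.mulVec (fun i => M i j) i := by
    simp [Matrix.mul_apply, Matrix.mulVec, dotProduct]
  have h2 : M i j = d * v.1 i := (congrFun hd' i).symm
  rw [h1, ← hd', Matrix.mulVec_smul, ← hc', Matrix.smul_apply, h2]
  simp; ring

section
set_option linter.unusedSectionVars false
variable {D : Type*} [DivisionRing D] [CharZero D]

namespace QD
variable (Q : QD D)

lemma nrd_lin (a b : ℚ) (x : D) : Q.nrd (a • (1 : D) + b • x) = a ^ 2 + a * b * Q.trd x + b ^ 2 * Q.nrd x := by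
  rw [Q.nrd_add, Q.nrd_smul, Q.nrd_smul, Q.nrd_one, B, conj_smul]
  simp only [smul_mul_smul_comm, one_mul, map_smul, smul_eq_mul, Q.trd_conj]
  ring

lemma cent (Q : QD D) {α c : D} (hα : ∀ q : ℚ, α ≠ q • (1 : D)) (hc : c * α = α * c) :
    ∃ a b : ℚ, c = a • (1 : D) + b • α := by
  set α0 := α - (Q.trd α / 2) • (1 : D) with hα0
  set c1 := c - (Q.trd c / 2) • (1 : D) with hc1
  have h0 : α0 ≠ 0 := fun h => hα _ (sub_eq_zero.1 h)
  have hca : Q.conj α0 = -α0 := by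
    rw [conj, hα0, map_sub, Q.trd_smul_one]; module
  have hcc : Q.conj c1 = -c1 := by
    rw [conj, hc1, map_sub, Q.trd_smul_one]; module
  have hcom : c1 * α0 = α0 * c1 := by
    simp only [hα0, hc1, sub_mul, mul_sub, smul_mul_assoc, mul_smul_comm, one_mul, mul_one, hc]
    module
  have h1 : Q.conj (c1 * α0) = c1 * α0 := by
    rw [Q.conj_mul, hca, hcc, neg_mul_neg, hcom]
  have h2 : c1 * α0 = (Q.trd (c1 * α0) / 2) • (1 : D) := by
    rw [conj] at h1
    have : (2 : ℚ) • (c1 * α0) = Q.trd (c1 * α0) • (1 : D) := by rw [two_smul]; exact (sub_eq_iff_eq_add.1 h1).symm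
    calc c1 * α0 = (1 / 2 : ℚ) • ((2 : ℚ) • (c1 * α0)) := by module
      _ = _ := by rw [this]; module
  have h3 : α0 * α0 = -(Q.nrd α0) • (1 : D) := by
    have := Q.mul_conj α0
    rw [hca, mul_neg] at this
    rw [neg_smul, ← this, neg_neg]
  have hn := (Q.pos α0 h0).ne'
  have h4 : c1 = (-(Q.trd (c1 * α0) / 2) / Q.nrd α0) • α0 := by
    have h5 : c1 * (α0 * α0) = (Q.trd (c1 * α0) / 2) • α0 := by
      rw [← mul_assoc]; nth_rewrite 1 [h2]; rw [smul_mul_assoc, one_mul]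
    rw [h3, mul_smul_comm, mul_one] at h5
    calc c1 = (-(1 / Q.nrd α0)) • (-(Q.nrd α0) • c1) := by
          rw [smul_smul]; field_simp; simp
      _ = _ := by rw [h5, smul_smul]; congr 1; field_simp
  have h6 : c = c1 + (Q.trd c / 2) • (1 : D) := by rw [hc1]; abel
  generalize (-(Q.trd (c1 * α0) / 2) / Q.nrd α0) = k at h4
  refine ⟨Q.trd c / 2 - k * (Q.trd α / 2), k, ?_⟩
  rw [hα0, hc1] at h4
  rw [← sub_eq_zero] at h4 ⊢
  rw [← h4]
  module

lemma conjugate {α β : D} (hα : ∀ q : ℚ, α ≠ q • (1 : D)) (ht : Q.trd α = Q.trd β)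
    (hn : Q.nrd α = Q.nrd β) : ∃ y : D, y ≠ 0 ∧ y * β = α * y := by
  by_contra! h
  have key : ∀ x : D, α * x - x * Q.conj β = 0 := by
    intro x
    by_contra hx
    refine h _ hx ?_
    have h1 := Q.rel α
    have h2 := Q.conj_mul_self β
    have h3 : x * Q.conj β = Q.trd α • x - x * β := by
      rw [conj, mul_sub, mul_smul_comm, mul_one, ht]
    rw [sub_mul, mul_sub, mul_assoc x, h2, ← mul_assoc α α, h1, h3, ← hn]
    simp only [sub_mul, mul_sub, smul_mul_assoc, mul_smul_comm, one_mul, mul_one, mul_assoc]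
    abel
  have h1 := key 1
  rw [mul_one, one_mul, sub_eq_zero] at h1
  obtain ⟨q, hq⟩ := Q.central α fun y => by
    have := key y
    rw [← h1, sub_eq_zero] at this
    exact this
  exact hα q (by rw [hq, Algebra.algebraMap_eq_smul_one])

end QD

namespace Setup
variable {p : ℕ} {Q : QD D} {Λ : Subring D} (S : Setup p Q Λ)
include S

lemma loc_eq {ℓ : ℕ} [hl : Fact ℓ.Prime] (hlp : ℓ ≠ p) {I J : AddSubgroup D} (hI : IsRt Λ I)
    (hJ : IsRt Λ J) (hIJ : I ≤ J) {α : D} (hαI : ∀ x ∈ I, α * x ∈ I) (hαJ : ∀ x ∈ J, α * x ∈ J)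
    (hc : ∀ a b : ℚ, (∀ x ∈ I, (a • (1 : D) + b • α) * x ∈ J) → ∃ z : ℤ, b = z) :
    J ≤ Loc ℓ I := by
  obtain ⟨u, hu, hu0, m, hm, hmJ⟩ := S.loc_principal (ℓ := ℓ) hJ
  have hrho := S.exists_rho hlp 1
  rw [pow_one] at hrho
  obtain ⟨ρ, hs, -, hk⟩ := hrho
  have huJ : ∀ y ∈ Λ, u * y ∈ J := hJ.2 u hu
  have ha0 : u⁻¹ * (m • (α * u)) ∈ Λ := (mem_lm' hu0).1 (hmJ _ (hαJ u hu))
  set a0 : Λ := ⟨u⁻¹ * (m • (α * u)), ha0⟩ with ha0'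
  have hua : u * (a0 : D) = m • (α * u) := by simp [ha0', mul_inv_cancel_left₀ hu0]
  let T : AddSubgroup Λ := I.comap ((AddMonoidHom.mulLeft u).comp Λ.subtype.toAddMonoidHom)
  have hT : ∀ y : Λ, y ∈ T ↔ u * (y : D) ∈ I := fun y => Iff.rfl
  let R := T.map ρ.toAddMonoidHom
  have hR : ∀ M, M ∈ R ↔ ∃ y ∈ T, ρ y = M := fun M => Iff.rfl
  by_cases htop : R = ⊤
  · have h1 : ∀ y : Λ, ∃ y' ∈ T, ∃ z : Λ, y = y' + ℓ • z := by
      intro y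
      obtain ⟨y', hy', h⟩ := (hR (ρ y)).1 (htop ▸ AddSubgroup.mem_top _)
      obtain ⟨z, hz⟩ := (hk (y - y')).1 (by rw [map_sub, h, sub_self])
      exact ⟨y', hy', z, by rw [← hz]; abel⟩
    have h2 : ∀ k : ℕ, ∀ y : Λ, ∃ y' ∈ T, ∃ z : Λ, y = y' + ℓ ^ k • z := by
      intro k
      induction k with
      | zero => exact fun y => ⟨0, T.zero_mem, y, by simp⟩
      | succ k ih =>
        intro y
        obtain ⟨y', hy', z, hz⟩ := ih y
        obtain ⟨y2, hy2, w, hw⟩ := h1 z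
        exact ⟨y' + ℓ ^ k • y2, T.add_mem hy' (T.nsmul_mem hy2 _), w, by
          rw [hz, hw, smul_add, pow_succ, mul_smul, add_assoc]⟩
    obtain ⟨n, hn, hnJ⟩ := exists_nsmul_le hJ.1.1 hI.1
    obtain ⟨k, n', hn', rfl⟩ := Nat.exists_eq_pow_mul_and_not_dvd hn.ne' ℓ hl.out.ne_one
    intro x hx
    obtain ⟨y, hy, hxy⟩ := mem_lm.1 (hmJ x hx)
    refine Loc_Loc hm ⟨n', hn', ?_⟩
    obtain ⟨y', hy', z, hz⟩ := h2 k ⟨y, hy⟩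
    have hz' : y = (y' : D) + ℓ ^ k • (z : D) := by
      have := congrArg (Subtype.val) hz; simpa using this
    rw [← hxy, hz', mul_add, smul_add]
    refine I.add_mem (I.nsmul_mem hy' _) ?_
    have := hnJ _ (huJ z z.2)
    rwa [mul_comm, mul_smul, ← mul_smul_comm] at this
  · exfalso
    obtain ⟨c, hc'⟩ := right_ideal_eig R (by
      rintro _ ⟨y, hy, rfl⟩ N
      obtain ⟨w, rfl⟩ := hs N
      refine (hR _).2 ⟨y * w, ?_, map_mul _ _ _⟩
      rw [hT]
      have := hI.2 _ ((hT y).1 hy) w w.2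
      rwa [mul_assoc] at this) (ρ a0) (by
      rintro _ ⟨y, hy, rfl⟩
      refine (hR _).2 ⟨a0 * y, ?_, map_mul _ _ _⟩
      rw [hT, Subring.coe_mul, ← mul_assoc, hua, smul_mul_assoc, mul_assoc]
      exact I.nsmul_mem (hαI _ hy) _) htop
    obtain ⟨k, rfl⟩ : ∃ k : ℕ, (k : ZMod ℓ) = c := ⟨c.val, ZMod.natCast_zmod_val c⟩
    have h1 : ∀ y ∈ T, ∃ z : Λ, a0 * y = k • y + ℓ • z := by
      intro y hy
      obtain ⟨z, hz⟩ := (hk (a0 * y - k • y)).1 (by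
        rw [map_sub, map_mul, hc' _ ((hR _).2 ⟨y, hy, rfl⟩), map_nsmul, Nat.cast_smul_eq_nsmul, sub_self])
      exact ⟨z, by rw [← hz]; abel⟩
    have hl0 : (ℓ : ℚ) ≠ 0 := by exact_mod_cast hl.out.ne_zero
    obtain ⟨z, hz⟩ := hc (-(m * k : ℚ) / ℓ) ((m * m : ℚ) / ℓ) (by
      intro x hx
      have hxJ : m • x ∈ lm u Λ.toAddSubgroup := hmJ x (hIJ hx)
      obtain ⟨y, hy, hxy⟩ := mem_lm.1 hxJ
      obtain ⟨z, hz⟩ := h1 ⟨y, hy⟩ (by rw [hT]; simpa [hxy] using I.nsmul_mem hx m)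
      have hz' : (a0 : D) * y = k • y + ℓ • (z : D) := by
        have := congrArg (Subtype.val) hz; simpa using this
      have h2 : m • (α * (m • x)) = k • (m • x) + ℓ • (u * (z : D)) := by
        have := congrArg (u * ·) hz'
        simp only [← mul_assoc, hua, mul_add, mul_smul_comm] at this
        rw [hxy, smul_mul_assoc, mul_assoc, hxy] at this
        exact this
      convert huJ z z.2 using 1
      have h3 : u * (z : D) = (1 / ℓ : ℚ) • ((ℓ : ℚ) • (u * (z : D))) := by
        rw [smul_smul]; field_simp; simp
      rw [h3, Nat.cast_smul_eq_nsmul, eq_sub_iff_add_eq'.2 h2.symm]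
      simp only [← Nat.cast_smul_eq_nsmul ℚ, add_mul, smul_mul_assoc, one_mul, mul_smul_comm]
      module)
    have : (ℓ : ℤ) ∣ m * m := ⟨z, by field_simp at hz; rw [← sq]; exact_mod_cast hz⟩
    have : ℓ ∣ m * m := by exact_mod_cast this
    exact (hl.out.dvd_mul.1 this).elim hm hm

/-- the set-up of an optimally embedded pair -/
lemma orbit_K {I J : AddSubgroup D} (hI : IsRt Λ I)
    (hJ : IsRt Λ J) (hIJ : I ≤ J) {α : D} (hαI : ∀ x ∈ I, α * x ∈ I) (hαJ : ∀ x ∈ J, α * x ∈ J)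
    (hc : ∀ a b : ℚ, (∀ x ∈ I, (a • (1 : D) + b • α) * x ∈ J) → (∃ z : ℤ, a = z) ∧ ∃ z : ℤ, b = z)
    {u : D} (hu : u ∈ J) (hu0 : u ≠ 0) (hmax : ∀ x ∈ J, Q.v p x ≤ Q.v p u) :
    I = J ∨ ∀ x, x ∈ I ↔ x ∈ J ∧ Q.v p x ≤ Q.v p u / p := by
  have hP : Fact p.Prime := ⟨S.hp⟩
  have hp1 : (1 : ℚ) < p := by exact_mod_cast S.hp.one_lt
  have hloc : ∀ (ℓ : ℕ) [Fact ℓ.Prime], ℓ ≠ p → J ≤ Loc ℓ I := fun ℓ _ h =>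
    S.loc_eq h hI hJ hIJ hαI hαJ fun a b h => (hc a b h).2
  have hmem : ∀ x ∈ J, x ∈ Loc p I → x ∈ I := fun x hx hxp => mem_of_forall_Loc fun ℓ hl => by
    by_cases h : ℓ = p
    · subst h; exact hxp
    · exact hloc ℓ h hx
  obtain ⟨w, hw, hw0, hwmax⟩ := S.exists_max (ℓ := p) hI.1
  have hI' := S.Loc_p_eq hI hw hw0 hwmax
  obtain ⟨i, hi⟩ := Q.v_val (ℓ := p) hw0
  obtain ⟨j, hj⟩ := Q.v_val (ℓ := p) hu0
  have hij : i ≤ j := by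
    have := hmax w (hIJ hw)
    rwa [hi, hj, zpow_le_zpow_iff_right₀ hp1] at this
  rcases eq_or_lt_of_le hij with h | h
  · left
    refine le_antisymm hIJ fun x hx => hmem x hx ((hI' x).2 ?_)
    rw [hi, h, ← hj]; exact hmax x hx
  rcases eq_or_lt_of_le (Int.add_one_le_iff.2 h) with h | h
  · right
    have he : Q.v p u / p = Q.v p w := by
      rw [hi, hj, ← h, zpow_add_one₀ (by positivity)]; field_simp
    rw [he]
    exact fun x => ⟨fun hx => ⟨hIJ hx, hwmax x hx⟩, fun hx => hmem x hx.1 ((hI' x).2 hx.2)⟩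
  · exfalso
    have hpI : ∀ x ∈ I, (1 / p : ℚ) • x ∈ J := by
      intro x hx
      have hpx : p • ((1 / p : ℚ) • x) = x := by
        rw [← Nat.cast_smul_eq_nsmul ℚ, smul_smul]; field_simp; simp
      refine mem_of_forall_Loc fun ℓ hl => ?_
      by_cases hlp : ℓ = p
      · subst hlp
        rw [S.Loc_p_eq hJ hu hu0 hmax]
        have h1 : Q.v ℓ x = ((ℓ : ℚ) ^ 2)⁻¹ * Q.v ℓ ((1 / ℓ : ℚ) • x) := by
          rw [← S.v_p, ← Q.v_mul, ← nsmul_eq_mul, hpx]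
        have h2 := hwmax x hx
        have h3 : Q.v ℓ w ≤ ((ℓ : ℚ) ^ 2)⁻¹ * Q.v ℓ u := by
          rw [hi, hj, ← zpow_natCast, ← zpow_neg, ← zpow_add₀ (by positivity),
            zpow_le_zpow_iff_right₀ hp1]
          push_cast; omega
        exact le_of_mul_le_mul_left (h1 ▸ h2.trans h3) (by positivity)
      · refine ⟨p, ?_, by rw [hpx]; exact hIJ hx⟩
        rw [Nat.prime_dvd_prime_iff_eq hl.out S.hp]; exact hlp
    obtain ⟨⟨z, hz⟩, -⟩ := hc (1 / p) 0 (fun x hx => by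
      rw [zero_smul, add_zero, smul_mul_assoc, one_mul]; exact hpI x hx)
    have h1 : (1 : ℚ) = (p : ℚ) * z := by rw [← hz]; field_simp
    have h2 : (p : ℤ) ∣ 1 := ⟨z, by exact_mod_cast h1⟩
    have h3 : p ∣ 1 := by exact_mod_cast h2
    exact S.hp.one_lt.ne' (Nat.dvd_one.1 h3)

lemma exists_c {I J : AddSubgroup D} (hI : IsRt Λ I) (hJ : IsRt Λ J) {α : D}
    (hαI : ∀ x ∈ I, α * x ∈ I) {t : ℤ} (ht : Q.trd α = t) (ht' : |t| ≤ 1) (hn : Q.nrd α = 1) :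
    ∃ c : D, c ≠ 0 ∧ c * α = α * c ∧ lm c I ≤ J ∧
    ∀ a b : ℚ, (∀ x ∈ lm c I, (a • (1 : D) + b • α) * x ∈ J) → (∃ z : ℤ, a = z) ∧ ∃ z : ℤ, b = z := by
  have hα : ∀ q : ℚ, α ≠ q • (1 : D) := by
    rintro q rfl
    rw [Q.nrd_smul, Q.nrd_one, mul_one] at hn
    rw [Q.trd_smul_one] at ht
    have h1 : (t : ℚ) ^ 2 = 4 := by rw [← ht]; linear_combination 4 * hn
    have h2 : t ^ 2 = 4 := by exact_mod_cast h1
    have := abs_le.1 ht'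
    nlinarith
  let C : Set D := {c | c ≠ 0 ∧ c * α = α * c ∧ lm c I ≤ J}
  have hC : C.Nonempty := by
    obtain ⟨m, hm, h⟩ := exists_nsmul_le hI.1.1 hJ.1
    refine ⟨(m : D), by exact_mod_cast hm.ne', Nat.cast_comm _ _, lm_le_iff.2 fun y hy => ?_⟩
    rw [← nsmul_eq_mul]; exact h y hy
  obtain ⟨c, hcC, hcmin⟩ : ∃ c ∈ C, ∀ d ∈ C, (lm c I).relIndex J ≤ (lm d I).relIndex J :=
    ⟨Function.argminOn (fun c => (lm c I).relIndex J) C hC, Function.argminOn_mem _ _ _,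
      fun d hd => Function.argminOn_le (fun c => (lm c I).relIndex J) C hd⟩
  have hmin : ∀ d ∈ C, Q.nrd c ≤ Q.nrd d := by
    intro d hd
    have h1 := Q.cov_relIndex hJ.1 (hI.1.lm hcC.1) hcC.2.2
    have h2 := Q.cov_relIndex hJ.1 (hI.1.lm hd.1) hd.2.2
    rw [Q.cov_lm hI.1 hcC.1] at h1
    rw [Q.cov_lm hI.1 hd.1] at h2
    have h3 : ((lm c I).relIndex J : ℝ) ≤ (lm d I).relIndex J := by exact_mod_cast hcmin d hd
    have h4 := mul_le_mul_of_nonneg_left h3 (Q.cov_pos hJ.1).le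
    rw [← h1, ← h2] at h4
    have h5 := le_of_mul_le_mul_right h4 (Q.cov_pos hI.1)
    have h6 : (Q.nrd c) ^ 2 ≤ (Q.nrd d) ^ 2 := by exact_mod_cast h5
    exact (pow_le_pow_iff_left₀ (Q.nrd_nonneg _) (Q.nrd_nonneg _) two_ne_zero).1 h6
  refine ⟨c, hcC.1, hcC.2.1, hcC.2.2, fun a b hab => ?_⟩
  have hcI := lm_le_iff.1 hcC.2.2
  set r : D := (a - round a) • (1 : D) + (b - round b) • α with hr
  have hrα : r * α = α * r := by
    rw [hr, add_mul, mul_add, smul_mul_assoc, smul_mul_assoc, mul_smul_comm, mul_smul_comm, one_mul, mul_one]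
  have hrc : ∀ y ∈ I, r * c * y ∈ J := by
    intro y hy
    have h1 := hab (c * y) (mem_lm.2 ⟨y, hy, rfl⟩)
    have h2 : r * c * y = (a • (1 : D) + b • α) * (c * y) - (round a • (c * y) + round b • (c * (α * y))) := by
      have : c * (α * y) = α * (c * y) := by rw [← mul_assoc, hcC.2.1, mul_assoc]
      rw [this, hr, mul_assoc, ← Int.cast_smul_eq_zsmul ℚ, ← Int.cast_smul_eq_zsmul ℚ]
      simp only [add_mul, smul_mul_assoc, one_mul]
      module
    rw [h2]
    exact J.sub_mem h1 (J.add_mem (J.zsmul_mem (hcI y hy) _) (J.zsmul_mem (hcI _ (hαI y hy)) _))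
  have hr0 : r = 0 := by
    by_contra hr0
    have hm := hmin (r * c) ⟨mul_ne_zero hr0 hcC.1, by rw [mul_assoc, hcC.2.1, ← mul_assoc, hrα, mul_assoc],
      lm_le_iff.2 hrc⟩
    rw [Q.nrd_mul] at hm
    have hpos := Q.pos c hcC.1
    have h1 : 1 ≤ Q.nrd r := by
      by_contra! h
      nlinarith
    rw [hr, Q.nrd_lin, ht, hn] at h1
    have ha := abs_le.1 (abs_sub_round a)
    have hb := abs_le.1 (abs_sub_round b)
    have ht2 : |(t : ℚ)| ≤ 1 := by exact_mod_cast ht'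
    have ht3 := abs_le.1 ht2
    set A := a - round a
    set E := b - round b
    have h2 : A ^ 2 ≤ 1 / 4 := by nlinarith
    have h3 : E ^ 2 ≤ 1 / 4 := by nlinarith
    have h4 : A * E * t ≤ 1 / 4 := by
      have : |A * E * t| ≤ 1 / 4 := by
        rw [abs_mul, abs_mul]
        calc |A| * |E| * |(t : ℚ)| ≤ (1 / 2) * (1 / 2) * 1 := by
              gcongr
              · exact abs_sub_round a
              · exact abs_sub_round b
          _ = 1 / 4 := by norm_num
      exact (le_abs_self _).trans this
    linarith
  have hb : b - round b = 0 := by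
    by_contra hb
    refine hα (-(a - round a) / (b - round b)) ?_
    rw [hr] at hr0
    calc α = (1 / (b - round b)) • ((b - round b) • α) := by rw [smul_smul]; field_simp; simp
      _ = (1 / (b - round b)) • (-((a - round a) • (1 : D))) := by rw [eq_neg_of_add_eq_zero_right hr0]
      _ = _ := by rw [← neg_smul, smul_smul]; congr 1; field_simp
  have ha : a - round a = 0 := by
    rw [hr, hb, zero_smul, add_zero] at hr0
    exact (smul_eq_zero.1 hr0).resolve_right one_ne_zero
  exact ⟨⟨round a, by linarith⟩, ⟨round b, by linarith⟩⟩

theorem orbit_two {t : ℤ} (ht' : |t| ≤ 1) : ∃ (α0 : D) (K : Bool → AddSubgroup D), ∀ I, IsRt Λ I →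
    ∀ α : D, (∀ x ∈ I, α * x ∈ I) → Q.trd α = t → Q.nrd α = 1 →
    ∃ y : D, y ≠ 0 ∧ (∃ i, lm y I = K i) ∧ y * α = α0 * y := by
  have hP : Fact p.Prime := ⟨S.hp⟩
  by_cases hex : ∃ J, IsRt Λ J ∧ ∃ α : D, (∀ x ∈ J, α * x ∈ J) ∧ Q.trd α = t ∧ Q.nrd α = 1
  swap
  · refine ⟨0, fun _ => ⊥, fun I hI α h1 h2 h3 => (hex ⟨I, hI, α, h1, h2, h3⟩).elim⟩
  obtain ⟨J, hJ, α0, hα0, ht0, hn0⟩ := hex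
  obtain ⟨u, hu, hu0, hmax⟩ := S.exists_max (ℓ := p) hJ.1
  classical
  let K2 : AddSubgroup D := if h : ∃ K : AddSubgroup D, ∀ x, x ∈ K ↔ x ∈ J ∧ Q.v p x ≤ Q.v p u / p
    then h.choose else ⊥
  refine ⟨α0, fun i => if i then J else K2, fun I hI α h1 h2 h3 => ?_⟩
  have hα : ∀ q : ℚ, α0 ≠ q • (1 : D) := by
    rintro q rfl
    rw [Q.nrd_smul, Q.nrd_one, mul_one] at hn0
    rw [Q.trd_smul_one] at ht0
    have h1 : (t : ℚ) ^ 2 = 4 := by rw [← ht0]; linear_combination 4 * hn0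
    have h2 : t ^ 2 = 4 := by exact_mod_cast h1
    have := abs_le.1 ht'
    nlinarith
  obtain ⟨y, hy0, hy⟩ := Q.conjugate hα (ht0.trans h2.symm) (hn0.trans h3.symm)
  have hI1 := hI.lm hy0
  have hαI1 : ∀ x ∈ lm y I, α0 * x ∈ lm y I := by
    intro x hx
    obtain ⟨z, hz, rfl⟩ := mem_lm.1 hx
    exact mem_lm.2 ⟨α * z, h1 z hz, by rw [← mul_assoc, hy, mul_assoc]⟩
  obtain ⟨c, hc0, hcα, hcJ, hc⟩ := S.exists_c hI1 hJ hαI1 ht0 ht' hn0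
  have hαI2 : ∀ x ∈ lm c (lm y I), α0 * x ∈ lm c (lm y I) := by
    intro x hx
    obtain ⟨z, hz, rfl⟩ := mem_lm.1 hx
    exact mem_lm.2 ⟨α0 * z, hαI1 z hz, by rw [← mul_assoc, hcα, mul_assoc]⟩
  refine ⟨c * y, mul_ne_zero hc0 hy0, ?_, by rw [mul_assoc, hy, ← mul_assoc, hcα, mul_assoc]⟩
  rw [lm_mul]
  rcases S.orbit_K (hI1.lm hc0) hJ hcJ hαI2 hα0 hc hu hu0 hmax with h | h
  · exact ⟨true, by simpa using h⟩
  · refine ⟨false, ?_⟩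
    have hK : ∃ K : AddSubgroup D, ∀ x, x ∈ K ↔ x ∈ J ∧ Q.v p x ≤ Q.v p u / p := ⟨_, h⟩
    have : K2 = hK.choose := dif_pos hK
    simp only [Bool.false_eq_true, if_false]
    rw [this]
    ext x
    rw [h, hK.choose_spec]

end Setup
end
end Eich

namespace Eich
open Module

lemma card_mul_stab {G X : Type*} [Group G] [MulAction G X] [Finite G] [Finite X] {s : ℕ}
    (hs : ∀ x : X, Nat.card (MulAction.stabilizer G x) = s) :
    Nat.card X * s = Nat.card G * Nat.card (MulAction.orbitRel.Quotient G X) := by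
  classical
  have := Fintype.ofFinite G
  have := Fintype.ofFinite X
  have := Fintype.ofFinite (MulAction.orbitRel.Quotient G X)
  have h0 : ∀ x : X, Nat.card (MulAction.orbit G x) * s = Nat.card G := fun x => by
    rw [← hs x, ← Nat.card_prod]
    exact Nat.card_congr (MulAction.orbitProdStabilizerEquivGroup G x)
  rw [Nat.card_congr (MulAction.selfEquivSigmaOrbits G X), Nat.card_sigma, Finset.sum_mul,
    Finset.sum_congr rfl fun ω _ => h0 _]
  simp [mul_comm]

section
set_option linter.unusedSectionVars false
variable {D : Type*} [DivisionRing D] [CharZero D]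

/-- left order -/
def OL (I : AddSubgroup D) : Subring D where
  carrier := {x | ∀ y ∈ I, x * y ∈ I}
  zero_mem' y _ := by simp
  one_mem' y hy := by simpa
  add_mem' ha hb y hy := by rw [add_mul]; exact I.add_mem (ha y hy) (hb y hy)
  mul_mem' ha hb y hy := by rw [mul_assoc]; exact ha _ (hb y hy)
  neg_mem' ha y hy := by rw [neg_mul]; exact I.neg_mem (ha y hy)

lemma OL_fg {I : AddSubgroup D} (hI : IsLat I) : Fg (OL I).toAddSubgroup := by
  obtain ⟨y, hy, hy0⟩ := QD.exists_ne hI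
  refine fg_of_le (fun x hx => ?_) (hI.1.map (AddMonoidHom.mulRight y⁻¹))
  exact ⟨x * y, hx y hy, by simp [mul_assoc, mul_inv_cancel₀ hy0]⟩

lemma Gam_mem_OL {I : AddSubgroup D} {u : Dˣ} (hu : u ∈ Gam I) : (u : D) ∈ OL I :=
  fun y hy => (mem_Gam.1 hu).le (mem_lm.2 ⟨y, hy, rfl⟩)

lemma neg_mem_Gam {I : AddSubgroup D} {u : Dˣ} (hu : u ∈ Gam I) : -u ∈ Gam I := by
  rw [mem_Gam, Units.val_neg]
  conv_rhs => rw [← mem_Gam.1 hu]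
  ext x
  simp only [mem_lm]
  exact ⟨fun ⟨z, hz, h⟩ => ⟨-z, I.neg_mem hz, by rw [← h]; simp⟩,
    fun ⟨z, hz, h⟩ => ⟨-z, I.neg_mem hz, by rw [← h]; simp⟩⟩

namespace QD
variable (Q : QD D)

/-- units of trace `t` -/
def PP (I : AddSubgroup D) (t : ℤ) : Type _ := {u : Gam I // Q.trd ((u : Dˣ) : D) = t}

instance (I : AddSubgroup D) (t : ℤ) : MulAction (Gam I) (Q.PP I t) where
  smul g u := ⟨g * u.1 * g⁻¹, by
    have := Q.trd_comm ((g : Dˣ) * (u.1 : Dˣ) : D) ((g⁻¹ : Gam I) : Dˣ)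
    simp only [Subgroup.coe_mul, Units.val_mul]
    rw [this, ← mul_assoc, ← Units.val_mul, ← Subgroup.coe_mul, inv_mul_cancel]
    simpa using u.2⟩
  one_smul u := Subtype.ext (by change 1 * u.1 * 1⁻¹ = u.1; simp)
  mul_smul g h u := Subtype.ext (by
    change g * h * u.1 * (g * h)⁻¹ = g * (h * u.1 * h⁻¹) * g⁻¹; group)

lemma PP_smul {I : AddSubgroup D} {t : ℤ} (g : Gam I) (u : Q.PP I t) :
    (g • u).1 = g * u.1 * g⁻¹ := rfl

lemma mem_stab {I : AddSubgroup D} {t : ℤ} (g : Gam I) (u : Q.PP I t) :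
    g ∈ MulAction.stabilizer (Gam I) u ↔ ((g : Dˣ) : D) * (u.1 : Dˣ) = (u.1 : Dˣ) * (g : Dˣ) := by
  have h1 : g • u = u ↔ g * u.1 * g⁻¹ = u.1 :=
    ⟨fun h => congrArg Subtype.val h, fun h => Subtype.ext h⟩
  rw [MulAction.mem_stabilizer_iff, h1, mul_inv_eq_iff_eq_mul, Subtype.ext_iff, Units.ext_iff]
  simp

lemma trd_Gam {I : AddSubgroup D} (hI : IsLat I) {u : Dˣ} (hu : u ∈ Gam I) :
    ∃ z : ℤ, Q.trd u = z := Q.trd_int (OL_fg hI) (Gam_mem_OL hu)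

lemma not_rat {α : D} {t : ℤ} (ht : Q.trd α = t) (ht' : |t| ≤ 1) (hn : Q.nrd α = 1) (q : ℚ) :
    α ≠ q • (1 : D) := by
  rintro rfl
  rw [Q.nrd_smul, Q.nrd_one, mul_one] at hn
  rw [Q.trd_smul_one] at ht
  have h1 : (t : ℚ) ^ 2 = 4 := by rw [← ht]; linear_combination 4 * hn
  have h2 : t ^ 2 = 4 := by exact_mod_cast h1
  have := abs_le.1 ht'
  nlinarith

lemma stab_param {I : AddSubgroup D} (hI : IsLat I) {t : ℤ} (ht' : |t| ≤ 1) (u : Q.PP I t) (g : Gam I)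
    (hg : g ∈ MulAction.stabilizer (Gam I) u) : ∃ (a b : ℚ) (s r : ℤ),
      ((g : Dˣ) : D) = a • (1 : D) + b • ((u.1 : Dˣ) : D) ∧ 2 * a + b * t = s ∧
      a * t + b * (t ^ 2 - 2) = r ∧ a ^ 2 + a * b * t + b ^ 2 = 1 := by
  have hn := Q.nrd_Gam hI u.1.2
  obtain ⟨a, b, hab⟩ := Q.cent (Q.not_rat u.2 ht' hn) ((Q.mem_stab g u).1 hg)
  obtain ⟨s, hs⟩ := Q.trd_Gam hI g.2
  obtain ⟨r, hr⟩ := Q.trd_Gam hI (g * u.1).2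
  have h1 := Q.nrd_Gam hI g.2
  have hu := u.2
  refine ⟨a, b, s, r, hab, ?_, ?_, ?_⟩
  · rw [hab, map_add, map_smul, map_smul, Q.trd_one, hu] at hs
    rw [← hs]; simp only [smul_eq_mul]; ring
  · rw [Subgroup.coe_mul, Units.val_mul, hab, add_mul, smul_mul_assoc, smul_mul_assoc, one_mul,
      map_add, map_smul, map_smul, Q.trd_sq, hu, hn] at hr
    rw [← hr]; simp only [smul_eq_mul]; ring
  · rw [hab, Q.nrd_lin, hu, hn] at h1
    rw [← h1]; ring

lemma stab4 {I : AddSubgroup D} (hI : IsLat I) (u : Q.PP I 0) :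
    Nat.card (MulAction.stabilizer (Gam I) u) = 4 := by
  have hn := Q.nrd_Gam hI u.1.2
  have hrel := Q.rel ((u.1 : Dˣ) : D)
  rw [u.2, hn] at hrel
  have h2 : ((u.1 : Dˣ) : D) * (u.1 : Dˣ) = -1 := by simpa using hrel
  have hz : MulAction.stabilizer (Gam I) u = Subgroup.zpowers u.1 := by
    refine le_antisymm (fun g hg => ?_) (Subgroup.zpowers_le.2 ?_)
    · obtain ⟨a, b, s, r, hab, hs, hr, h1⟩ := Q.stab_param hI (by norm_num) u g hg
      have h3 : (s : ℚ) ^ 2 + r ^ 2 = 4 := by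
        rw [← hs, ← hr]; push_cast; linear_combination 4 * h1
      have h3 : s ^ 2 + r ^ 2 = 4 := by exact_mod_cast h3
      have hs2 : s ≤ 2 := by nlinarith
      have hs3 : -2 ≤ s := by nlinarith
      have hr2 : r ≤ 2 := by nlinarith
      have hr3 : -2 ≤ r := by nlinarith
      have ha : a = s / 2 := by rw [← hs]; push_cast; ring
      have hb : b = -r / 2 := by rw [← hr]; push_cast; ring
      have key : ∀ k : ℕ, ((g : Dˣ) : D) = ((u.1 : Dˣ) : D) ^ k → g ∈ Subgroup.zpowers u.1 := fun k hk =>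
        ⟨k, Subtype.ext (Units.ext (by simp [hk]))⟩
      rw [ha, hb] at hab
      interval_cases s <;> interval_cases r <;> first | (exfalso; revert h3; norm_num; done) | skip
      · exact key 2 (by rw [hab, sq, h2]; norm_num)
      · exact key 1 (by rw [hab]; norm_num)
      · exact key 3 (by rw [hab, pow_succ, sq, h2]; norm_num)
      · exact key 0 (by rw [hab]; norm_num)
    · rw [Q.mem_stab]
  rw [hz, Nat.card_zpowers]
  have : Fact (Nat.Prime 2) := ⟨Nat.prime_two⟩
  refine orderOf_eq_prime_pow (p := 2) (n := 1) (fun h => ?_) (Subtype.ext (Units.ext ?_))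
  · have h3 : ((u.1 : Dˣ) : D) ^ 2 = 1 := by
      have := congrArg (fun x : Gam I => ((x : Dˣ) : D)) h
      simpa using this
    rw [sq, h2] at h3
    exact absurd h3 (by norm_num)
  · simp only [Subgroup.coe_pow, Units.val_pow_eq_pow_val]
    have h3 : ((u.1 : Dˣ) : D) ^ 2 = -1 := by rw [sq, h2]
    rw [show 2 ^ (1 + 1) = 2 * 2 by norm_num, pow_mul, h3]; simp

lemma stab6 {I : AddSubgroup D} (hI : IsLat I) (u : Q.PP I (-1)) :
    Nat.card (MulAction.stabilizer (Gam I) u) = 6 := by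
  have hn := Q.nrd_Gam hI u.1.2
  have hrel := Q.rel ((u.1 : Dˣ) : D)
  rw [u.2, hn] at hrel
  set x := ((u.1 : Dˣ) : D) with hx
  have h2 : x * x = -x - 1 := by simpa using hrel
  have h3 : x ^ 3 = 1 := by rw [pow_succ, sq, h2, sub_mul, neg_mul, h2]; simp
  let w : Gam I := ⟨-u.1, neg_mem_Gam u.1.2⟩
  have hw : ((w : Dˣ) : D) = -x := by simp [w, hx]
  have hz : MulAction.stabilizer (Gam I) u = Subgroup.zpowers w := by
    refine le_antisymm (fun g hg => ?_) (Subgroup.zpowers_le.2 ?_)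
    · obtain ⟨a, b, s, r, hab, hs, hr, h1⟩ := Q.stab_param hI (by norm_num) u g hg
      rw [← hx] at hab
      have h4 : (s : ℚ) ^ 2 + s * r + r ^ 2 = 3 := by
        rw [← hs, ← hr]; push_cast; linear_combination 3 * h1
      have h4 : s ^ 2 + s * r + r ^ 2 = 3 := by exact_mod_cast h4
      have hs2 : s ≤ 2 := by nlinarith [sq_nonneg (s + 2 * r)]
      have hs3 : -2 ≤ s := by nlinarith [sq_nonneg (s + 2 * r)]
      have hr2 : r ≤ 2 := by nlinarith [sq_nonneg (r + 2 * s)]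
      have hr3 : -2 ≤ r := by nlinarith [sq_nonneg (r + 2 * s)]
      have ha : a = (s - r) / 3 := by rw [← hs, ← hr]; push_cast; ring
      have hb : b = -(2 * r + s) / 3 := by rw [← hr, ← hs]; push_cast; ring
      have key : ∀ k : ℕ, ((g : Dˣ) : D) = (-x) ^ k → g ∈ Subgroup.zpowers w := fun k hk =>
        ⟨k, Subtype.ext (Units.ext (by simp [hk, hw]))⟩
      rw [ha, hb] at hab
      interval_cases s <;> interval_cases r <;> first | (exfalso; revert h4; norm_num; done) | skip
      · exact key 3 (by rw [hab, Odd.neg_pow (by decide), h3]; norm_num)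
      · exact key 4 (by rw [hab, Even.neg_pow (by decide), pow_succ, h3]; norm_num)
      · exact key 2 (by rw [hab, Even.neg_pow (by decide), sq, h2]; norm_num [sub_eq_add_neg, add_comm])
      · exact key 5 (by rw [hab, Odd.neg_pow (by decide), show 5 = 3 + 2 by norm_num, pow_add, h3, sq, h2]; norm_num [add_comm])
      · exact key 1 (by rw [hab]; norm_num)
      · exact key 0 (by rw [hab]; norm_num)
    · rw [Q.mem_stab, hw, ← hx]; simp
  have hone : u.1 ≠ 1 := fun h => by
    have := u.2
    rw [h] at this
    simp [Q.trd_one] at this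
    norm_num at this
  rw [hz, Nat.card_zpowers]
  have h5 : orderOf u.1 = 3 := by
    have : Fact (Nat.Prime 3) := ⟨Nat.prime_three⟩
    exact orderOf_eq_prime (Subtype.ext (Units.ext (by simpa using h3))) hone
  let n : Gam I := ⟨-1, neg_mem_Gam (one_mem _)⟩
  have h6 : orderOf n = 2 := by
    have : Fact (Nat.Prime 2) := ⟨Nat.prime_two⟩
    refine orderOf_eq_prime (Subtype.ext (Units.ext (by simp [n]))) fun h => ?_
    have := congrArg (fun x : Gam I => ((x : Dˣ) : D)) h
    simp only [n, Units.val_neg, Units.val_one, Subgroup.coe_one] at this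
    exact absurd this (by norm_num)
  have h7 : w = n * u.1 := Subtype.ext (Units.ext (by simp [w, n]))
  have hcom : Commute n u.1 := Subtype.ext (Units.ext (by simp [n]))
  rw [h7, hcom.orderOf_mul_eq_mul_orderOf_of_coprime (by rw [h5, h6]; norm_num), h5, h6]

/-- number of orbits -/
noncomputable def orb (I : AddSubgroup D) (t : ℤ) : ℕ :=
  Nat.card (MulAction.orbitRel.Quotient (Gam I) (Q.PP I t))

lemma PP_finite {I : AddSubgroup D} (hI : IsLat I) (t : ℤ) : Finite (Q.PP I t) := by
  have := Q.finite_Gam hI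
  exact Subtype.finite

lemma card_Gam {I : AddSubgroup D} (hI : IsLat I) :
    Nat.card (Gam I) = 2 + Nat.card (Q.PP I 0) + 2 * Nat.card (Q.PP I (-1)) := by
  classical
  have := Q.finite_Gam hI
  have := Fintype.ofFinite (Gam I)
  have hb : ∀ u : Gam I, ∃ z ∈ Finset.Icc (-2 : ℤ) 2, Q.trd ((u : Dˣ) : D) = z := by
    intro u
    obtain ⟨z, hz⟩ := Q.trd_Gam hI u.2
    have h1 := Q.disc_nonpos ((u : Dˣ) : D)
    rw [Q.nrd_Gam hI u.2, hz] at h1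
    have h2 : z ^ 2 ≤ 4 := by
      have : (z : ℚ) ^ 2 ≤ (4 : ℤ) := by simpa using h1
      exact_mod_cast this
    exact ⟨z, Finset.mem_Icc.2 ⟨by nlinarith, by nlinarith⟩, hz⟩
  choose f hf hf' using hb
  have h1 : ∀ t : ℤ, (Finset.univ.filter fun u => f u = t).card = Nat.card (Q.PP I t) := by
    intro t
    rw [PP, Nat.card_eq_fintype_card, Fintype.card_subtype]
    congr 1
    ext u
    simp only [Finset.mem_filter, Finset.mem_univ, true_and, hf', Int.cast_inj]
  have h2 : Nat.card (Gam I) = ∑ t ∈ Finset.Icc (-2 : ℤ) 2, Nat.card (Q.PP I t) := by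
    rw [Nat.card_eq_fintype_card, ← Finset.card_univ,
      Finset.card_eq_sum_card_fiberwise (f := f) (t := Finset.Icc (-2) 2) fun u _ => hf u]
    exact Finset.sum_congr rfl fun t _ => h1 t
  have h3 : ∀ t : ℤ, Nat.card (Q.PP I t) = Nat.card (Q.PP I (-t)) := fun t =>
    Nat.card_congr
      { toFun := fun u => ⟨⟨-u.1, neg_mem_Gam u.1.2⟩, by simpa using u.2⟩
        invFun := fun u => ⟨⟨-u.1, neg_mem_Gam u.1.2⟩, by simpa [neg_eq_iff_eq_neg] using u.2⟩
        left_inv := fun u => Subtype.ext (Subtype.ext (neg_neg _))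
        right_inv := fun u => Subtype.ext (Subtype.ext (neg_neg _)) }
  have h4 : Nat.card (Q.PP I 2) = 1 := by
    rw [Nat.card_eq_one_iff_unique]
    refine ⟨⟨fun u v => ?_⟩, ⟨⟨1, by simp [Q.trd_one]⟩⟩⟩
    have key : ∀ u : Q.PP I 2, ((u.1 : Dˣ) : D) = 1 := fun u => by
      have := Q.disc_zero (x := ((u.1 : Dˣ) : D)) (by rw [Q.nrd_Gam hI u.1.2, u.2]; norm_num)
      rw [this, u.2]; simp
    exact Subtype.ext (Subtype.ext (Units.ext ((key u).trans (key v).symm)))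
  have h5 : Finset.Icc (-2 : ℤ) 2 = {-2, -1, 0, 1, 2} := by decide
  have h6 := h3 2
  have h7 := h3 1
  rw [h2, h5]
  simp
  omega

lemma unit_eq {I : AddSubgroup D} (hI : IsLat I) :
    (1 : ℝ) = 2 * (1 / Nat.card (Gam I)) + Q.orb I 0 / 4 + Q.orb I (-1) / 3 := by
  have := Q.finite_Gam hI
  have := Q.PP_finite hI 0
  have := Q.PP_finite hI (-1)
  have h4 := card_mul_stab (Q.stab4 hI)
  have h6 := card_mul_stab (Q.stab6 hI)
  have hg := Q.card_Gam hI
  change _ = _ * Q.orb I 0 at h4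
  change _ = _ * Q.orb I (-1) at h6
  have hpos : (0 : ℝ) < Nat.card (Gam I) := by exact_mod_cast Nat.card_pos
  have h4' : (Nat.card (Q.PP I 0) : ℝ) * 4 = Nat.card (Gam I) * Q.orb I 0 := by exact_mod_cast h4
  have h6' : (Nat.card (Q.PP I (-1)) : ℝ) * 6 = Nat.card (Gam I) * Q.orb I (-1) := by exact_mod_cast h6
  have hg' : (Nat.card (Gam I) : ℝ) = 2 + Nat.card (Q.PP I 0) + 2 * Nat.card (Q.PP I (-1)) := by
    exact_mod_cast hg
  field_simp
  linear_combination 12 * hg' + 3 * h4' + 4 * h6'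

end QD

namespace Setup
variable {p : ℕ} {Q : QD D} {Λ : Subring D} (S : Setup p Q Λ)
include S

lemma orb_le {ι : Type*} (s : Finset ι) (I : ι → AddSubgroup D) (hI : ∀ i, IsRt Λ (I i))
    (hne : ∀ i j, i ≠ j → ¬ Eqv (I i) (I j)) {t : ℤ} (ht : |t| ≤ 1) :
    ∑ i ∈ s, Q.orb (I i) t ≤ 2 := by
  obtain ⟨α0, K, hK⟩ := S.orbit_two ht
  have hfin : ∀ i, Finite (MulAction.orbitRel.Quotient (Gam (I i)) (Q.PP (I i) t)) := fun i => by
    have := Q.PP_finite (hI i).1 t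
    exact Quotient.finite _
  have hch : ∀ x : (Σ i : s, MulAction.orbitRel.Quotient (Gam (I i)) (Q.PP (I i) t)),
      ∃ (k : Bool) (y : D), y ≠ 0 ∧ lm y (I x.1) = K k ∧
        y * ((x.2.out.1 : Dˣ) : D) = α0 * y := by
    intro x
    obtain ⟨y, h0, ⟨k, hk⟩, h⟩ := hK (I x.1) (hI x.1) (x.2.out.1 : Dˣ) (Gam_mem_OL x.2.out.1.2)
      x.2.out.2 (Q.nrd_Gam (hI x.1).1 x.2.out.1.2)
    exact ⟨k, y, h0, hk, h⟩
  choose k y hy0 hyK hyα using hch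
  have hinj : Function.Injective k := by
    rintro ⟨i, o⟩ ⟨j, o'⟩ hk
    have hlm : lm (y ⟨i, o⟩) (I i) = lm (y ⟨j, o'⟩) (I j) := by
      have h1 := hyK ⟨i, o⟩
      have h2 := hyK ⟨j, o'⟩
      rw [hk, ← h2] at h1; exact h1
    have hij : i = j := by
      by_contra h
      refine hne i j (fun h' => h (Subtype.ext h')) ?_
      refine Eqv.trans (Eqv.symm ⟨y ⟨i, o⟩, hy0 _, rfl⟩) ⟨y ⟨j, o'⟩, hy0 _, hlm.symm⟩
    subst hij
    congr 1
    have h1 := hyα ⟨i, o⟩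
    have h2 := hyα ⟨i, o'⟩
    have h10 := hy0 ⟨i, o⟩
    have h20 := hy0 ⟨i, o'⟩
    simp only at h1 h2
    generalize y ⟨i, o⟩ = y1 at *
    generalize y ⟨i, o'⟩ = y2 at *
    rw [← Quotient.out_eq' o, ← Quotient.out_eq' o']
    have hw0 : y1⁻¹ * y2 ≠ 0 := mul_ne_zero (inv_ne_zero h10) h20
    refine Quotient.sound' ⟨⟨Units.mk0 _ hw0, ?_⟩, Subtype.ext (Subtype.ext (Units.ext ?_))⟩
    · rw [mem_Gam, Units.val_mk0, lm_mul, ← hlm, ← lm_mul, inv_mul_cancel₀ h10, lm_one]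
    · change (y1⁻¹ * y2) * (((Quotient.out o').1 : Dˣ) : D) * (y1⁻¹ * y2)⁻¹ = (((Quotient.out o).1 : Dˣ) : D)
      rw [mul_inv_eq_iff_eq_mul₀ hw0, mul_assoc, h2]
      have : (((Quotient.out o).1 : Dˣ) : D) = y1⁻¹ * (α0 * y1) := by
        rw [← h1, inv_mul_cancel_left₀ h10]
      rw [this]
      simp [mul_assoc, mul_inv_cancel_left₀ h10]
  have h1 := Nat.card_le_card_of_injective k hinj
  rw [Nat.card_sigma] at h1
  simp only [Nat.card_eq_fintype_card, Fintype.card_bool] at h1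
  rw [← Finset.sum_coe_sort s fun i => Q.orb (I i) t]
  exact h1

/-- the setoid of right ideal classes -/
def cls (Λ : Subring D) : Setoid {I : AddSubgroup D // IsRt Λ I} where
  r I J := Eqv I.1 J.1
  iseqv := ⟨fun _ => ⟨1, one_ne_zero, lm_one _⟩, Eqv.symm, Eqv.trans⟩

theorem class_number : ∃ A B : ℕ, A ≤ 2 ∧ B ≤ 2 ∧
    12 * Nat.card (Quotient (cls Λ)) + 1 = p + 3 * B + 4 * A := by
  let I : Quotient (cls Λ) → AddSubgroup D := fun c => c.out.1
  have hI : ∀ i, IsRt Λ (I i) := fun i => i.out.2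
  have hne : ∀ i j, i ≠ j → ¬ Eqv (I i) (I j) := fun i j hij h => hij (by
    rw [← i.out_eq, ← j.out_eq]; exact Quotient.sound h)
  have hsum : ∀ s : Finset (Quotient (cls Λ)), (s.card : ℝ) =
      2 * (∑ i ∈ s, (1 : ℝ) / Nat.card (Gam (I i))) + (∑ i ∈ s, Q.orb (I i) 0 : ℕ) / 4 +
        (∑ i ∈ s, Q.orb (I i) (-1) : ℕ) / 3 := by
    intro s
    rw [Finset.card_eq_sum_ones]
    push_cast
    rw [Finset.mul_sum, Finset.sum_div, Finset.sum_div, ← Finset.sum_add_distrib, ← Finset.sum_add_distrib]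
    exact Finset.sum_congr rfl fun i _ => Q.unit_eq (hI i).1
  have hb : ∀ s : Finset (Quotient (cls Λ)), ∑ i ∈ s, Q.orb (I i) 0 ≤ 2 := fun s =>
    S.orb_le s I hI hne (by norm_num)
  have ha : ∀ s : Finset (Quotient (cls Λ)), ∑ i ∈ s, Q.orb (I i) (-1) ≤ 2 := fun s =>
    S.orb_le s I hI hne (by norm_num)
  have hfin : Finite (Quotient (cls Λ)) := by
    by_contra hinf
    rw [not_finite_iff_infinite] at hinf
    obtain ⟨s, hs⟩ := Infinite.exists_subset_card_eq (Quotient (cls Λ)) (p + 2)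
    have h1 := hsum s
    have h2 := S.mass_le s I hI hne
    have h3 : ((∑ i ∈ s, Q.orb (I i) 0 : ℕ) : ℝ) ≤ 2 := by exact_mod_cast hb s
    have h4 : ((∑ i ∈ s, Q.orb (I i) (-1) : ℕ) : ℝ) ≤ 2 := by exact_mod_cast ha s
    rw [hs] at h1
    push_cast at h1 h3 h4
    have : (0 : ℝ) ≤ p := by positivity
    linarith
  have := Fintype.ofFinite (Quotient (cls Λ))
  refine ⟨_, _, ha Finset.univ, hb Finset.univ, ?_⟩
  have h1 := hsum Finset.univ
  rw [S.mass_eq Finset.univ I hI hne fun J hJ => ⟨Quotient.mk (cls Λ) ⟨J, hJ⟩, Finset.mem_univ _,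
    Quotient.mk_out (s := cls Λ) ⟨J, hJ⟩⟩, Finset.card_univ, ← Nat.card_eq_fintype_card] at h1
  have h2 : (12 * Nat.card (Quotient (cls Λ)) + 1 : ℝ) = p + 3 * (∑ i, Q.orb (I i) 0 : ℕ) +
      4 * (∑ i, Q.orb (I i) (-1) : ℕ) := by rw [h1]; ring
  exact_mod_cast h2

end Setup
end
end Eich

namespace Eich
open Module
open scoped TensorProduct

section
set_option linter.unusedSectionVars false
variable {D : Type*} [DivisionRing D] [CharZero D]

lemma quadratic (h4 : finrank ℚ D = 4)
    (hc : ∀ x : D, (∀ y, x * y = y * x) → ∃ q : ℚ, x = algebraMap ℚ D q) (x : D) :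
    ∃ t n : ℚ, x * x = t • x - n • (1 : D) := by
  have : FiniteDimensional ℚ D := FiniteDimensional.of_finrank_pos (by omega)
  let K := Algebra.adjoin ℚ {x}
  let _ : DivisionRing K := divisionRingOfFiniteDimensional ℚ K
  have hfree : Module.Free K D := Module.Free.of_divisionRing K D
  have hmul : finrank ℚ K * finrank K D = 4 := by
    rw [← h4]; exact finrank_mul_finrank ℚ K D
  have hdvd : finrank ℚ K ∣ 4 := ⟨_, hmul.symm⟩
  have hle : finrank ℚ K ≤ 4 := Nat.le_of_dvd (by norm_num) hdvd
  have hne : finrank ℚ K ≠ 4 := by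
    intro h
    have htop : K = ⊤ := by
      apply Subalgebra.toSubmodule_injective
      rw [Algebra.top_toSubmodule]
      exact Submodule.eq_top_of_finrank_eq (by rw [h4]; exact h)
    have hcomm : ∀ y z : D, y * z = z * y := by
      intro y z
      have hy : y ∈ K := by rw [htop]; trivial
      have hz : z ∈ K := by rw [htop]; trivial
      rw [show K = (Polynomial.aeval x).range from Algebra.adjoin_singleton_eq_range_aeval ℚ x] at hy hz
      obtain ⟨f, rfl⟩ := hy
      obtain ⟨g, rfl⟩ := hz
      change Polynomial.aeval x f * Polynomial.aeval x g = Polynomial.aeval x g * Polynomial.aeval x f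
      rw [← map_mul, mul_comm, map_mul]
    have : finrank ℚ D ≤ 1 := finrank_le_one (1 : D) fun w => by
      obtain ⟨q, hq⟩ := hc w (hcomm w)
      exact ⟨q, by rw [hq, Algebra.algebraMap_eq_smul_one]⟩
    omega
  have h3 : finrank ℚ K ≤ 2 := by
    by_contra h
    have : finrank ℚ K = 3 := by omega
    rw [this] at hdvd
    norm_num at hdvd
  have hx : x ∈ K := Algebra.self_mem_adjoin_singleton ℚ x
  have hdep : ¬ LinearIndependent ℚ (![1, ⟨x, hx⟩, ⟨x, hx⟩ * ⟨x, hx⟩] : Fin 3 → K) := fun h => by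
    have := h.fintype_card_le_finrank
    simp at this
    omega
  obtain ⟨g, hg, i, hi⟩ := Fintype.not_linearIndependent_iff.1 hdep
  have hg := congrArg (fun z : K => (z : D)) hg
  have hg : g 0 • (1 : D) + g 1 • x + g 2 • (x * x) = 0 := by
    rw [Fin.sum_univ_three] at hg
    exact hg
  by_cases h2 : g 2 = 0
  · rw [h2, zero_smul, add_zero] at hg
    by_cases h1 : g 1 = 0
    · rw [h1, zero_smul, add_zero] at hg
      have h0 : g 0 = 0 := (smul_eq_zero.1 hg).resolve_right one_ne_zero
      fin_cases i <;> simp_all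
    · have hxq : x = (-(g 1)⁻¹ * g 0) • (1 : D) := by
        have : g 1 • x = -(g 0 • (1 : D)) := by rw [eq_neg_iff_add_eq_zero, add_comm]; exact hg
        rw [← inv_smul_smul₀ h1 x, this, ← smul_neg, mul_smul]
        simp
      rw [hxq]
      generalize (-(g 1)⁻¹ * g 0) = q
      refine ⟨2 * q, q ^ 2, ?_⟩
      rw [smul_mul_smul_comm, one_mul, smul_smul, ← sub_smul]
      congr 1; ring
  · refine ⟨-(g 2)⁻¹ * g 1, (g 2)⁻¹ * g 0, ?_⟩
    have : g 2 • (x * x) = - (g 1 • x) - g 0 • (1 : D) := by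
      rw [eq_sub_iff_add_eq, eq_neg_iff_add_eq_zero, ← hg]; abel
    rw [← inv_smul_smul₀ h2 (x * x), this, smul_sub, smul_neg, smul_smul, smul_smul, neg_mul, neg_smul]

/-- half the trace of left multiplication -/
noncomputable def tr' : D →ₗ[ℚ] ℚ :=
  (1 / 2 : ℚ) • (LinearMap.trace ℚ D ∘ₗ (Algebra.lmul ℚ D).toLinearMap)

lemma tr'_comm (x y : D) : tr' (x * y) = tr' (y * x) := by
  simp only [tr', LinearMap.smul_apply, LinearMap.comp_apply, AlgHom.toLinearMap_apply, map_mul]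
  rw [LinearMap.trace_mul_comm]

lemma tr'_one (h4 : finrank ℚ D = 4) : tr' (1 : D) = 2 := by
  have : FiniteDimensional ℚ D := FiniteDimensional.of_finrank_pos (by omega)
  simp only [tr', LinearMap.smul_apply, LinearMap.comp_apply, AlgHom.toLinearMap_apply, map_one, LinearMap.trace_one, h4]
  norm_num

lemma exists_rel (h4 : finrank ℚ D = 4)
    (hc : ∀ x : D, (∀ y, x * y = y * x) → ∃ q : ℚ, x = algebraMap ℚ D q) (x : D) :
    ∃ n : ℚ, x * x = tr' x • x - n • (1 : D) := by
  by_cases hx : ∀ y, x * y = y * x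
  · obtain ⟨q, rfl⟩ := hc x hx
    refine ⟨q ^ 2, ?_⟩
    rw [Algebra.algebraMap_eq_smul_one, map_smul, tr'_one h4, smul_mul_smul_comm, one_mul, smul_smul,
      ← sub_smul, smul_eq_mul]
    congr 1; ring
  · push Not at hx
    obtain ⟨w, hw⟩ := hx
    obtain ⟨t, n, h⟩ := quadratic h4 hc x
    refine ⟨n, ?_⟩
    suffices ht : tr' x = t by rw [ht, h]
    set z := x * w - w * x with hz
    have hz0 : z ≠ 0 := sub_ne_zero.2 hw
    have hxz : z * (t • 1 - x) = x * z := by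
      rw [hz]
      simp only [mul_sub, sub_mul, mul_smul_comm, mul_one, ← mul_assoc, h, smul_mul_assoc, one_mul]
      rw [mul_assoc w x x, h, mul_sub, mul_smul_comm, mul_smul_comm, mul_one, smul_sub]
      abel
    have h1 : tr' (t • 1 - x) = tr' x := by
      have : t • 1 - x = z⁻¹ * (x * z) := by rw [← hxz, inv_mul_cancel_left₀ hz0]
      rw [this, tr'_comm, mul_assoc, mul_inv_cancel₀ hz0, mul_one]
    rw [map_sub, map_smul, tr'_one h4, smul_eq_mul] at h1
    linarith

lemma root_rat (hc : ∀ x : D, (∀ y, x * y = y * x) → ∃ q : ℚ, x = algebraMap ℚ D q)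
    {L : Type*} [Field L] [Algebra ℚ L] (hL : ∀ z : L ⊗[ℚ] D, z ≠ 0 → IsUnit z)
    {x : D} {t n : ℚ} (h : x * x = t • x - n • (1 : D)) {r : L}
    (hr : r * r = t • r - n • (1 : L)) : ∃ q : ℚ, x = algebraMap ℚ D q := by
  have key : ∀ s : L, (1 : L) ⊗ₜ[ℚ] x = s ⊗ₜ[ℚ] (1 : D) → ∃ q : ℚ, x = algebraMap ℚ D q := by
    intro s hs
    refine hc x fun y => ?_
    have hinj : Function.Injective (Algebra.TensorProduct.includeRight : D →ₐ[ℚ] L ⊗[ℚ] D) :=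
      Algebra.TensorProduct.includeRight_injective (algebraMap ℚ L).injective
    apply hinj
    rw [map_mul, map_mul, Algebra.TensorProduct.includeRight_apply, hs,
      Algebra.TensorProduct.includeRight_apply]
    simp
  have hprod : ((1 : L) ⊗ₜ[ℚ] x - r ⊗ₜ[ℚ] (1 : D)) * ((1 : L) ⊗ₜ[ℚ] x - (t • 1 - r) ⊗ₜ[ℚ] (1 : D)) = 0 := by
    have e1 : ((1 : L) ⊗ₜ[ℚ] x) * ((1 : L) ⊗ₜ[ℚ] x) = t • ((1 : L) ⊗ₜ[ℚ] x) - n • (1 : L ⊗[ℚ] D) := by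
      rw [Algebra.TensorProduct.tmul_mul_tmul, h, one_mul, TensorProduct.tmul_sub,
        TensorProduct.tmul_smul, TensorProduct.tmul_smul]; rfl
    have e2 : (r ⊗ₜ[ℚ] (1 : D)) * (r ⊗ₜ[ℚ] (1 : D)) = t • (r ⊗ₜ[ℚ] (1 : D)) - n • (1 : L ⊗[ℚ] D) := by
      rw [Algebra.TensorProduct.tmul_mul_tmul, hr, one_mul, TensorProduct.sub_tmul]; rfl
    have e3 : (r ⊗ₜ[ℚ] (1 : D)) * ((1 : L) ⊗ₜ[ℚ] x) = ((1 : L) ⊗ₜ[ℚ] x) * (r ⊗ₜ[ℚ] (1 : D)) := by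
      simp
    have e4 : (t • 1 - r) ⊗ₜ[ℚ] (1 : D) = t • (1 : L ⊗[ℚ] D) - r ⊗ₜ[ℚ] (1 : D) := by
      rw [TensorProduct.sub_tmul]; rfl
    rw [e4, sub_mul, mul_sub, mul_sub, mul_sub, mul_sub, e1, e2, e3, mul_smul_comm, mul_smul_comm, mul_one, mul_one]
    abel
  by_cases h0 : (1 : L) ⊗ₜ[ℚ] x - r ⊗ₜ[ℚ] (1 : D) = 0
  · exact key _ (sub_eq_zero.1 h0)
  · rw [(hL _ h0).mul_right_eq_zero] at hprod
    exact key _ (sub_eq_zero.1 hprod)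

lemma rat_rel (h4 : finrank ℚ D = 4) {q n : ℚ} (h : algebraMap ℚ D q * algebraMap ℚ D q =
    tr' (algebraMap ℚ D q) • algebraMap ℚ D q - n • (1 : D)) : n = q ^ 2 ∧ tr' (algebraMap ℚ D q) = 2 * q := by
  have ht : tr' (algebraMap ℚ D q) = 2 * q := by
    rw [Algebra.algebraMap_eq_smul_one, map_smul, tr'_one h4, smul_eq_mul, mul_comm]
  refine ⟨?_, ht⟩
  rw [ht, Algebra.algebraMap_eq_smul_one, smul_mul_smul_comm, one_mul, smul_smul, ← sub_smul] at h
  have := QD.smul_one_inj h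
  linarith

/-- the quaternion data -/
noncomputable def mkQD (h4 : finrank ℚ D = 4)
    (hc : ∀ x : D, (∀ y, x * y = y * x) → ∃ q : ℚ, x = algebraMap ℚ D q)
    (hR : ∀ z : ℝ ⊗[ℚ] D, z ≠ 0 → IsUnit z) : QD D where
  fin := h4
  central := hc
  trd := tr'
  nrd x := (exists_rel h4 hc x).choose
  trd_one := tr'_one h4
  trd_comm := tr'_comm
  rel x := (exists_rel h4 hc x).choose_spec
  pos x hx := by
    have h := (exists_rel h4 hc x).choose_spec
    generalize (exists_rel h4 hc x).choose = n at h
    by_contra hn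
    push Not at hn
    have hd : (0 : ℝ) ≤ (tr' x : ℝ) ^ 2 - 4 * n := by
      have : (n : ℝ) ≤ 0 := by exact_mod_cast hn
      nlinarith [sq_nonneg (tr' x : ℝ)]
    obtain ⟨q, hq⟩ := root_rat hc hR h (r := ((tr' x : ℝ) + √((tr' x : ℝ) ^ 2 - 4 * n)) / 2) (by
      have := Real.sq_sqrt hd
      simp only [Rat.smul_def, mul_one]
      linear_combination this / 4)
    rw [hq] at h
    have := (rat_rel h4 h).1
    have h0 : q = 0 := by nlinarith [sq_nonneg q]
    rw [h0, map_zero] at hq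
    exact hx hq

lemma hensel_root {p : ℕ} [Fact p.Prime] (t n : ℚ) (h : padicNorm p n < padicNorm p t ^ 2) :
    ∃ r : ℚ_[p], r * r = t • r - n • (1 : ℚ_[p]) := by
  have ht : t ≠ 0 := by
    rintro rfl
    simp at h
    exact absurd h (not_lt.2 (padicNorm.nonneg _))
  have htp : 0 < padicNorm p t ^ 2 := by
    have := padicNorm.nonzero (p := p) ht
    positivity
  have hc : ‖((n / t ^ 2 : ℚ) : ℚ_[p])‖ < 1 := by
    rw [Padic.eq_padicNorm, padicNorm.div, pow_two, padicNorm.mul, ← pow_two]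
    have : padicNorm p n / padicNorm p t ^ 2 < 1 := by rwa [div_lt_one htp]
    exact_mod_cast this
  let c : ℤ_[p] := ⟨((n / t ^ 2 : ℚ) : ℚ_[p]), hc.le⟩
  obtain ⟨z, hz, -⟩ := hensels_lemma (F := (Polynomial.X ^ 2 - Polynomial.X + Polynomial.C c : Polynomial ℤ_[p]))
    (a := (0 : ℤ_[p])) (by
      have hc' : ‖c‖ < 1 := hc
      simpa [Polynomial.eval_C] using hc')
  refine ⟨t * (z : ℚ_[p]), ?_⟩
  have hz' : (z : ℚ_[p]) ^ 2 - z + ((n / t ^ 2 : ℚ) : ℚ_[p]) = 0 := by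
    have := congrArg (fun y : ℤ_[p] => (y : ℚ_[p])) hz
    simp only [map_add, map_sub, map_pow, Polynomial.aeval_X, Polynomial.aeval_C, Algebra.algebraMap_self,
      RingHom.id_apply, PadicInt.coe_add, PadicInt.coe_sub, PadicInt.coe_pow, PadicInt.coe_zero] at this
    exact this
  have ht' : (t : ℚ_[p]) ≠ 0 := by exact_mod_cast ht
  simp only [Rat.smul_def, mul_one]
  push_cast at hz'
  field_simp at hz'
  linear_combination hz'

lemma ram_of {p : ℕ} [Fact p.Prime] (Q : QD D)
    (hL : ∀ z : ℚ_[p] ⊗[ℚ] D, z ≠ 0 → IsUnit z) (x : D) :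
    padicNorm p (Q.trd x) ^ 2 ≤ padicNorm p (Q.nrd x) := by
  by_contra h
  push Not at h
  obtain ⟨r, hr⟩ := hensel_root _ _ h
  obtain ⟨q, hq⟩ := root_rat Q.central hL (Q.rel x) hr
  rw [Algebra.algebraMap_eq_smul_one] at hq
  rw [hq, Q.trd_smul_one, Q.nrd_smul, Q.nrd_one, mul_one, padicNorm.mul, pow_two q, padicNorm.mul] at h
  have h2 : padicNorm p 2 ≤ 1 := by exact_mod_cast padicNorm.of_nat (p := p) 2
  have h0 := padicNorm.nonneg (p := p) 2
  have h1 := mul_self_nonneg (padicNorm p q)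
  nlinarith [mul_nonneg h1 (by nlinarith : 0 ≤ 1 - padicNorm p 2 ^ 2)]

lemma split_trace (Q : QD D) {L : Type*} [Field L] [CharZero L] (φ : D →+* Matrix (Fin 2) (Fin 2) L) (x : D) :
    (φ x).trace = (Q.trd x : L) ∧ (φ x).det = (Q.nrd x : L) := by
  have hsc : ∀ q : ℚ, φ (q • (1 : D)) = (q : L) • (1 : Matrix (Fin 2) (Fin 2) L) := by
    intro q
    have h1 : φ (q • (1 : D)) = q • φ 1 := map_rat_smul φ q 1
    rw [h1, map_one]
    ext i j; fin_cases i <;> fin_cases j <;> simp [Rat.smul_def]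
  by_cases hs : ∃ s : L, φ x = s • (1 : Matrix (Fin 2) (Fin 2) L)
  · obtain ⟨s, hs⟩ := hs
    obtain ⟨q, hq⟩ := Q.central x fun y => φ.injective (by rw [map_mul, map_mul, hs]; simp)
    rw [Algebra.algebraMap_eq_smul_one] at hq
    rw [hq, hsc, Q.trd_smul_one, Q.nrd_smul, Q.nrd_one]
    constructor
    · simp [mul_comm]
    · simp
  · have h1 := congrArg φ (Q.rel x)
    have h2 : Q.trd x • x = (Q.trd x • (1 : D)) * x := by rw [smul_mul_assoc, one_mul]
    rw [map_mul, map_sub, hsc, h2, map_mul, hsc] at h1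
    generalize φ x = M at h1 hs
    have e00 := congrFun (congrFun h1 0) 0
    have e01 := congrFun (congrFun h1 0) 1
    have e10 := congrFun (congrFun h1 1) 0
    have e11 := congrFun (congrFun h1 1) 1
    simp [Matrix.mul_apply, Fin.sum_univ_two] at e00 e01 e10 e11
    have htr : M 0 0 + M 1 1 = (Q.trd x : L) := by
      by_contra hne
      have hne' := sub_ne_zero.2 hne
      have z01 : M 0 1 = 0 := by
        apply mul_left_cancel₀ hne'; linear_combination e01
      have z10 : M 1 0 = 0 := by
        apply mul_left_cancel₀ hne'; linear_combination e10
      have z : M 0 0 = M 1 1 := by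
        apply mul_left_cancel₀ hne'; linear_combination e00 - e11
      refine hs ⟨M 0 0, ?_⟩
      ext i j; fin_cases i <;> fin_cases j <;> simp [z01, z10, z]
    refine ⟨by rw [Matrix.trace_fin_two, htr], ?_⟩
    rw [Matrix.det_fin_two]
    linear_combination (M 0 0) * htr - e00

lemma split_mod (Q : QD D) {L : Type*} [Field L] [CharZero L] [Algebra ℚ L] {V : Type*} [AddCommGroup V]
    [Module L V] [Module (L ⊗[ℚ] D) V] [IsScalarTower L (L ⊗[ℚ] D) V] [FiniteDimensional L V]
    (h0 : 0 < finrank L V) (h2 : finrank L V ≤ 2) : Nonempty (D →+* Matrix (Fin 2) (Fin 2) L) := by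
  have hψ : Nonempty (D →+* Module.End L V) :=
    ⟨(Algebra.lsmul L L V : (L ⊗[ℚ] D) →ₐ[L] Module.End L V).toRingHom.comp
      (Algebra.TensorProduct.includeRight : D →ₐ[ℚ] L ⊗[ℚ] D).toRingHom⟩
  obtain ⟨ψ⟩ := hψ
  have : finrank L V = 1 ∨ finrank L V = 2 := by omega
  rcases this with h | h
  · exfalso
    let φ : D →+* Matrix (Fin 1) (Fin 1) L :=
      (LinearMap.toMatrixAlgEquiv (finBasisOfFinrankEq L V h)).toRingEquiv.toRingHom.comp ψ
    have hcomm : ∀ x y : D, x * y = y * x := fun x y => φ.injective (by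
      rw [map_mul, map_mul]
      ext i j; fin_cases i; fin_cases j; simp [Matrix.mul_apply, mul_comm])
    have := finrank_le_one (R := ℚ) (1 : D) fun w => by
      obtain ⟨q, hq⟩ := Q.central w (hcomm w)
      exact ⟨q, by rw [hq, Algebra.algebraMap_eq_smul_one]⟩
    have := Q.fin
    omega
  · exact ⟨(LinearMap.toMatrixAlgEquiv (finBasisOfFinrankEq L V h)).toRingEquiv.toRingHom.comp ψ⟩

lemma split_of (Q : QD D) {L : Type*} [Field L] [CharZero L] [Algebra ℚ L]
    (hL : ¬ ∀ z : L ⊗[ℚ] D, z ≠ 0 → IsUnit z) : Nonempty (D →+* Matrix (Fin 2) (Fin 2) L) := by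
  push Not at hL
  obtain ⟨x, hx0, hx⟩ := hL
  have hfd : FiniteDimensional ℚ D := FiniteDimensional.of_finrank_pos (by rw [Q.fin]; norm_num)
  have h4 : finrank L (L ⊗[ℚ] D) = 4 := by rw [finrank_baseChange, Q.fin]
  let f : (L ⊗[ℚ] D) →ₗ[L ⊗[ℚ] D] (L ⊗[ℚ] D) := LinearMap.toSpanSingleton _ _ x
  have hf : ∀ z, f z = z * x := fun z => rfl
  have hrn := LinearMap.finrank_range_add_finrank_ker (f.restrictScalars L)
  rw [h4] at hrn
  have hr0 : 0 < finrank L (LinearMap.range (f.restrictScalars L)) := by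
    rw [finrank_pos_iff_exists_ne_zero]
    exact ⟨⟨x, 1, by simp [hf]⟩, fun h => hx0 (congrArg Subtype.val h)⟩
  have hk0 : 0 < finrank L (LinearMap.ker (f.restrictScalars L)) := by
    rw [Nat.pos_iff_ne_zero]
    intro h
    have hker := Submodule.finrank_eq_zero.1 h
    have hsurj : Function.Surjective (f.restrictScalars L) :=
      LinearMap.injective_iff_surjective.1 (LinearMap.ker_eq_bot.1 hker)
    obtain ⟨y, hy⟩ := hsurj 1
    have hy : y * x = 1 := hy
    refine hx ⟨⟨x, y, ?_, hy⟩, rfl⟩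
    have hinj := LinearMap.ker_eq_bot.1 hker
    apply hinj
    change x * y * x = 1 * x
    rw [mul_assoc, hy, mul_one, one_mul]
  by_cases h : finrank L (LinearMap.range (f.restrictScalars L)) ≤ 2
  · have e : finrank L (LinearMap.range f) = finrank L (LinearMap.range (f.restrictScalars L)) := rfl
    have : FiniteDimensional L (LinearMap.range f) := FiniteDimensional.of_finrank_pos (by rw [e]; exact hr0)
    exact split_mod Q (V := LinearMap.range f) (by rw [e]; exact hr0) (by rw [e]; exact h)
  · have e : finrank L (LinearMap.ker f) = finrank L (LinearMap.ker (f.restrictScalars L)) := rfl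
    have : FiniteDimensional L (LinearMap.ker f) := FiniteDimensional.of_finrank_pos (by rw [e]; exact hk0)
    exact split_mod Q (V := LinearMap.ker f) (by rw [e]; exact hk0) (by rw [e]; omega)

end
end Eich

namespace Eich
open Module

section
set_option linter.unusedSectionVars false
variable {D : Type*} [DivisionRing D] [CharZero D]

lemma isLat_iff {I : AddSubgroup D} : IsLat I ↔ Fg I ∧ Submodule.span ℚ (I : Set D) = ⊤ := by
  refine and_congr_right fun _ => ⟨fun h => ?_, fun h x => ?_⟩
  · rw [eq_top_iff]
    intro x _
    obtain ⟨m, hm, hx⟩ := h x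
    have hm' : (m : ℚ) ≠ 0 := by exact_mod_cast hm.ne'
    have : x = (m : ℚ)⁻¹ • (m • x) := by
      rw [← Nat.cast_smul_eq_nsmul ℚ, inv_smul_smul₀ hm']
    rw [this]
    exact Submodule.smul_mem _ _ (Submodule.subset_span hx)
  · have hx : x ∈ Submodule.span ℚ (I : Set D) := by rw [h]; trivial
    induction hx using Submodule.span_induction with
    | mem x hx => exact ⟨1, one_pos, by simpa using hx⟩
    | zero => exact ⟨1, one_pos, by simp⟩
    | add x y _ _ h1 h2 =>
      obtain ⟨m, hm, h1⟩ := h1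
      obtain ⟨n, hn, h2⟩ := h2
      refine ⟨m * n, Nat.mul_pos hm hn, ?_⟩
      rw [smul_add, mul_smul, mul_smul, smul_comm]
      exact I.add_mem (I.nsmul_mem h1 _) (I.nsmul_mem h2 _)
    | smul q x _ h =>
      obtain ⟨m, hm, h⟩ := h
      refine ⟨q.den * m, Nat.mul_pos q.den_pos hm, ?_⟩
      have : (q.den * m) • (q • x) = q.num • (m • x) := by
        rw [← Nat.cast_smul_eq_nsmul ℚ, ← Int.cast_smul_eq_zsmul ℚ, ← Nat.cast_smul_eq_nsmul ℚ m, smul_smul, smul_smul]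
        congr 1
        push_cast
        rw [← Rat.den_mul_eq_num]; ring
      rw [this]
      exact I.zsmul_mem h _

lemma fg_sub {Λ : Subalgebra ℤ D} : Fg Λ.toSubring.toAddSubgroup ↔ Module.Finite ℤ Λ := by
  have h1 : AddSubgroup.toIntSubmodule Λ.toSubring.toAddSubgroup = Subalgebra.toSubmodule Λ := by
    ext; rfl
  rw [Fg, h1, ← Module.Finite.iff_fg]; rfl

variable [FiniteDimensional ℚ D]

lemma order_iff {Λ : Subalgebra ℤ D} : IsROrder ℤ ℚ D Λ ↔ IsLat Λ.toSubring.toAddSubgroup := by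
  rw [isLat_iff, fg_sub]; rfl

lemma mkSetup {p : ℕ} (hp : p.Prime) (hA : IsQuaternionRamifiedExactlyAtPAndInfty p D)
    (Λ : Subalgebra ℤ D) (hΛ : IsROrder ℤ ℚ D Λ)
    (hmax : ∀ Λ' : Subalgebra ℤ D, IsROrder ℤ ℚ D Λ' → Λ ≤ Λ' → Λ' = Λ) :
    ∃ Q : QD D, Setup p Q Λ.toSubring := by
  obtain ⟨h4, hcen, -, hR, hP, hS⟩ := hA
  have hc : ∀ x : D, (∀ y, x * y = y * x) → ∃ q : ℚ, x = algebraMap ℚ D q := by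
    intro x hx
    obtain ⟨q, hq⟩ := hcen.out (Subalgebra.mem_center_iff.2 fun y => (hx y).symm)
    exact ⟨q, hq.symm⟩
  refine ⟨mkQD h4 hc hR.2, hp, order_iff.1 hΛ, fun Λ' hfg hle => ?_, ?_, ?_⟩
  · let Λ'' : Subalgebra ℤ D := subalgebraOfSubring Λ'
    have e : Λ''.toSubring = Λ' := by ext; rfl
    have := hmax Λ'' (order_iff.2 ⟨by rw [e]; exact hfg, fun x => ?_⟩) hle
    · rw [← e, this]
    · obtain ⟨m, hm, h⟩ := (order_iff.1 hΛ).2 x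
      exact ⟨m, hm, hle h⟩
  · intro x _
    exact ram_of _ (hP hp).2 x
  · intro ℓ hl hne
    obtain ⟨φ⟩ := split_of (mkQD h4 hc hR.2) (L := ℚ_[ℓ]) fun h => hS ℓ hl.out hne ⟨by
      have : Nontrivial (ℝ ⊗[ℚ] D) := hR.1
      infer_instance, h⟩
    exact ⟨φ, split_trace _ φ⟩

section
variable (v : HeightOneSpectrum ℤ)

lemma exists_prime : ∃ ℓ : ℕ, ℓ.Prime ∧ ∀ m : ℕ, ¬ ℓ ∣ m → (m : ℤ) ∉ v.asIdeal := by
  have hg := Submodule.IsPrincipal.prime_generator_of_isPrime v.asIdeal v.ne_bot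
  refine ⟨_, Int.prime_iff_natAbs_prime.1 hg, fun m hm h => hm ?_⟩
  rw [Submodule.IsPrincipal.mem_iff_generator_dvd] at h
  have := Int.natAbs_dvd_natAbs.2 h
  simpa using this

lemma div_mem {m : ℕ} (hm : (m : ℤ) ∉ v.asIdeal) {c : v.adicCompletion ℚ}
    (hc : c ∈ v.adicCompletionIntegers ℚ) : ((m : ℚ)⁻¹ : ℚ) • c ∈ v.adicCompletionIntegers ℚ := by
  rw [HeightOneSpectrum.mem_adicCompletionIntegers] at hc ⊢
  rw [Algebra.smul_def, map_mul]
  have h1 : Valued.v (algebraMap ℚ (v.adicCompletion ℚ) (m : ℚ)⁻¹) = 1 := by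
    have h2 : v.valuation ℚ ((m : ℚ)⁻¹) = 1 := by
      rw [map_inv₀, inv_eq_one, ← v.valuation_eq_one_iff_notMem (K := ℚ)] at *
      simpa using hm
    rw [← h2]
    exact v.valuedAdicCompletion_eq_valuation' (K := ℚ) _
  rw [h1, one_mul]; exact hc

lemma lat_mul_order {I : Submodule ℤ D} {Λ : Subalgebra ℤ D} (hI : ∀ x ∈ I, ∀ a ∈ Λ, x * a ∈ I)
    {y : PlaceAlgebra ℤ ℚ D v} (hy : y ∈ orderAt ℤ ℚ D Λ v) :
    ∀ z ∈ latticeAt ℤ ℚ D I v, z * y ∈ latticeAt ℤ ℚ D I v := by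
  have key : ∀ y : PlaceAlgebra ℤ ℚ D v, (∀ c ∈ v.adicCompletionIntegers ℚ, ∀ x ∈ I,
      PlaceAlgebra.of ℤ ℚ D v (c ⊗ₜ[ℚ] x) * y ∈ latticeAt ℤ ℚ D I v) →
      ∀ z ∈ latticeAt ℤ ℚ D I v, z * y ∈ latticeAt ℤ ℚ D I v := by
    intro y hy z hz
    induction hz using AddSubgroup.closure_induction with
    | mem z hz => obtain ⟨c, hc, x, hx, rfl⟩ := hz; exact hy c hc x hx
    | zero => rw [zero_mul]; exact zero_mem _
    | add a b _ _ h1 h2 => rw [add_mul]; exact add_mem h1 h2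
    | neg a _ h => rw [neg_mul]; exact neg_mem h
  induction hy using Subring.closure_induction with
  | mem y hy =>
    apply key
    intro c hc x hx
    rcases hy with ⟨d, hd, rfl⟩ | ⟨a, ha, rfl⟩
    · refine AddSubgroup.subset_closure ⟨c * d, mul_mem hc hd, x, hx, ?_⟩
      change (c ⊗ₜ[ℚ] x) * (d ⊗ₜ[ℚ] (1 : D)) = (c * d) ⊗ₜ[ℚ] x
      rw [Algebra.TensorProduct.tmul_mul_tmul, mul_one]
    · refine AddSubgroup.subset_closure ⟨c, hc, x * a, hI x hx a ha, ?_⟩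
      change (c ⊗ₜ[ℚ] x) * ((1 : v.adicCompletion ℚ) ⊗ₜ[ℚ] a) = c ⊗ₜ[ℚ] (x * a)
      rw [Algebra.TensorProduct.tmul_mul_tmul, mul_one]
  | zero => intro z _; rw [mul_zero]; exact zero_mem _
  | one => intro z hz; rwa [mul_one]
  | add a b _ _ h1 h2 => intro z hz; rw [mul_add]; exact add_mem (h1 z hz) (h2 z hz)
  | neg a _ h => intro z hz; rw [mul_neg]; exact neg_mem (h z hz)
  | mul a b _ _ h1 h2 => intro z hz; rw [← mul_assoc]; exact h2 _ (h1 z hz)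

lemma lat_eq {I : Submodule ℤ D} {Λ : Subalgebra ℤ D} (hI : ∀ x ∈ I, ∀ a ∈ Λ, x * a ∈ I)
    {u : D} (hu : u ∈ I) (hu0 : u ≠ 0) {m : ℕ} (hm : (m : ℤ) ∉ v.asIdeal)
    (h : ∀ x ∈ I, ∃ a ∈ Λ, u * a = m • x) : ∃ w : (PlaceAlgebra ℤ ℚ D v)ˣ,
      (latticeAt ℤ ℚ D I v : Set (PlaceAlgebra ℤ ℚ D v)) =
        (fun y : PlaceAlgebra ℤ ℚ D v => w.val * y) ''
          (orderAt ℤ ℚ D Λ v : Set (PlaceAlgebra ℤ ℚ D v)) := by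
  let f : D →+* PlaceAlgebra ℤ ℚ D v :=
    (Algebra.TensorProduct.includeRight : D →ₐ[ℚ] v.adicCompletion ℚ ⊗[ℚ] D).toRingHom
  let w : (PlaceAlgebra ℤ ℚ D v)ˣ := Units.map f.toMonoidHom (Units.mk0 u hu0)
  have hw : w.val = PlaceAlgebra.of ℤ ℚ D v ((1 : v.adicCompletion ℚ) ⊗ₜ[ℚ] u) := rfl
  have hm0 : (m : ℚ) ≠ 0 := by
    intro h0
    have : m = 0 := by exact_mod_cast h0
    exact hm (by rw [this]; simp)
  refine ⟨w, Set.Subset.antisymm (fun z hz => ?_) ?_⟩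
  · change z ∈ latticeAt ℤ ℚ D I v at hz
    change z ∈ (orderAt ℤ ℚ D Λ v).toAddSubgroup.map (AddMonoidHom.mulLeft w.val)
    revert z
    change latticeAt ℤ ℚ D I v ≤ _
    rw [latticeAt, AddSubgroup.closure_le]
    rintro _ ⟨c, hc, x, hx, rfl⟩
    obtain ⟨a, ha, hax⟩ := h x hx
    refine ⟨PlaceAlgebra.of ℤ ℚ D v ((((m : ℚ)⁻¹ : ℚ) • c) ⊗ₜ[ℚ] (1 : D)) *
      PlaceAlgebra.of ℤ ℚ D v ((1 : v.adicCompletion ℚ) ⊗ₜ[ℚ] a), ?_, ?_⟩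
    · exact (orderAt ℤ ℚ D Λ v).mul_mem (Subring.subset_closure (Or.inl ⟨_, div_mem v hm hc, rfl⟩))
        (Subring.subset_closure (Or.inr ⟨a, ha, rfl⟩))
    · change ((1 : v.adicCompletion ℚ) ⊗ₜ[ℚ] u) * (((((m : ℚ)⁻¹ : ℚ) • c) ⊗ₜ[ℚ] (1 : D)) *
        ((1 : v.adicCompletion ℚ) ⊗ₜ[ℚ] a)) = c ⊗ₜ[ℚ] x
      rw [Algebra.TensorProduct.tmul_mul_tmul, Algebra.TensorProduct.tmul_mul_tmul, one_mul, one_mul, mul_one,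
        hax, TensorProduct.smul_tmul, ← Nat.cast_smul_eq_nsmul ℚ, inv_smul_smul₀ hm0]
  · rintro _ ⟨y, hy, rfl⟩
    refine lat_mul_order v hI hy _ (AddSubgroup.subset_closure ⟨1, one_mem _, u, hu, hw⟩)

end

lemma rt_of {Λ : Subalgebra ℤ D} (I : LocallyFreeIdeal ℤ ℚ D Λ) :
    IsRt Λ.toSubring I.carrier.toAddSubgroup :=
  ⟨isLat_iff.2 ⟨I.fg, I.spans⟩, I.right_mul⟩

lemma exists_ideal {p : ℕ} {Q : QD D} {Λ : Subalgebra ℤ D} (S : Setup p Q Λ.toSubring)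
    {I : AddSubgroup D} (hI : IsRt Λ.toSubring I) :
    ∃ J : LocallyFreeIdeal ℤ ℚ D Λ, J.carrier.toAddSubgroup = I := by
  refine ⟨⟨AddSubgroup.toIntSubmodule I, hI.1.1, (isLat_iff.1 hI.1).2, hI.2, fun v => ?_⟩, rfl⟩
  obtain ⟨ℓ, hl, hv⟩ := exists_prime v
  have : Fact ℓ.Prime := ⟨hl⟩
  obtain ⟨u, hu, hu0, m, hm, h⟩ := S.loc_principal (ℓ := ℓ) hI
  exact lat_eq v hI.2 hu hu0 (hv m hm) h

lemma mem_sumLat {I : Submodule ℤ D} {z : Fin 1 → D} : z ∈ sumLat ![I] ↔ z 0 ∈ I := by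
  simp [sumLat, AddSubgroup.mem_pi]

lemma iso_iff {Λ : Subalgebra ℤ D} (hΛ : IsLat Λ.toSubring.toAddSubgroup) (I J : LocallyFreeIdeal ℤ ℚ D Λ) :
    IdealIso Λ I J ↔ Eqv I.carrier.toAddSubgroup J.carrier.toAddSubgroup := by
  constructor
  · rintro ⟨e, he⟩
    obtain ⟨x0, hx0, hne⟩ := QD.exists_ne (rt_of I).1
    have hmk : ∀ x ∈ I.carrier, (fun _ => x : Fin 1 → D) ∈ sumLat ![I.carrier] := fun x hx => mem_sumLat.2 hx
    let y := (e ⟨_, hmk x0 hx0⟩).val 0 * x0⁻¹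
    have hy : ∀ z : sumLat ![I.carrier], (e z).val 0 = y * z.val 0 := by
      intro z
      obtain ⟨m, hm, ha⟩ := hΛ.2 (x0⁻¹ * z.val 0)
      have h0 : z.val 0 ∈ I.carrier := mem_sumLat.1 z.2
      have hx : x0 * (m • (x0⁻¹ * z.val 0)) = m • z.val 0 := by
        rw [mul_smul_comm, mul_inv_cancel_left₀ hne]
      have h1 := he ⟨_, hmk x0 hx0⟩ _ ha (mem_sumLat.2 (by
        change x0 * _ ∈ _
        rw [hx]; exact nsmul_mem h0 m))
      have h2 : (⟨fun i => x0 * (m • (x0⁻¹ * z.val 0)), mem_sumLat.2 (by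
        rw [hx]; exact nsmul_mem h0 m)⟩ : sumLat ![I.carrier]) = m • z := by
        apply Subtype.ext
        funext i
        rw [Subsingleton.elim i 0]
        exact hx
      have h3 := congrFun h1 0
      have h4 : (m • e z).val 0 = (e ⟨_, hmk x0 hx0⟩).val 0 * (m • (x0⁻¹ * z.val 0)) := by
        rw [← h3, ← map_nsmul, ← h2]
      have h5 : m • (e z).val 0 = m • (y * z.val 0) := by
        refine Eq.trans h4 ?_
        rw [mul_smul_comm, mul_assoc]
      exact smul_right_injective D hm.ne' h5
    have hy0 : y ≠ 0 := by
      intro h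
      have h1 : e ⟨_, hmk x0 hx0⟩ = 0 := by
        apply Subtype.ext
        funext i
        rw [Subsingleton.elim i 0, hy, h, zero_mul]; rfl
      have h2 := e.map_eq_zero_iff.1 h1
      exact hne (congrFun (congrArg Subtype.val h2) 0)
    refine Eqv.symm ⟨y, hy0, ?_⟩
    ext z
    rw [mem_lm]
    constructor
    · rintro ⟨x, hx, rfl⟩
      have := hy ⟨_, hmk x hx⟩
      simp only at this
      rw [← this]
      exact mem_sumLat.1 (e _).2
    · intro hz
      obtain ⟨x, hx⟩ := e.surjective ⟨fun _ => z, mem_sumLat.2 hz⟩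
      refine ⟨x.val 0, mem_sumLat.1 x.2, ?_⟩
      rw [← hy, hx]
  · intro h
    obtain ⟨y, hy0, hy⟩ := h.symm
    have hmem : ∀ x ∈ I.carrier, y * x ∈ J.carrier := fun x hx => by
      change _ ∈ J.carrier.toAddSubgroup
      rw [← hy]; exact ⟨x, hx, rfl⟩
    have hmem' : ∀ x ∈ J.carrier, y⁻¹ * x ∈ I.carrier := fun x hx => by
      change x ∈ J.carrier.toAddSubgroup at hx
      rwa [← hy, mem_lm' hy0] at hx
    refine ⟨
      { toFun := fun z => ⟨fun i => y * z.val i, mem_sumLat.2 (hmem _ (mem_sumLat.1 z.2))⟩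
        invFun := fun z => ⟨fun i => y⁻¹ * z.val i, mem_sumLat.2 (hmem' _ (mem_sumLat.1 z.2))⟩
        left_inv := fun z => Subtype.ext (funext fun i => inv_mul_cancel_left₀ hy0 _)
        right_inv := fun z => Subtype.ext (funext fun i => mul_inv_cancel_left₀ hy0 _)
        map_add' := fun z w => Subtype.ext (funext fun i => mul_add _ _ _) }, ?_⟩
    intro z a _ _
    funext i
    exact (mul_assoc _ _ _).symm

lemma card_eq {p : ℕ} {Q : QD D} {Λ : Subalgebra ℤ D} (S : Setup p Q Λ.toSubring) :
    Nat.card (Quot (IdealIso (R := ℤ) (K := ℚ) (A := D) Λ)) =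
      Nat.card (Quotient (Setup.cls Λ.toSubring)) := by
  refine Nat.card_eq_of_bijective (Quot.lift (fun I => Quotient.mk (Setup.cls Λ.toSubring)
    ⟨I.carrier.toAddSubgroup, rt_of I⟩) fun I J h => Quotient.sound ((iso_iff S.lat I J).1 h)) ⟨?_, ?_⟩
  · rintro ⟨I⟩ ⟨J⟩ h
    exact Quot.sound ((iso_iff S.lat I J).2 (Quotient.exact h))
  · rintro ⟨⟨I, hI⟩⟩
    obtain ⟨J, rfl⟩ := exists_ideal S hI
    exact ⟨Quot.mk _ J, rfl⟩

end

lemma kron3 (p : ℕ) (hp : p.Prime) {A : ℕ} (hA : A ≤ 2) (h : (A + p) % 3 = 1) :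
    (A : ℤ) = 1 - kroneckerSymbol (-3) p hp := by
  unfold kroneckerSymbol
  split_ifs with h2 h3 h5
  · norm_num at h3
  · norm_num at h5
  · omega
  · have : Fact p.Prime := ⟨hp⟩
    have f3 : Fact (Nat.Prime 3) := ⟨Nat.prime_three⟩
    by_cases h3 : p = 3
    · subst h3
      have e : legendreSym 3 (-3) = 0 := by norm_num
      rw [e]
      omega
    · have e : legendreSym p (-3) = legendreSym 3 p := by
        rw [show (-3 : ℤ) = -1 * (3 : ℕ) by norm_num, legendreSym.mul, legendreSym.at_neg_one h2,
          ZMod.χ₄_eq_neg_one_pow (hp.eq_two_or_odd.resolve_left h2),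
          legendreSym.quadratic_reciprocity' (by norm_num) h2, ← mul_assoc, ← pow_add]
        rw [show p / 2 + 3 / 2 * (p / 2) = 2 * (p / 2) by omega, pow_mul]
        simp
      have hp3 : p % 3 ≠ 0 := fun h0 => by
        rcases (Nat.dvd_prime hp).1 (Nat.dvd_of_mod_eq_zero h0) with h1 | h1 <;> omega
      rw [e, legendreSym.mod]
      have : (p : ℤ) % (3 : ℕ) = 1 ∨ (p : ℤ) % (3 : ℕ) = 2 := by omega
      rcases this with h1 | h1
      · have e1 : legendreSym 3 1 = 1 := by norm_num
        rw [h1, e1]; omega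
      · have e1 : legendreSym 3 2 = -1 := by norm_num
        rw [h1, e1]; omega

lemma kron4 (p : ℕ) (hp : p.Prime) {B : ℕ} (hB : B ≤ 2) (h : (B + 1) % 4 = p % 4) :
    (B : ℤ) = 1 - kroneckerSymbol (-4) p hp := by
  unfold kroneckerSymbol
  split_ifs with h2 h3 h5
  · omega
  · norm_num at h3
  · norm_num at h3
  · have : Fact p.Prime := ⟨hp⟩
    have hodd := hp.eq_two_or_odd.resolve_left h2
    have e : legendreSym p (-4) = ZMod.χ₄ p := by
      rw [show (-4 : ℤ) = -1 * 2 ^ 2 by norm_num, legendreSym.mul, legendreSym.at_neg_one h2,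
        legendreSym.sq_one', mul_one]
      intro h0
      have : ((2 : ℕ) : ZMod p) = 0 := by exact_mod_cast h0
      rw [ZMod.natCast_eq_zero_iff] at this
      exact h2 ((Nat.prime_dvd_prime_iff_eq hp Nat.prime_two).1 this)
    rw [e]
    have : p % 4 = 1 ∨ p % 4 = 3 := by omega
    rcases this with h1 | h1
    · rw [ZMod.χ₄_nat_one_mod_four h1]; omega
    · rw [ZMod.χ₄_nat_three_mod_four h1]; omega

lemma final_arith (p : ℕ) (hp : p.Prime) {h A B : ℕ} (hA : A ≤ 2) (hB : B ≤ 2)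
    (e : 12 * h + 1 = p + 3 * B + 4 * A) :
    ((h : ℚ) = ((p : ℚ) - 1) / 12 + (1 - (kroneckerSymbol (-3) p hp : ℚ)) / 3 +
          (1 - (kroneckerSymbol (-4) p hp : ℚ)) / 4) ∧ (h = 1 ↔ p ∈ ({2, 3, 5, 7, 13} : Set ℕ)) := by
  have h3 := kron3 p hp hA (by omega)
  have h4 := kron4 p hp hB (by omega)
  constructor
  · have h3' : (A : ℚ) = 1 - kroneckerSymbol (-3) p hp := by exact_mod_cast h3
    have h4' : (B : ℚ) = 1 - kroneckerSymbol (-4) p hp := by exact_mod_cast h4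
    have e' : 12 * (h : ℚ) + 1 = p + 3 * B + 4 * A := by exact_mod_cast e
    rw [← h3', ← h4']
    linarith
  · simp only [Set.mem_insert_iff, Set.mem_singleton_iff]
    constructor
    · rintro rfl
      have hp13 : p ≤ 13 := by omega
      have := hp.two_le
      interval_cases p <;> first | omega | (exfalso; revert hp; norm_num)
    · rintro (rfl | rfl | rfl | rfl | rfl) <;> omega

theorem main_thm {D : Type*} [DivisionRing D] [CharZero D] [i1 : Algebra ℚ D] [i2 : FiniteDimensional ℚ D]
    [i3 : Algebra ℤ D] [i4 : IsScalarTower ℤ ℚ D]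
    (p : ℕ) (hp : p.Prime) (hA : IsQuaternionRamifiedExactlyAtPAndInfty p D)
    (Λ : Subalgebra ℤ D) (hΛ : IsROrder ℤ ℚ D Λ)
    (hmax : ∀ Λ' : Subalgebra ℤ D, IsROrder ℤ ℚ D Λ' → Λ ≤ Λ' → Λ' = Λ) :
    ((Nat.card (Quot (IdealIso (R := ℤ) (K := ℚ) (A := D) Λ)) : ℚ) =
        ((p : ℚ) - 1) / 12 + (1 - (kroneckerSymbol (-3) p hp : ℚ)) / 3 +
          (1 - (kroneckerSymbol (-4) p hp : ℚ)) / 4) ∧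
      (Nat.card (Quot (IdealIso (R := ℤ) (K := ℚ) (A := D) Λ)) = 1 ↔
        p ∈ ({2, 3, 5, 7, 13} : Set ℕ)) := by
  obtain rfl : i1 = DivisionRing.toRatAlgebra := Subsingleton.elim _ _
  obtain rfl : i3 = Ring.toIntAlgebra D := Subsingleton.elim _ _
  obtain ⟨Q, S⟩ := mkSetup hp hA Λ hΛ hmax
  obtain ⟨A, B, h1, h2, h⟩ := S.class_number
  rw [← card_eq S] at h
  exact final_arith p hp h1 h2 h

end Eich

/-- **Eichler's class number formula for `B_{p,∞}`.**
Let `p` be a prime and `Λ(p)` a maximal `ℤ`-order in the quaternion `ℚ`-algebra `B_{p,∞}`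
ramified exactly at `p` and `∞`.  Then the class number `h(Λ(p))` — the number of
isomorphism classes of locally free right `Λ(p)`-ideals — equals
`(p−1)/12 + (1/3)(1 − (−3/p)) + (1/4)(1 − (−4/p))`, where `(·/p)` is the Legendre/Kronecker
symbol.  In particular `h(Λ(p)) = 1` if and only if `p ∈ {2, 3, 5, 7, 13}`. -/
theorem eichler_class_number_formula_for_quaternion_maximal_order
    (p : ℕ) (hp : p.Prime) (hA : IsQuaternionRamifiedExactlyAtPAndInfty p A)
    (Λ : Subalgebra ℤ A) (hΛ : IsROrder ℤ ℚ A Λ)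
    (hmax : ∀ Λ' : Subalgebra ℤ A, IsROrder ℤ ℚ A Λ' → Λ ≤ Λ' → Λ' = Λ) :
    ((Nat.card (Quot (IdealIso (R := ℤ) (K := ℚ) (A := A) Λ)) : ℚ) =
        ((p : ℚ) - 1) / 12 + (1 - (kroneckerSymbol (-3) p hp : ℚ)) / 3 +
          (1 - (kroneckerSymbol (-4) p hp : ℚ)) / 4) ∧
      (Nat.card (Quot (IdealIso (R := ℤ) (K := ℚ) (A := A) Λ)) = 1 ↔
        p ∈ ({2, 3, 5, 7, 13} : Set ℕ)) := by
  have hnt : Nontrivial A := by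
    by_contra h
    rw [not_nontrivial_iff_subsingleton] at h
    have := hA.1
    rw [Module.finrank_zero_of_subsingleton] at this
    omega
  have hdiv : ∀ x : A, IsUnit x ∨ x = 0 := by
    intro x
    by_cases hx : x = 0
    · exact Or.inr hx
    left
    have hinj : Function.Injective (Algebra.TensorProduct.includeRight : A →ₐ[ℚ] ℝ ⊗[ℚ] A) :=
      Algebra.TensorProduct.includeRight_injective (algebraMap ℚ ℝ).injective
    have hu := hA.2.2.2.1.2 ((1 : ℝ) ⊗ₜ[ℚ] x) fun h => hx (hinj (by rw [map_zero]; exact h))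
    have hli : Function.Injective (LinearMap.mulLeft ℚ x) := by
      rw [injective_iff_map_eq_zero]
      intro y hy
      have hy : x * y = 0 := hy
      apply hinj
      rw [map_zero, Algebra.TensorProduct.includeRight_apply]
      rw [← hu.mul_right_eq_zero, Algebra.TensorProduct.tmul_mul_tmul, hy, TensorProduct.tmul_zero]
    obtain ⟨y, hy⟩ := LinearMap.injective_iff_surjective.1 hli 1
    have hy : x * y = 1 := hy
    refine ⟨⟨x, y, hy, ?_⟩, rfl⟩
    apply hli
    change x * (y * x) = x * 1
    rw [← mul_assoc, hy, one_mul, mul_one]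
  let _ : DivisionRing A := DivisionRing.ofIsUnitOrEqZero hdiv
  have : CharZero A := algebraRat.charZero A
  exact Eich.main_thm p hp hA Λ hΛ hmax

end
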